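/- Let α ∈ (0,1) and p > 1 be real, and consider case sgn, n(x) = x·|x|^(p−1). Then there exist a speed c with 0 < c < (p/(p−1))·∫_{−π}^{π}|K_α(x)|dx and a nontrivial steady solution φ with speed c such that: φ is even; φ satisfies the antisymmetry φ(x + π) = −φ(x) for all x (antisymmetry about −π/2), so that φ(−π) = −μ ≤ φ(x) ≤ μ = φ(0) for all x; φ is globally α-Hölder continuous, i.e. there is C > 0 with |φ(x) − φ(y)| ≤ C·|x − y|^α for all x, y; φ is strictly increasing on (−π,0) and infinitely differentiable at every point of (−π,0) ∪ (0,π) except possibly at the points where φ vanishes; and there exist δ, c₁, c₂ > 0 such that c₁·|x|^α ≤ μ − φ(x) ≤ c₂·|x|^α and c₁·|x + π|^α ≤ φ(x) + μ ≤ c₂·|x + π|^α for all x with |x| ≤ δ and |x + π| ≤ δ respectively. -/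

import Mathlib

open Real MeasureTheory Set Filter Topology

/-- The periodic convolution kernel `K_α`: equal to the explicit integral
representation for `x ∉ 2πℤ` and to `0` on `2πℤ`. -/
noncomputable def Kker (α x : ℝ) : ℝ :=
  letI : Decidable (∃ k : ℤ, x = 2 * π * k) := Classical.propDecidable _
  if ∃ k : ℤ, x = 2 * π * k then 0
  else (1 / (π * Real.Gamma α)) *
    ∫ t in Set.Ioi (0:ℝ),
      t ^ (α - 1) * (Real.exp t * Real.cos x - 1) /
        (1 - 2 * Real.exp t * Real.cos x + Real.exp (2 * t))

/-- A steady travelling-wave solution of speed `c` with nonlinearity `n`: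
a continuous, `2π`-periodic, zero-mean function `φ` satisfying the steady
convolution equation. -/
def IsSteadySolution (α c : ℝ) (n φ : ℝ → ℝ) : Prop :=
  Continuous φ ∧ Function.Periodic φ (2 * π) ∧
  (∫ y in (-π)..π, φ y) = 0 ∧
  ∀ x : ℝ, (∫ y in (-π)..π, Kker α (x - y) * φ y) =
    c * φ x - n (φ x) + (1 / (2 * π)) * ∫ y in (-π)..π, n (φ y)

/-- Case abs nonlinearity `n(x) = |x|^p`. -/
noncomputable def nAbs (p x : ℝ) : ℝ := |x| ^ p
/-- Case sgn nonlinearity `n(x) = x·|x|^(p-1)`. -/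
noncomputable def nSgn (p x : ℝ) : ℝ := x * |x| ^ (p - 1)
/-- Derivative of the case abs nonlinearity, `n′(x) = p·x·|x|^(p-2)`. -/
noncomputable def nAbs' (p x : ℝ) : ℝ := p * x * |x| ^ (p - 2)
/-- Derivative of the case sgn nonlinearity, `n′(x) = p·|x|^(p-1)`. -/
noncomputable def nSgn' (p x : ℝ) : ℝ := p * |x| ^ (p - 1)





lemma det_one_add_smul_poly {ι : Type*} [Fintype ι] [DecidableEq ι] (M : Matrix ι ι ℝ) (t : ℝ) :
    (1 + t • M).det = ∑ j ∈ Finset.range (Fintype.card ι + 1),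
      (Lagrange.basis (Finset.range (Fintype.card ι + 1)) (fun i : ℕ => (i : ℝ)) j).eval t *
        (1 + (j : ℝ) • M).det := by
  classical
  set P : Polynomial ℝ := Matrix.det ((Polynomial.X : Polynomial ℝ) • M.map Polynomial.C +
    (1 : Matrix ι ι ℝ).map Polynomial.C) with hP
  have hev : ∀ s : ℝ, P.eval s = (1 + s • M).det := by
    intro s
    rw [hP, ← Polynomial.coe_evalRingHom, RingHom.map_det]
    congr 1
    ext i j
    simp [Matrix.one_apply]
    by_cases h : i = j <;> simp [h, add_comm, mul_comm]
  have hdeg : P.degree < (Finset.range (Fintype.card ι + 1)).card := by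
    have h1 := Polynomial.natDegree_det_X_add_C_le M (1 : Matrix ι ι ℝ)
    refine lt_of_le_of_lt Polynomial.degree_le_natDegree ?_
    rw [Finset.card_range]
    exact_mod_cast Nat.lt_succ_of_le h1
  have hinj : Set.InjOn (fun i : ℕ => (i : ℝ)) (Finset.range (Fintype.card ι + 1)) := by
    intro a _ b _ h
    simpa using h
  have h := Lagrange.eq_interpolate hinj hdeg
  rw [← hev, h, Lagrange.interpolate_apply, Polynomial.eval_finsetSum]
  refine Finset.sum_congr rfl fun j _ => ?_
  rw [Polynomial.eval_mul, Polynomial.eval_C, hev, mul_comm]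

lemma clm_det_poly {n : ℕ} (A : EuclideanSpace ℝ (Fin n) →L[ℝ] EuclideanSpace ℝ (Fin n)) (t : ℝ) :
    (ContinuousLinearMap.id ℝ _ + t • A).det = ∑ j ∈ Finset.range (n + 1),
      (Lagrange.basis (Finset.range (n + 1)) (fun i : ℕ => (i : ℝ)) j).eval t *
        (ContinuousLinearMap.id ℝ _ + (j : ℝ) • A).det := by
  obtain ⟨b, -⟩ : ∃ b : Module.Basis (Fin n) ℝ (EuclideanSpace ℝ (Fin n)), True :=
    ⟨(EuclideanSpace.basisFun (Fin n) ℝ).toBasis, trivial⟩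
  have key : ∀ s : ℝ, (ContinuousLinearMap.id ℝ _ + s • A).det =
      (1 + s • LinearMap.toMatrix b b A.toLinearMap).det := by
    intro s
    rw [ContinuousLinearMap.det, ← LinearMap.det_toMatrix b]
    congr 1
    simp
  simp only [key]
  have := det_one_add_smul_poly (LinearMap.toMatrix b b A.toLinearMap) t
  simpa using this

lemma det_pos_of_small {n : ℕ} (A : EuclideanSpace ℝ (Fin n) →L[ℝ] EuclideanSpace ℝ (Fin n))
    (h : ‖A‖ < 1) : 0 < (ContinuousLinearMap.id ℝ _ + A).det := by
  have hne : ∀ s ∈ Icc (0:ℝ) 1, (ContinuousLinearMap.id ℝ _ + s • A).det ≠ 0 := by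
    intro s hs h0
    have h1 := LinearMap.bot_lt_ker_of_det_eq_zero (f := (ContinuousLinearMap.id ℝ _ + s • A).toLinearMap) h0
    obtain ⟨v, hv, hv0⟩ := (Submodule.ne_bot_iff _).1 h1.ne'
    have h2 : v + s • A v = 0 := by simpa using hv
    have h3 : ‖v‖ = ‖s • A v‖ := by
      rw [eq_neg_of_add_eq_zero_left h2, norm_neg, ]
      rw [← eq_neg_of_add_eq_zero_left h2]
    have h4 : ‖s • A v‖ ≤ ‖A‖ * ‖v‖ := by
      rw [norm_smul]
      have := A.le_opNorm v
      have h5 : ‖s‖ ≤ 1 := by rw [Real.norm_eq_abs, abs_of_nonneg hs.1]; exact hs.2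
      calc ‖s‖ * ‖A v‖ ≤ 1 * ‖A v‖ := by gcongr
        _ ≤ _ := by simpa using this
    have h6 : 0 < ‖v‖ := norm_pos_iff.2 hv0
    nlinarith
  by_contra hcon
  push Not at hcon
  have hc : ContinuousOn (fun s : ℝ => (ContinuousLinearMap.id ℝ _ + s • A).det) (Icc 0 1) := by
    apply Continuous.continuousOn
    exact ContinuousLinearMap.continuous_det.comp (by fun_prop)
  have := intermediate_value_Icc' (zero_le_one) hc
  have h0 : (0:ℝ) ∈ Icc ((fun s : ℝ => (ContinuousLinearMap.id ℝ _ + s • A).det) 1)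
     ((fun s : ℝ => (ContinuousLinearMap.id ℝ _ + s • A).det) 0) := by
    constructor
    · simpa using hcon
    · simp [ContinuousLinearMap.det]
  obtain ⟨s, hs, hs0⟩ := this h0
  exact hne s hs hs0

lemma lipschitz_ext_zero {E : Type*} [NormedAddCommGroup E] [NormedSpace ℝ E] (g : E → E) (L : ℝ)
    (hL : 0 ≤ L)
    (hg : ∀ x y, ‖x‖ ≤ 1 → ‖y‖ ≤ 1 → ‖g x - g y‖ ≤ L * ‖x - y‖) (hz : ∀ x, ‖x‖ = 1 → g x = 0)
    (G : E → E) (hG1 : ∀ x, ‖x‖ ≤ 1 → G x = g x) (hG2 : ∀ x, 1 < ‖x‖ → G x = 0) :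
    ∀ x y, ‖G x - G y‖ ≤ L * ‖x - y‖ := by
  have aux : ∀ x y, ‖x‖ ≤ 1 → 1 < ‖y‖ → ‖G x‖ ≤ L * ‖x - y‖ := by
    intro x y hx hy
    have hc : ContinuousOn (fun s : ℝ => ‖x + s • (y - x)‖) (Icc 0 1) := by fun_prop
    have h0 : (1:ℝ) ∈ Icc ((fun s : ℝ => ‖x + s • (y - x)‖) 0) ((fun s : ℝ => ‖x + s • (y - x)‖) 1) := by
      constructor
      · simpa using hx
      · simpa using hy.le
    obtain ⟨s, hs, hs1⟩ := intermediate_value_Icc zero_le_one hc h0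
    simp only at hs1
    have h1 := hg x (x + s • (y - x)) hx hs1.le
    rw [hz _ hs1, sub_zero] at h1
    rw [hG1 x hx]
    refine h1.trans ?_
    have : ‖x - (x + s • (y - x))‖ = s * ‖x - y‖ := by
      rw [sub_add_cancel_left, norm_neg, norm_smul, Real.norm_eq_abs, abs_of_nonneg hs.1, norm_sub_rev]
    rw [this]
    have : s * ‖x - y‖ ≤ 1 * ‖x - y‖ := by gcongr; exact hs.2
    rw [one_mul] at this
    gcongr
  intro x y
  rcases le_or_gt ‖x‖ 1 with hx | hx <;> rcases le_or_gt ‖y‖ 1 with hy | hy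
  · rw [hG1 x hx, hG1 y hy]; exact hg x y hx hy
  · rw [hG2 y hy, sub_zero]; exact aux x y hx hy
  · rw [hG2 x hx, zero_sub, norm_neg, norm_sub_rev]; exact aux y x hy hx
  · rw [hG2 x hx, hG2 y hy]; simp; positivity


lemma no_smooth_retraction {n : ℕ} (r : EuclideanSpace ℝ (Fin n) → EuclideanSpace ℝ (Fin n))
    (hr : ∀ x, ‖x‖ ≤ 1 → ContDiffAt ℝ 1 r x) (hr1 : ∀ x, ‖x‖ ≤ 1 → ‖r x‖ = 1)
    (hr2 : ∀ x, ‖x‖ = 1 → r x = x) : False := by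
  classical
  set B : Set (EuclideanSpace ℝ (Fin n)) := Metric.closedBall 0 1 with hB
  have memB : ∀ x, x ∈ B ↔ ‖x‖ ≤ 1 := fun x => by simp [hB]
  have hBc : IsCompact B := isCompact_closedBall _ _
  set A : EuclideanSpace ℝ (Fin n) → (EuclideanSpace ℝ (Fin n) →L[ℝ] EuclideanSpace ℝ (Fin n)) :=
    fun x => fderiv ℝ r x - ContinuousLinearMap.id ℝ _ with hA
  set g : EuclideanSpace ℝ (Fin n) → EuclideanSpace ℝ (Fin n) := fun x => r x - x with hg
  have hgA : ∀ x ∈ B, HasFDerivAt g (A x) x := by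
    intro x hx
    exact ((hr x ((memB x).1 hx)).differentiableAt (by norm_num)).hasFDerivAt.sub (hasFDerivAt_id x)
  have hAc : ContinuousOn A B := by
    intro x hx
    have h1 : ContinuousAt (fderiv ℝ r) x :=
      ((hr x ((memB x).1 hx)).fderiv_right (m := 0) (by norm_num)).continuousAt
    exact (h1.sub continuousAt_const).continuousWithinAt
  obtain ⟨L0, hL0⟩ := hBc.exists_bound_of_continuousOn hAc
  set L : ℝ := max L0 1 with hLdef
  have hL1 : 1 ≤ L := le_max_right _ _
  have hLpos : 0 < L := by linarith
  have hAL : ∀ x ∈ B, ‖A x‖ ≤ L := fun x hx => (hL0 x hx).trans (le_max_left _ _)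
  have hgL : ∀ x y, ‖x‖ ≤ 1 → ‖y‖ ≤ 1 → ‖g x - g y‖ ≤ L * ‖x - y‖ := by
    intro x y hx hy
    exact (convex_closedBall (0 : EuclideanSpace ℝ (Fin n)) 1).norm_image_sub_le_of_norm_hasFDerivWithin_le
      (fun z hz => (hgA z hz).hasFDerivWithinAt) hAL ((memB y).2 hy) ((memB x).2 hx)
  have hgz : ∀ x, ‖x‖ = 1 → g x = 0 := fun x hx => by simp [hg, hr2 x hx]
  set G : EuclideanSpace ℝ (Fin n) → EuclideanSpace ℝ (Fin n) := fun x => if ‖x‖ ≤ 1 then g x else 0 with hG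
  have hGL := lipschitz_ext_zero g L hLpos.le hgL hgz G (fun x hx => by simp [hG, hx])
    (fun x hx => by simp [hG, not_le.2 hx])
  set F : ℝ → ℝ := fun t => ∫ x in B, (ContinuousLinearMap.id ℝ _ + t • A x).det with hF
  have hdetc : ∀ t : ℝ, ContinuousOn (fun x => (ContinuousLinearMap.id ℝ _ + t • A x).det) B := by
    intro t
    exact ContinuousLinearMap.continuous_det.comp_continuousOn
      (continuousOn_const.add (hAc.const_smul t))
  -- small t
  have hsmall : ∀ t ∈ Ioo (0:ℝ) (1 / (2 * L)), F t = (volume B).toReal := by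
    intro t ht
    have htL : t * L < 1 := by
      have := ht.2
      rw [lt_div_iff₀ (by positivity)] at this
      nlinarith [ht.1]
    have himg : (fun x => x + t • g x) '' B = B := by
      apply Subset.antisymm
      · rintro _ ⟨x, hx, rfl⟩
        rw [memB] at *
        have : x + t • g x = (1 - t) • x + t • r x := by
          simp only [hg]; module
        simp only [this]
        have ht1 : t ≤ 1 := by nlinarith [ht.1]
        calc ‖(1 - t) • x + t • r x‖ ≤ (1 - t) * ‖x‖ + t * ‖r x‖ := by
              refine (norm_add_le _ _).trans (le_of_eq ?_)
              rw [norm_smul, norm_smul, Real.norm_of_nonneg (by linarith), Real.norm_of_nonneg ht.1.le]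
          _ ≤ 1 := by rw [hr1 x hx]; nlinarith [norm_nonneg x]
      · intro y hy
        have hcw : ContractingWith (Real.toNNReal (t * L)) (fun x => y - t • G x) := by
          constructor
          · rw [← NNReal.coe_lt_coe, Real.coe_toNNReal _ (by nlinarith [ht.1])]; simpa using htL
          · apply LipschitzWith.of_dist_le_mul
            intro a b
            rw [Real.coe_toNNReal _ (by nlinarith [ht.1]), dist_eq_norm, dist_eq_norm]
            have : (y - t • G a) - (y - t • G b) = t • (G b - G a) := by module
            rw [this, norm_smul, Real.norm_of_nonneg ht.1.le, mul_assoc, norm_sub_rev a b]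
            have := hGL b a
            have := ht.1
            gcongr
        set x := hcw.fixedPoint with hx
        have hfix : y - t • G x = x := hcw.fixedPoint_isFixedPt
        have hxB : ‖x‖ ≤ 1 := by
          by_contra hcon
          have : G x = 0 := by simp [hG, hcon]
          rw [this, smul_zero, sub_zero] at hfix
          rw [← hfix] at hcon
          exact hcon ((memB y).1 hy)
        refine ⟨x, (memB x).2 hxB, ?_⟩
        have : G x = g x := by simp [hG, hxB]
        rw [this] at hfix
        simp only
        rw [← eq_add_of_sub_eq hfix]
    have hinj : InjOn (fun x => x + t • g x) B := by
      intro x hx y hy hxy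
      simp only at hxy
      have h1 : x - y = t • (g y - g x) := by
        have : x - y = (x + t • g x) - (y + t • g y) + t • (g y - g x) := by module
        rw [this, hxy]; simp
      have h2 := hgL y x ((memB y).1 hy) ((memB x).1 hx)
      have h3 : ‖x - y‖ ≤ t * L * ‖x - y‖ := by
        conv_lhs => rw [h1]
        rw [norm_smul, Real.norm_of_nonneg ht.1.le, mul_assoc, norm_sub_rev x y]
        have := ht.1
        gcongr
      have h4 : ‖x - y‖ = 0 := by nlinarith [norm_nonneg (x - y)]
      exact sub_eq_zero.1 (norm_eq_zero.1 h4)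
    have hder : ∀ x ∈ B, HasFDerivWithinAt (fun x => x + t • g x)
        (ContinuousLinearMap.id ℝ _ + t • A x) B x := by
      intro x hx
      exact ((hasFDerivAt_id x).add ((hgA x hx).const_smul t)).hasFDerivWithinAt
    have hcv := integral_image_eq_integral_abs_det_fderiv_smul (volume) (s := B)
      (Metric.isClosed_closedBall.measurableSet) hder hinj (fun _ => (1:ℝ))
    rw [himg] at hcv
    have : F t = ∫ x in B, |(ContinuousLinearMap.id ℝ _ + t • A x).det| • (1:ℝ) := by
      apply setIntegral_congr_fun Metric.isClosed_closedBall.measurableSet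
      intro x hx
      have : 0 < (ContinuousLinearMap.id ℝ _ + t • A x).det := by
        apply det_pos_of_small
        rw [norm_smul, Real.norm_of_nonneg ht.1.le]
        have := hAL x hx
        nlinarith [ht.1]
      simp only [smul_eq_mul, mul_one]
      rw [abs_of_pos this]
    rw [this, ← hcv]
    simp [Measure.real]
  -- polynomial
  set P : Polynomial ℝ := ∑ j ∈ Finset.range (n + 1),
    Lagrange.basis (Finset.range (n + 1)) (fun i : ℕ => (i : ℝ)) j * Polynomial.C (F j) with hP
  have hPF : ∀ t, F t = P.eval t := by
    intro t
    simp only [hF, hP, Polynomial.eval_finsetSum, Polynomial.eval_mul, Polynomial.eval_C]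
    simp_rw [clm_det_poly _ t]
    rw [integral_finsetSum]
    · refine Finset.sum_congr rfl fun j _ => ?_
      rw [integral_const_mul]
    · intro j _
      exact ((hdetc j).integrableOn_compact hBc).const_mul _
  have hPc : P = Polynomial.C (volume B).toReal := by
    apply Polynomial.eq_of_infinite_eval_eq
    refine Set.Infinite.mono ?_ (Set.Ioo_infinite (a := (0:ℝ)) (b := 1 / (2 * L)) (by positivity))
    intro t ht
    simp only [mem_ofPred_eq, Polynomial.eval_C]
    rw [← hPF, hsmall t ht]
  have hF1 : F 1 = (volume B).toReal := by rw [hPF, hPc]; simp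
  have hvol : 0 < (volume B).toReal :=
    ENNReal.toReal_pos (Metric.measure_closedBall_pos volume _ one_pos).ne' hBc.measure_lt_top.ne
  have hF0 : F 1 = 0 := by
    have hae : (Metric.closedBall (0 : EuclideanSpace ℝ (Fin n)) 1 : Set _) =ᵐ[volume] Metric.ball 0 1 := by
      rw [← Metric.ball_union_sphere]
      have : volume (Metric.sphere (0 : EuclideanSpace ℝ (Fin n)) 1) = 0 :=
        Measure.addHaar_sphere_of_ne_zero _ _ one_ne_zero
      exact union_ae_eq_left_of_ae_eq_empty (ae_eq_empty.2 this)
    simp only [hF, hB]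
    rw [setIntegral_congr_set hae]
    apply setIntegral_eq_zero_of_forall_eq_zero
    intro x hx
    have hxb : ‖x‖ < 1 := by simpa using hx
    have hid : ContinuousLinearMap.id ℝ _ + (1:ℝ) • A x = fderiv ℝ r x := by
      simp [hA]
    rw [hid]
    by_contra hdet
    have hdiff : HasFDerivAt r (fderiv ℝ r x) x :=
      ((hr x hxb.le).differentiableAt (by norm_num)).hasFDerivAt
    have h1 : HasFDerivAt (fun y => inner ℝ (r y) (r y)) _ x := hdiff.inner ℝ hdiff
    have h2 : (fun y => inner ℝ (r y) (r y)) =ᶠ[𝓝 x] fun _ => (1:ℝ) := by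
      filter_upwards [Metric.isOpen_ball.mem_nhds hx] with y hy
      have : ‖y‖ < 1 := by simpa using hy
      rw [real_inner_self_eq_norm_sq, hr1 y this.le]; norm_num
    have h3 := (h1.congr_of_eventuallyEq h2.symm).unique (hasFDerivAt_const (1:ℝ) x)
    have hsurj : Function.Surjective (fderiv ℝ r x) := by
      have := LinearEquiv.ofIsUnitDet (f := (fderiv ℝ r x).toLinearMap)
        (v := (EuclideanSpace.basisFun (Fin n) ℝ).toBasis)
        (v' := (EuclideanSpace.basisFun (Fin n) ℝ).toBasis) (by
          rw [LinearMap.det_toMatrix]; exact isUnit_iff_ne_zero.2 hdet)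
      exact ((LinearMap.equivOfDetNeZero (fderiv ℝ r x).toLinearMap hdet).surjective)
    obtain ⟨v, hv⟩ := hsurj (r x)
    have h4 := congrArg (fun T => T v) h3
    simp [fderivInnerCLM_apply, hv] at h4
    have h5 := hr1 x hxb.le
    rw [h4] at h5
    simp at h5
  linarith

lemma brouwer_smooth {n : ℕ} (f : EuclideanSpace ℝ (Fin n) → EuclideanSpace ℝ (Fin n))
    (hf : ContDiff ℝ 1 f) (hm : ∀ x, ‖x‖ ≤ 1 → ‖f x‖ ≤ 1) : ∃ x, ‖x‖ ≤ 1 ∧ f x = x := by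
  by_contra hcon
  push Not at hcon
  set d : EuclideanSpace ℝ (Fin n) → EuclideanSpace ℝ (Fin n) := fun x => x - f x with hd
  have hd0 : ∀ x, ‖x‖ ≤ 1 → d x ≠ 0 := fun x hx h => hcon x hx (sub_eq_zero.1 h).symm
  have hdn : ∀ x, ‖x‖ ≤ 1 → 0 < ‖d x‖ ^ 2 := fun x hx => by
    have := norm_pos_iff.2 (hd0 x hx); positivity
  set D : EuclideanSpace ℝ (Fin n) → ℝ := fun x => (inner ℝ x (d x)) ^ 2 + ‖d x‖ ^ 2 * (1 - ‖x‖ ^ 2) with hD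
  have hin : ∀ x, ‖x‖ = 1 → 0 < inner ℝ x (d x) := by
    intro x hx
    have h1 : inner ℝ x (d x) = 1 - inner ℝ x (f x) := by
      simp only [hd, inner_sub_right, real_inner_self_eq_norm_sq, hx]; norm_num
    have h2 := hdn x hx.le
    have h3 : ‖d x‖ ^ 2 = 1 - 2 * inner ℝ x (f x) + ‖f x‖ ^ 2 := by
      simp only [hd, norm_sub_sq_real, hx]; norm_num
    have h4 := hm x hx.le
    have h5 : ‖f x‖ ^ 2 ≤ 1 := by nlinarith [norm_nonneg (f x)]
    linarith
  have hDpos : ∀ x, ‖x‖ ≤ 1 → 0 < D x := by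
    intro x hx
    rcases hx.lt_or_eq with h | h
    · have := hdn x hx
      have h2 : 0 < 1 - ‖x‖ ^ 2 := by nlinarith [norm_nonneg x]
      simp only [hD]; positivity
    · have := hin x h
      simp only [hD, h]
      nlinarith
  have hdc : ContDiff ℝ 1 d := contDiff_id.sub hf
  have hDc : ContDiff ℝ 1 D := by
    simp only [hD]
    exact ((contDiff_id.inner ℝ hdc).pow 2).add ((hdc.norm_sq ℝ).mul (contDiff_const.sub (contDiff_id.norm_sq ℝ)))
  set τ : EuclideanSpace ℝ (Fin n) → ℝ := fun x => (-(inner ℝ x (d x)) + √(D x)) / ‖d x‖ ^ 2 with hτ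
  refine no_smooth_retraction (fun x => x + τ x • d x) ?_ ?_ ?_
  · intro x hx
    have h1 : ContDiffAt ℝ 1 τ x := by
      refine ContDiffAt.div ?_ (hdc.norm_sq ℝ).contDiffAt (hdn x hx).ne'
      exact ((contDiff_id.inner ℝ hdc).neg.contDiffAt).add (hDc.contDiffAt.sqrt (hDpos x hx).ne')
    exact contDiffAt_id.add (h1.smul hdc.contDiffAt)
  · intro x hx
    have h1 : ‖x + τ x • d x‖ ^ 2 = 1 := by
      rw [norm_add_sq_real, norm_smul, inner_smul_right, mul_pow, Real.norm_eq_abs, sq_abs]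
      have h2 := Real.sq_sqrt (hDpos x hx).le
      have h3 := (hdn x hx).ne'
      simp only [hτ]
      generalize hs : √(D x) = s at *
      simp only [hD] at h2
      generalize inner ℝ x (d x) = a at *
      generalize ‖d x‖ ^ 2 = b at *
      field_simp
      nlinarith
    have h2 := norm_nonneg (x + τ x • d x)
    nlinarith
  · intro x hx
    have : τ x = 0 := by
      simp only [hτ, hD, hx]
      norm_num
      left
      rw [Real.sqrt_sq (hin x hx).le]; ring
    simp [this]

lemma brouwer_ball {n : ℕ} (f : EuclideanSpace ℝ (Fin n) → EuclideanSpace ℝ (Fin n))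
    (hf : Continuous f) (hm : ∀ x, ‖x‖ ≤ 1 → ‖f x‖ ≤ 1) : ∃ x, ‖x‖ ≤ 1 ∧ f x = x := by
  have happ : ∀ ε : ℝ, 0 < ε → ∃ x, ‖x‖ ≤ 1 ∧ ‖f x - x‖ ≤ 2 * ε := by
    intro ε hε
    obtain ⟨g, hg2, hg1, -⟩ := hf.exists_contDiff_approx 1 (ε := fun _ => ε) continuous_const (fun _ => hε)
    obtain ⟨x, hx, hfx⟩ := brouwer_smooth (fun x => (1 / (1 + ε)) • g x) (ContDiff.const_smul _ (by simpa using hg2)) (by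
      intro x hx
      rw [norm_smul, Real.norm_of_nonneg (by positivity), div_mul_eq_mul_div, one_mul, div_le_one (by positivity)]
      have h1 := hg1 x
      rw [dist_eq_norm] at h1
      have h2 := hm x hx
      have h3 : ‖g x‖ ≤ ‖g x - f x‖ + ‖f x‖ := by simpa using norm_add_le (g x - f x) (f x)
      linarith)
    refine ⟨x, hx, ?_⟩
    have h1 := hg1 x
    rw [dist_eq_norm] at h1
    have h4 : g x = (1 + ε) • x := by
      have h6 : (1 + ε) • ((1 / (1 + ε)) • g x) = g x := by
        rw [smul_smul, mul_one_div_cancel (by positivity), one_smul]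
      rw [← h6, hfx]
    have h5 : f x - x = -(g x - f x) + ε • x := by rw [h4]; module
    rw [h5]
    refine (norm_add_le _ _).trans ?_
    rw [norm_neg, norm_smul, Real.norm_of_nonneg hε.le]
    nlinarith
  have hc : IsCompact (Metric.closedBall (0 : EuclideanSpace ℝ (Fin n)) 1) := isCompact_closedBall _ _
  obtain ⟨x, hx, hmin⟩ := hc.exists_isMinOn ⟨0, by simp⟩ (f := fun x => ‖f x - x‖) (by fun_prop)
  refine ⟨x, by simpa using hx, ?_⟩
  by_contra hne
  have hpos : 0 < ‖f x - x‖ := norm_pos_iff.2 (sub_ne_zero.2 hne)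
  obtain ⟨y, hy, hy2⟩ := happ (‖f x - x‖ / 4) (by positivity)
  have : ‖f x - x‖ ≤ ‖f y - y‖ := hmin (by simpa using hy : y ∈ Metric.closedBall _ _)
  linarith


lemma brouwer_simplex {n : ℕ} (hn : 0 < n) (f : (Fin n → ℝ) → (Fin n → ℝ))
    (hf : ContinuousOn f (stdSimplex ℝ (Fin n))) (hm : MapsTo f (stdSimplex ℝ (Fin n)) (stdSimplex ℝ (Fin n))) :
    ∃ w ∈ stdSimplex ℝ (Fin n), f w = w := by
  set y : (Fin n → ℝ) → (Fin n → ℝ) := fun x i => max (x i) 0 + max (1 - ∑ j, max (x j) 0) 0 with hy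
  have hynn : ∀ x i, 0 ≤ y x i := fun x i => by simp only [hy]; positivity
  have hysum : ∀ x, 1 ≤ ∑ i, y x i := by
    intro x
    simp only [hy, Finset.sum_add_distrib, Finset.sum_const, Finset.card_univ, Fintype.card_fin, nsmul_eq_mul]
    have h1 : (1:ℝ) ≤ n := by exact_mod_cast hn
    have h2 := le_max_left (1 - ∑ j, max (x j) 0) 0
    have h3 := le_max_right (1 - ∑ j, max (x j) 0) 0
    nlinarith
  have hyc : Continuous y := by fun_prop
  set r : (Fin n → ℝ) → (Fin n → ℝ) := fun x i => y x i / ∑ j, y x j with hr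
  have hrm : ∀ x, r x ∈ stdSimplex ℝ (Fin n) := by
    intro x
    have := hysum x
    refine ⟨fun i => div_nonneg (hynn x i) (by linarith), ?_⟩
    simp only [hr]
    rw [← Finset.sum_div, div_self (by linarith)]
  have hrc : Continuous r := by
    refine continuous_pi fun i => ?_
    refine Continuous.div (by fun_prop) (by fun_prop) fun x => ?_
    have := hysum x
    linarith
  have hrid : ∀ x ∈ stdSimplex ℝ (Fin n), r x = x := by
    intro x hx
    have h1 : ∀ i, max (x i) 0 = x i := fun i => max_eq_left (hx.1 i)
    have h2 : y x = x := by
      ext i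
      simp only [hy, h1, hx.2]; simp
    ext i
    simp only [hr, h2, hx.2]; simp
  have hfr : Continuous (fun x => f (r x)) := by
    exact hf.comp_continuous hrc hrm
  have hnorm : ∀ x ∈ stdSimplex ℝ (Fin n), ‖WithLp.toLp 2 x‖ ≤ 1 := by
    intro x hx
    have h1 : ‖WithLp.toLp 2 x‖ ^ 2 ≤ 1 := by
      rw [EuclideanSpace.norm_sq_eq]
      simp only [Real.norm_eq_abs, sq_abs]
      rw [← hx.2]
      refine Finset.sum_le_sum fun i _ => ?_
      have h2 := hx.1 i
      have h3 : x i ≤ 1 := by rw [← hx.2]; exact Finset.single_le_sum (fun j _ => hx.1 j) (Finset.mem_univ i)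
      nlinarith
    nlinarith [norm_nonneg (WithLp.toLp 2 x)]
  obtain ⟨x, -, hx⟩ := brouwer_ball (n := n) (fun x => WithLp.toLp 2 (f (r (WithLp.ofLp x))))
    (by
      exact (PiLp.continuous_toLp 2 _).comp (hfr.comp (PiLp.continuous_ofLp 2 _)))
    (fun x _ => hnorm _ (hm (hrm _)))
  have hx' : f (r (WithLp.ofLp x)) = WithLp.ofLp x := by
    conv_rhs => rw [← hx]
  have hxs : WithLp.ofLp x ∈ stdSimplex ℝ (Fin n) := by
    rw [← hx']; exact hm (hrm _)
  refine ⟨_, hxs, ?_⟩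
  rw [hrid _ hxs] at hx'
  exact hx'

theorem schauder_fixed_point {E : Type*} [NormedAddCommGroup E] [NormedSpace ℝ E] (S C : Set E)
    (hSne : S.Nonempty) (hSc : Convex ℝ S) (hScl : IsClosed S) (hC : IsCompact C) (T : E → E)
    (hT : ContinuousOn T S) (hTS : MapsTo T S S) (hTC : MapsTo T S C) : ∃ x ∈ S, T x = x := by
  have happ : ∀ ε : ℝ, 0 < ε → ∃ z ∈ S, ‖T z - z‖ ≤ ε := by
    intro ε hε
    have htb : TotallyBounded (T '' S) := hC.totallyBounded.subset (image_subset_iff.2 hTC)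
    obtain ⟨t, htS, htf, htc⟩ := Metric.finite_approx_of_totallyBounded htb ε hε
    obtain ⟨n, x, -, hx⟩ := htf.fin_param
    have hxS : ∀ i, x i ∈ S := by
      intro i
      have : x i ∈ t := hx ▸ mem_range_self i
      obtain ⟨s, hs, hs2⟩ := htS this
      rw [← hs2]; exact hTS hs
    have hcov : ∀ s ∈ S, ∃ i, dist (T s) (x i) < ε := by
      intro s hs
      have := htc (mem_image_of_mem T hs)
      simp only [mem_iUnion, Metric.mem_ball] at this
      obtain ⟨y, hy, hy2⟩ := this
      rw [← hx] at hy
      obtain ⟨i, rfl⟩ := hy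
      exact ⟨i, hy2⟩
    have hn : 0 < n := by
      obtain ⟨s, hs⟩ := hSne
      obtain ⟨i, -⟩ := hcov s hs
      exact i.pos
    set Φ : (Fin n → ℝ) → E := fun w => ∑ i, w i • x i with hΦ
    have hΦS : ∀ w ∈ stdSimplex ℝ (Fin n), Φ w ∈ S := fun w hw =>
      hSc.sum_mem (fun i _ => hw.1 i) hw.2 (fun i _ => hxS i)
    have hΦc : Continuous Φ := by fun_prop
    set l : (Fin n → ℝ) → Fin n → ℝ := fun w i => max (ε - dist (T (Φ w)) (x i)) 0 with hl
    have hlnn : ∀ w i, 0 ≤ l w i := fun w i => le_max_right _ _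
    have hlpos : ∀ w ∈ stdSimplex ℝ (Fin n), 0 < ∑ i, l w i := by
      intro w hw
      obtain ⟨i, hi⟩ := hcov _ (hΦS w hw)
      refine lt_of_lt_of_le ?_ (Finset.single_le_sum (fun j _ => hlnn w j) (Finset.mem_univ i))
      simp only [hl]
      exact lt_max_of_lt_left (by linarith)
    have hTΦ : ContinuousOn (fun w => T (Φ w)) (stdSimplex ℝ (Fin n)) :=
      hT.comp hΦc.continuousOn hΦS
    have hlc : ∀ i, ContinuousOn (fun w => l w i) (stdSimplex ℝ (Fin n)) := by
      intro i
      simp only [hl]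
      intro w hw
      have h1 : Tendsto (fun w => T (Φ w)) (𝓝[stdSimplex ℝ (Fin n)] w) (𝓝 (T (Φ w))) := hTΦ w hw
      exact (tendsto_const_nhds.sub (h1.dist tendsto_const_nhds)).max tendsto_const_nhds
    obtain ⟨w, hw, hwf⟩ := brouwer_simplex hn (fun w i => l w i / ∑ j, l w j)
      (by
        refine continuousOn_pi.2 fun i => ?_
        refine (hlc i).div ?_ (fun w hw => (hlpos w hw).ne')
        exact continuousOn_finsetSum _ fun j _ => hlc j)
      (by
        intro w hw
        refine ⟨fun i => div_nonneg (hlnn w i) (hlpos w hw).le, ?_⟩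
        simp only
        rw [← Finset.sum_div, div_self (hlpos w hw).ne'])
    refine ⟨Φ w, hΦS w hw, ?_⟩
    have h1 : T (Φ w) - Φ w = ∑ i, w i • (T (Φ w) - x i) := by
      simp only [smul_sub, Finset.sum_sub_distrib, ← Finset.sum_smul]
      rw [hw.2, one_smul]
    rw [h1]
    refine (norm_sum_le _ _).trans ?_
    have h2 : ∀ i ∈ Finset.univ, ‖w i • (T (Φ w) - x i)‖ ≤ w i * ε := by
      intro i _
      rw [norm_smul, Real.norm_of_nonneg (hw.1 i)]
      by_cases h0 : w i = 0
      · simp [h0]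
      · have h3 : l w i ≠ 0 := by
          intro h4
          apply h0
          rw [← hwf]; simp [h4]
        have h5 : dist (T (Φ w)) (x i) ≤ ε := by
          by_contra h6
          push Not at h6
          apply h3
          simp only [hl]
          exact max_eq_right (by linarith)
        rw [dist_eq_norm] at h5
        exact mul_le_mul_of_nonneg_left h5 (hw.1 i)
    refine (Finset.sum_le_sum h2).trans ?_
    rw [← Finset.sum_mul, hw.2, one_mul]
  choose z hzS hz using fun k : ℕ => happ (1 / ((k:ℝ) + 1)) (by positivity)
  obtain ⟨y, -, φ, hφ, hlim⟩ := hC.tendsto_subseq (fun k => hTC (hzS k))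
  have hd : Tendsto (fun k => T (z (φ k)) - z (φ k)) atTop (𝓝 0) := by
    apply squeeze_zero_norm (fun k => hz (φ k))
    exact tendsto_one_div_add_atTop_nhds_zero_nat.comp hφ.tendsto_atTop
  have hzl : Tendsto (fun k => z (φ k)) atTop (𝓝 y) := by
    have := hlim.sub hd
    simpa using this
  have hyS : y ∈ S := hScl.mem_of_tendsto hzl (Eventually.of_forall fun k => hzS _)
  refine ⟨y, hyS, ?_⟩
  have h1 : Tendsto (fun k => T (z (φ k))) atTop (𝓝 (T y)) := by
    refine (hT y hyS).tendsto.comp ?_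
    exact tendsto_nhdsWithin_iff.2 ⟨hzl, Eventually.of_forall fun k => hzS _⟩
  exact tendsto_nhds_unique h1 hlim


/-- the denominator -/
noncomputable def den (t s : ℝ) : ℝ := Real.exp t + Real.exp (-t) - 2 + 2 * s

noncomputable def kfun (α s : ℝ) : ℝ :=
  ∫ t in Set.Ioi (0:ℝ), t ^ (α - 1) * ((1 - Real.exp (-t) - s) / den t s)

noncomputable def Jk (α : ℝ) (n : ℕ) (s : ℝ) : ℝ :=
  ∫ t in Set.Ioi (0:ℝ), t ^ (α - 1) * (Real.sinh t / den t s ^ (n + 2))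

lemma den_ge_exp (t s m : ℝ) (h0 : 0 ≤ m) (hm1 : m ≤ 1) (hms : m ≤ s) :
    m * Real.exp t ≤ den t s := by
  unfold den
  have h1 : Real.exp t * Real.exp (-t) = 1 := by rw [← Real.exp_add]; simp
  have hx := Real.exp_pos t
  have hy := Real.exp_pos (-t)
  have h2 : Real.exp t + Real.exp (-t) ≥ 2 := by
    nlinarith [sq_nonneg (Real.exp t - Real.exp (-t))]
  nlinarith [mul_le_mul_of_nonneg_left h2 (sub_nonneg.2 hm1), mul_nonneg h0 hy.le]

lemma den_pos {t s : ℝ} (hs : 0 < s) : 0 < den t s := by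
  have : 0 < min 1 s := lt_min one_pos hs
  have h := den_ge_exp t s (min 1 s) this.le (min_le_left _ _) (min_le_right _ _)
  have := Real.exp_pos t
  nlinarith [mul_pos ‹0 < min 1 s› this]

lemma hasDerivAt_den (t s : ℝ) : HasDerivAt (fun s => den t s) 2 s := by
  unfold den
  simpa using ((hasDerivAt_id s).const_mul 2).const_add (Real.exp t + Real.exp (-t) - 2)

lemma continuous_den (s : ℝ) : Continuous (fun t => den t s) := by
  unfold den; fun_prop

lemma int_rpow_exp {α : ℝ} (hα : 0 < α) (C : ℝ) :
    Integrable (fun t => t ^ (α - 1) * (C * Real.exp (-t))) (volume.restrict (Set.Ioi (0:ℝ))) := by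
  have h := (Real.GammaIntegral_convergent hα).const_mul C
  refine Integrable.congr h ?_
  filter_upwards with t
  ring

lemma sinh_le_exp (t : ℝ) : Real.sinh t ≤ Real.exp t := by
  rw [Real.sinh_eq]; nlinarith [Real.exp_pos t, Real.exp_pos (-t)]

lemma ae_meas_rpow_mul {α : ℝ} {f : ℝ → ℝ} (hf : Measurable f) :
    AEStronglyMeasurable (fun t => t ^ (α - 1) * f t) (volume.restrict (Set.Ioi (0:ℝ))) := by
  apply Measurable.aestronglyMeasurable
  exact (measurable_id.pow_const _).mul hf

lemma Jk_bound {t s m : ℝ} (n : ℕ) (ht : 0 < t) (hm : 0 < m) (hm1 : m ≤ 1) (hms : m ≤ s) :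
    |Real.sinh t / den t s ^ (n + 2)| ≤ (1 / m ^ (n + 2)) * Real.exp (-t) := by
  have hs : 0 < s := lt_of_lt_of_le hm hms
  have hd := den_pos (t := t) hs
  have h1 := den_ge_exp t s m hm.le hm1 hms
  have he := Real.exp_pos t
  have hsinh : 0 < Real.sinh t := Real.sinh_pos_iff.2 ht
  rw [abs_of_pos (by positivity)]
  rw [div_le_iff₀ (by positivity)]
  have h2 : m ^ (n+2) * Real.exp t ^ 2 ≤ den t s ^ (n+2) := by
    calc m ^ (n+2) * Real.exp t ^ 2 ≤ m ^ (n+2) * Real.exp t ^ (n+2) := by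
          gcongr
          · exact Real.one_le_exp ht.le
          · omega
      _ = (m * Real.exp t) ^ (n+2) := by rw [mul_pow]
      _ ≤ _ := by gcongr
  have h3 : Real.exp (-t) * Real.exp t = 1 := by rw [← Real.exp_add]; simp
  calc Real.sinh t ≤ Real.exp t := sinh_le_exp t
    _ = 1 / m ^ (n + 2) * Real.exp (-t) * (m ^ (n+2) * Real.exp t ^ 2) := by
        have : 1 / m ^ (n + 2) * Real.exp (-t) * (m ^ (n+2) * Real.exp t ^ 2)
          = (m^(n+2) / m^(n+2)) * (Real.exp (-t) * Real.exp t) * Real.exp t := by ring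
        rw [this, h3, div_self (by positivity)]; ring
    _ ≤ _ := by gcongr

lemma kf_bound {t s m M : ℝ} (ht : 0 < t) (hm : 0 < m) (hm1 : m ≤ 1) (hms : m ≤ s) (hM : s ≤ M) :
    |(1 - Real.exp (-t) - s) / den t s| ≤ ((1 + M) / m) * Real.exp (-t) := by
  have hs : 0 < s := lt_of_lt_of_le hm hms
  have hd := den_pos (t := t) hs
  have h1 := den_ge_exp t s m hm.le hm1 hms
  have he := Real.exp_pos t
  rw [abs_div, abs_of_pos hd, div_le_iff₀ hd]
  have h3 : Real.exp (-t) * Real.exp t = 1 := by rw [← Real.exp_add]; simp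
  have h4 : Real.exp (-t) < 1 := by rw [Real.exp_lt_one_iff]; linarith
  have h5 := Real.exp_pos (-t)
  calc |1 - Real.exp (-t) - s| ≤ 1 + M := by rw [abs_le]; constructor <;> linarith
    _ = (1 + M) / m * Real.exp (-t) * (m * Real.exp t) := by
        have : (1 + M) / m * Real.exp (-t) * (m * Real.exp t) =
          (1 + M) * (m / m) * (Real.exp (-t) * Real.exp t) := by ring
        rw [this, h3, div_self hm.ne']; ring
    _ ≤ _ := by
        have : 0 ≤ (1 + M) / m := div_nonneg (by linarith) hm.le
        gcongr

lemma meas_J (n : ℕ) (s : ℝ) : Measurable (fun t => Real.sinh t / den t s ^ (n + 2)) :=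
  (Real.continuous_sinh.measurable).div ((continuous_den s).measurable.pow_const _)

lemma meas_kf (s : ℝ) : Measurable (fun t => (1 - Real.exp (-t) - s) / den t s) :=
  Measurable.div (by fun_prop) (continuous_den s).measurable

lemma Jk_integrable {α s : ℝ} (hα : 0 < α) (hs : 0 < s) (n : ℕ) :
    Integrable (fun t => t ^ (α - 1) * (Real.sinh t / den t s ^ (n + 2)))
      (volume.restrict (Set.Ioi (0:ℝ))) := by
  refine Integrable.mono' (int_rpow_exp hα (1 / (min 1 s) ^ (n+2))) (ae_meas_rpow_mul (meas_J n s)) ?_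
  filter_upwards [ae_restrict_mem measurableSet_Ioi] with t ht
  have ht : 0 < t := ht
  rw [norm_mul, Real.norm_of_nonneg (by positivity), Real.norm_eq_abs]
  gcongr
  exact Jk_bound n ht (lt_min one_pos hs) (min_le_left _ _) (min_le_right _ _)

lemma kf_integrable {α s : ℝ} (hα : 0 < α) (hs : 0 < s) :
    Integrable (fun t => t ^ (α - 1) * ((1 - Real.exp (-t) - s) / den t s))
      (volume.restrict (Set.Ioi (0:ℝ))) := by
  refine Integrable.mono' (int_rpow_exp hα ((1 + s) / (min 1 s))) (ae_meas_rpow_mul (meas_kf s)) ?_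
  filter_upwards [ae_restrict_mem measurableSet_Ioi] with t ht
  have ht : 0 < t := ht
  rw [norm_mul, Real.norm_of_nonneg (by positivity), Real.norm_eq_abs]
  gcongr
  exact kf_bound ht (lt_min one_pos hs) (min_le_left _ _) (min_le_right _ _) le_rfl

lemma kfun_hasDerivAt {α s : ℝ} (hα : 0 < α) (hs : 0 < s) :
    HasDerivAt (kfun α) (-2 * Jk α 0 s) s := by
  set m := min 1 (s/2) with hm
  have hm0 : 0 < m := lt_min one_pos (by linarith)
  have key := hasDerivAt_integral_of_dominated_loc_of_deriv_le
    (μ := volume.restrict (Set.Ioi (0:ℝ)))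
    (F := fun s t => t ^ (α - 1) * ((1 - Real.exp (-t) - s) / den t s))
    (F' := fun s t => t ^ (α - 1) * (-2 * (Real.sinh t / den t s ^ 2)))
    (x₀ := s) (s := Ioi (s/2))
    (bound := fun t => t ^ (α - 1) * (2 * (1 / m ^ 2) * Real.exp (-t)))
    (Ioi_mem_nhds (by linarith))
    (Eventually.of_forall fun s => ae_meas_rpow_mul (meas_kf s))
    (kf_integrable hα hs)
    (ae_meas_rpow_mul ((meas_J 0 s).const_mul _))
    (by
      filter_upwards [ae_restrict_mem measurableSet_Ioi] with t ht
      intro x hx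
      have ht : 0 < t := ht
      have hx : s/2 < x := hx
      rw [norm_mul, Real.norm_of_nonneg (by positivity), Real.norm_eq_abs, abs_mul]
      have := Jk_bound (s := x) 0 ht hm0 (min_le_left _ _) ((min_le_right _ _).trans hx.le)
      simp only [zero_add] at this
      have h2 : |(-2:ℝ)| = 2 := by norm_num
      rw [h2, mul_assoc 2]
      gcongr)
    (int_rpow_exp hα _)
    (by
      filter_upwards [ae_restrict_mem measurableSet_Ioi] with t ht
      intro x hx
      have hx : s/2 < x := hx
      have hd := den_pos (t := t) (show 0 < x by linarith)
      apply HasDerivAt.const_mul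
      have := ((hasDerivAt_id x).const_sub (1 - Real.exp (-t))).div (hasDerivAt_den t x) hd.ne'
      refine this.congr_deriv ?_
      simp only [id]
      rw [← mul_div_assoc]
      congr 1
      rw [Real.sinh_eq]; unfold den; ring)
  have h2 := key.2
  have e : (∫ t in Set.Ioi (0:ℝ), t ^ (α - 1) * (-2 * (Real.sinh t / den t s ^ 2))) = -2 * Jk α 0 s := by
    unfold Jk
    rw [← integral_const_mul]
    congr 1; ext t; simp only [zero_add]; ring
  rw [e] at h2
  exact h2

lemma Jk_hasDerivAt {α s : ℝ} (hα : 0 < α) (hs : 0 < s) (n : ℕ) :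
    HasDerivAt (Jk α n) (-(2 * (n + 2)) * Jk α (n+1) s) s := by
  set m := min 1 (s/2) with hm
  have hm0 : 0 < m := lt_min one_pos (by linarith)
  have key := hasDerivAt_integral_of_dominated_loc_of_deriv_le
    (μ := volume.restrict (Set.Ioi (0:ℝ)))
    (F := fun s t => t ^ (α - 1) * (Real.sinh t / den t s ^ (n + 2)))
    (F' := fun s t => t ^ (α - 1) * (-(2 * (n + 2)) * (Real.sinh t / den t s ^ (n + 1 + 2))))
    (x₀ := s) (s := Ioi (s/2))
    (bound := fun t => t ^ (α - 1) * ((2 * (n+2)) * (1 / m ^ (n + 1 + 2)) * Real.exp (-t)))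
    (Ioi_mem_nhds (by linarith))
    (Eventually.of_forall fun s => ae_meas_rpow_mul (meas_J n s))
    (Jk_integrable hα hs n)
    (ae_meas_rpow_mul ((meas_J (n+1) s).const_mul _))
    (by
      filter_upwards [ae_restrict_mem measurableSet_Ioi] with t ht
      intro x hx
      have ht : 0 < t := ht
      have hx : s/2 < x := hx
      rw [norm_mul, Real.norm_of_nonneg (by positivity), Real.norm_eq_abs, abs_mul]
      have := Jk_bound (s := x) (n+1) ht hm0 (min_le_left _ _) ((min_le_right _ _).trans hx.le)
      have h2 : |-(2 * ((n:ℝ)+2))| = 2 * (n+2) := by rw [abs_neg, abs_of_nonneg (by positivity)]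
      rw [h2, mul_assoc (2 * ((n:ℝ)+2))]
      gcongr)
    (int_rpow_exp hα _)
    (by
      filter_upwards [ae_restrict_mem measurableSet_Ioi] with t ht
      intro x hx
      have hx : s/2 < x := hx
      have hd := den_pos (t := t) (show 0 < x by linarith)
      apply HasDerivAt.const_mul
      have := (hasDerivAt_const x (Real.sinh t)).div ((hasDerivAt_den t x).pow (n+2)) (pow_pos hd _).ne'
      refine this.congr_deriv ?_
      rw [← mul_div_assoc, div_eq_div_iff (by simp; exact hd.ne') (by positivity)]
      push_cast
      simp only [Pi.pow_apply]
      ring)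
  have h2 := key.2
  have e : (∫ t in Set.Ioi (0:ℝ), t ^ (α - 1) * (-(2 * (n + 2)) * (Real.sinh t / den t s ^ (n + 1 + 2)))) = -(2 * (n + 2)) * Jk α (n+1) s := by
    unfold Jk
    rw [← integral_const_mul]
    congr 1; ext t; ring
  rw [e] at h2
  exact h2

lemma Jk_contDiffOn {α : ℝ} (hα : 0 < α) (k : ℕ) : ∀ n, ContDiffOn ℝ k (Jk α n) (Ioi 0) := by
  induction k with
  | zero =>
    intro n
    simp only [Nat.cast_zero, contDiffOn_zero]
    intro s hs
    exact (Jk_hasDerivAt hα hs n).continuousAt.continuousWithinAt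
  | succ k ih =>
    intro n
    push_cast
    rw [contDiffOn_succ_iff_deriv_of_isOpen isOpen_Ioi]
    refine ⟨fun s hs => (Jk_hasDerivAt hα hs n).differentiableAt.differentiableWithinAt, by simp, ?_⟩
    have : ContDiffOn ℝ k (fun s => -(2 * ((n:ℝ) + 2)) * Jk α (n+1) s) (Ioi 0) :=
      contDiffOn_const.mul (ih (n+1))
    exact this.congr fun s hs => (Jk_hasDerivAt hα hs n).deriv

lemma kfun_contDiffAt {α : ℝ} (hα : 0 < α) {s : ℝ} (hs : 0 < s) :
    ContDiffAt ℝ (⊤ : ℕ∞) (kfun α) s := by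
  have : ∀ k : ℕ, ContDiffOn ℝ k (kfun α) (Ioi 0) := by
    intro k
    have h : ContDiffOn ℝ (k+1) (kfun α) (Ioi 0) := by
      rw [contDiffOn_succ_iff_deriv_of_isOpen isOpen_Ioi]
      refine ⟨fun s hs => (kfun_hasDerivAt hα hs).differentiableAt.differentiableWithinAt, by simp, ?_⟩
      have : ContDiffOn ℝ k (fun s => -2 * Jk α 0 s) (Ioi 0) :=
        contDiffOn_const.mul (Jk_contDiffOn hα k 0)
      exact this.congr fun s hs => (kfun_hasDerivAt hα hs).deriv
    exact h.of_le (by exact_mod_cast Nat.le_succ k)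
  exact (contDiffOn_infty.2 this).contDiffAt (Ioi_mem_nhds hs)

lemma Jk_pos {α s : ℝ} (hα : 0 < α) (hs : 0 < s) (n : ℕ) : 0 < Jk α n s := by
  unfold Jk
  rw [setIntegral_pos_iff_support_of_nonneg_ae]
  · have : (Function.support fun t => t ^ (α - 1) * (Real.sinh t / den t s ^ (n + 2))) ∩ Ioi 0 = Ioi 0 := by
      apply inter_eq_right.2
      intro t ht
      have ht : 0 < t := ht
      have := den_pos (t := t) hs
      have h2 : 0 < Real.sinh t := Real.sinh_pos_iff.2 ht
      rw [Function.mem_support]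
      positivity
    rw [this]; simp
  · filter_upwards [ae_restrict_mem measurableSet_Ioi] with t ht
    have ht : 0 < t := ht
    have := den_pos (t := t) hs
    have h2 : 0 < Real.sinh t := Real.sinh_pos_iff.2 ht
    simp only [Pi.zero_apply]
    positivity
  · exact Jk_integrable hα hs n


lemma cosh_lower (t : ℝ) : 1 + t ^ 2 / 2 + t ^ 4 / 24 ≤ Real.cosh t := by
  have h := Real.hasSum_cosh t
  have h2 := sum_le_hasSum (Finset.range 3) (fun i _ => by
    have : t ^ (2 * i) = (t^2)^i := by rw [pow_mul]
    rw [this]; positivity) h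
  simp [Finset.sum_range_succ, Nat.factorial] at h2
  linarith

lemma den_eq_cosh (t s : ℝ) : den t s = 2 * (Real.cosh t - 1 + s) := by
  unfold den; rw [Real.cosh_eq]; ring

lemma sinh_le_mul_cosh {t : ℝ} (ht : 0 ≤ t) : Real.sinh t ≤ t * Real.cosh t := by
  have h : MonotoneOn (fun t => t * Real.cosh t - Real.sinh t) (Ici 0) := by
    apply monotoneOn_of_deriv_nonneg (convex_Ici 0)
    · fun_prop
    · fun_prop
    · intro x hx
      simp only [interior_Ici, mem_Ioi] at hx
      have := (((hasDerivAt_id x).mul (Real.hasDerivAt_cosh x)).sub (Real.hasDerivAt_sinh x)).deriv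
      have h2 : deriv (fun t => t * Real.cosh t - Real.sinh t) x = 1 * Real.cosh x + x * Real.sinh x - Real.cosh x := this
      rw [h2]
      have : 0 < Real.sinh x := Real.sinh_pos_iff.2 hx
      nlinarith [mul_pos hx this]
  have := h (show (0:ℝ) ∈ Ici 0 by simp) (show t ∈ Ici 0 from ht) ht
  simp at this
  linarith

lemma J_pointwise {t s : ℝ} (n : ℕ) (ht : 0 < t) (hs : 0 < s) (hs2 : s ≤ 2) :
    Real.sinh t / den t s ^ (n + 2) ≤ 6 * (t / (t ^ 2 + 2 * s) ^ (n + 2)) := by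
  have hc := cosh_lower t
  have hc1 := Real.one_le_cosh t
  have hsh := sinh_le_mul_cosh ht.le
  have hd := den_pos (t := t) hs
  set q := t ^ 2 + 2 * s with hq
  have hq0 : 0 < q := by positivity
  have hdq : q ≤ den t s := by
    rw [den_eq_cosh]; nlinarith [sq_nonneg (t^2)]
  -- den * (t^2+4) ≥ q * 2 (cosh t + 1)
  have h1 : q * (2 * (Real.cosh t + 1)) ≤ den t s * (t ^ 2 + 4) := by
    rw [den_eq_cosh]
    nlinarith [mul_nonneg (show 0 ≤ 2 - s by linarith) (show 0 ≤ Real.cosh t - 1 - t^2/2 by nlinarith [sq_nonneg (t^2)])]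
  have h2 : (t^2+4)^2 ≤ 24 * (Real.cosh t + 1) := by nlinarith [sq_nonneg (t^2)]
  -- cosh t * q^2 ≤ 6 den^2
  have h3 : Real.cosh t * q ^ 2 ≤ 6 * den t s ^ 2 := by
    have h4 : (q * (2 * (Real.cosh t + 1)))^2 ≤ (den t s * (t^2+4))^2 := by
      apply pow_le_pow_left₀ (by positivity) h1
    have h5 : (den t s * (t^2+4))^2 ≤ den t s ^2 * (24 * (Real.cosh t + 1)) := by
      rw [mul_pow]; gcongr
    have h6 : q^2 * (Real.cosh t + 1) ≤ 6 * den t s ^ 2 := by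
      have : (q^2 * (Real.cosh t + 1)) * (4 * (Real.cosh t + 1)) ≤ (6 * den t s ^2) * (4 * (Real.cosh t + 1)) := by
        nlinarith
      exact le_of_mul_le_mul_right this (by positivity)
    nlinarith [sq_nonneg q]
  rw [← mul_div_assoc, div_le_div_iff₀ (by positivity) (by positivity)]
  have h7 : q ^ n ≤ den t s ^ n := pow_le_pow_left₀ hq0.le hdq n
  calc Real.sinh t * q ^ (n+2) ≤ (t * Real.cosh t) * q ^ (n+2) := by gcongr
    _ = t * (Real.cosh t * q ^ 2) * q ^ n := by ring
    _ ≤ t * (6 * den t s ^ 2) * den t s ^ n := by gcongr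
    _ = _ := by ring

lemma Jmodel_integrable {α : ℝ} (h0 : 0 < α) (h1 : α < 1) (n : ℕ) :
    IntegrableOn (fun τ : ℝ => τ ^ (α - 1) * (τ / (τ ^ 2 + 2) ^ (n + 2))) (Ioi 0) := by
  have hm : Measurable (fun τ : ℝ => τ ^ (α - 1) * (τ / (τ ^ 2 + 2) ^ (n + 2))) :=
    (measurable_id.pow_const _).mul (by fun_prop)
  rw [← Ioc_union_Ioi_eq_Ioi (zero_le_one), integrableOn_union]
  constructor
  · refine Integrable.mono' (g := fun _ => (1:ℝ)) (by simp) hm.aestronglyMeasurable ?_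
    filter_upwards [ae_restrict_mem measurableSet_Ioc] with τ hτ
    have hτ0 : 0 < τ := hτ.1
    rw [Real.norm_of_nonneg (by positivity)]
    have : τ ^ (α - 1) * (τ / (τ ^ 2 + 2) ^ (n + 2)) = τ ^ α / (τ^2+2)^(n+2) := by
      rw [Real.rpow_sub_one hτ0.ne']; field_simp
    rw [this, div_le_one (by positivity)]
    calc τ ^ α ≤ 1 := Real.rpow_le_one hτ0.le hτ.2 h0.le
      _ ≤ _ := one_le_pow₀ (by nlinarith)
  · have h := integrableOn_Ioi_rpow_of_lt (a := α - 4) (by linarith) (zero_lt_one)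
    refine Integrable.mono' h hm.aestronglyMeasurable ?_
    filter_upwards [ae_restrict_mem measurableSet_Ioi] with τ hτ
    have hτ1 : 1 < τ := hτ
    have hτ0 : 0 < τ := by linarith
    rw [Real.norm_of_nonneg (by positivity)]
    have : τ ^ (α - 1) * (τ / (τ ^ 2 + 2) ^ (n + 2)) = τ ^ α / (τ^2+2)^(n+2) := by
      rw [Real.rpow_sub_one hτ0.ne']; field_simp
    rw [this, Real.rpow_sub hτ0]
    gcongr
    rw [show (4:ℝ) = ((4:ℕ):ℝ) by norm_num, Real.rpow_natCast]
    calc τ ^ 4 = (τ^2)^2 := by ring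
      _ ≤ (τ^2+2)^2 := by gcongr; linarith
      _ ≤ _ := pow_le_pow_right₀ (by nlinarith) (by omega)

lemma Jk_upper {α : ℝ} (h0 : 0 < α) (h1 : α < 1) (n : ℕ) :
    ∃ C > 0, ∀ ρ : ℝ, 0 < ρ → ρ ^ 2 ≤ 2 → Jk α n (ρ ^ 2) ≤ C * ρ ^ (α + 1 - 2 * (n + 2)) := by
  set M := ∫ τ in Ioi (0:ℝ), τ ^ (α - 1) * (τ / (τ ^ 2 + 2) ^ (n + 2)) with hM
  have hM0 : 0 ≤ M := by
    apply setIntegral_nonneg measurableSet_Ioi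
    intro τ hτ
    have hτ : 0 < τ := hτ
    positivity
  refine ⟨6 * M + 1, by positivity, ?_⟩
  intro ρ hρ hρ2
  have hpt : ∀ τ ∈ Ioi (0:ℝ), (fun t => t ^ (α - 1) * (t / (t ^ 2 + 2 * ρ^2) ^ (n + 2))) (ρ * τ)
      = ρ ^ (α - 2 * (n+2)) * (τ ^ (α - 1) * (τ / (τ ^ 2 + 2) ^ (n + 2))) := by
    intro τ hτ
    have hτ : 0 < τ := hτ
    simp only
    rw [Real.mul_rpow hρ.le hτ.le, show (ρ * τ)^2 + 2 * ρ^2 = ρ^2 * (τ^2+2) by ring, mul_pow,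
      Real.rpow_sub hρ α (2 * (n+2)), Real.rpow_sub_one hρ.ne']
    rw [show (2 * ((n:ℝ)+2)) = ((2 * (n+2) : ℕ) : ℝ) by push_cast; ring, Real.rpow_natCast, pow_mul]
    field_simp
  have hsc := integral_comp_mul_left_Ioi (fun t => t ^ (α - 1) * (t / (t ^ 2 + 2 * ρ^2) ^ (n + 2))) 0 hρ
  have hJint : IntegrableOn (fun t => t ^ (α - 1) * (t / (t ^ 2 + 2 * ρ^2) ^ (n + 2))) (Ioi 0) := by
    rw [← mul_zero ρ, ← integrableOn_Ioi_comp_mul_left_iff _ _ hρ]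
    refine (IntegrableOn.congr_fun ((Jmodel_integrable h0 h1 n).const_mul (ρ ^ (α - 2 * (n+2)))) ?_ measurableSet_Ioi)
    intro τ hτ
    exact (hpt τ hτ).symm
  rw [setIntegral_congr_fun measurableSet_Ioi hpt, integral_const_mul, mul_zero, ← hM, smul_eq_mul] at hsc
  have hle : Jk α n (ρ^2) ≤ 6 * ∫ t in Ioi (0:ℝ), t ^ (α - 1) * (t / (t ^ 2 + 2 * ρ^2) ^ (n + 2)) := by
    unfold Jk
    rw [← integral_const_mul]
    apply setIntegral_mono_on (Jk_integrable h0 (by positivity) n) (hJint.const_mul 6) measurableSet_Ioi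
    intro t ht
    have ht : 0 < t := ht
    have := J_pointwise n ht (show 0 < ρ^2 by positivity) hρ2
    calc t ^ (α - 1) * (Real.sinh t / den t (ρ ^ 2) ^ (n + 2)) ≤ t ^ (α - 1) * (6 * (t / (t ^ 2 + 2 * ρ^2) ^ (n + 2))) := by gcongr
      _ = _ := by ring
  have e1 : (∫ t in Ioi (0:ℝ), t ^ (α - 1) * (t / (t ^ 2 + 2 * ρ^2) ^ (n + 2))) = ρ ^ (α + 1 - 2 * (n+2)) * M := by
    have : ρ ^ (α + 1 - 2 * ((n:ℝ)+2)) = ρ ^ (α - 2 * (n+2)) * ρ := by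
      rw [← Real.rpow_add_one hρ.ne']; congr 1; ring
    rw [this, mul_right_comm, hsc]; field_simp
  rw [e1] at hle
  have : 0 < ρ ^ (α + 1 - 2 * ((n:ℝ)+2)) := by positivity
  nlinarith

lemma J0_lower {α : ℝ} (h0 : 0 < α) :
    ∃ c > 0, ∀ ρ : ℝ, 0 < ρ → ρ ≤ 1 → c * ρ ^ (α - 3) ≤ Jk α 0 (ρ ^ 2) := by
  refine ⟨1 / (16 * (α + 1)), by positivity, ?_⟩
  intro ρ hρ hρ1
  have hJint := Jk_integrable h0 (show 0 < ρ^2 by positivity) 0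
  have h1 : ∫ t in Ioc 0 ρ, t ^ (α - 1) * (Real.sinh t / den t (ρ ^ 2) ^ (0 + 2)) ≤ Jk α 0 (ρ^2) := by
    unfold Jk
    apply setIntegral_mono_set hJint
    · filter_upwards [ae_restrict_mem measurableSet_Ioi] with t ht
      have ht : 0 < t := ht
      have := den_pos (t := t) (show 0 < ρ^2 by positivity)
      have h2 : 0 < Real.sinh t := Real.sinh_pos_iff.2 ht
      simp only [Pi.zero_apply]
      positivity
    · exact (Ioc_subset_Ioi_self).eventuallyLE
  have hii : IntervalIntegrable (fun t : ℝ => t ^ α) volume 0 ρ :=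
    intervalIntegral.intervalIntegrable_rpow' (by linarith)
  have h2 : ∫ t in Ioc 0 ρ, (1 / (16 * ρ^4)) * t ^ α ≤ ∫ t in Ioc 0 ρ, t ^ (α - 1) * (Real.sinh t / den t (ρ ^ 2) ^ (0 + 2)) := by
    apply setIntegral_mono_on
    · have := hii.const_mul (1 / (16 * ρ^4))
      rwa [intervalIntegrable_iff_integrableOn_Ioc_of_le hρ.le] at this
    · exact hJint.mono_measure (Measure.restrict_mono Ioc_subset_Ioi_self le_rfl)
    · exact measurableSet_Ioc
    intro t ht
    have ht0 : 0 < t := ht.1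
    have htρ : t ≤ ρ := ht.2
    have hd := den_pos (t := t) (show 0 < ρ^2 by positivity)
    have hs : t ≤ Real.sinh t := Real.self_le_sinh_iff.2 ht0.le
    have hcosh : Real.cosh t ≤ 1 + t^2 := by
      have h3 : t ^ 2 ≤ 1 := by nlinarith
      calc Real.cosh t ≤ Real.exp (t^2/2) := Real.cosh_le_exp_half_sq t
        _ ≤ 1 + t^2 := by
          have h4 : Real.exp (-(t^2/2)) ≥ 1 - t^2/2 := by linarith [Real.add_one_le_exp (-(t^2/2))]
          rw [Real.exp_neg] at h4
          have h5 := Real.exp_pos (t^2/2)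
          have h6 : (Real.exp (t^2/2)) * (1 - t^2/2) ≤ 1 := by
            calc _ ≤ Real.exp (t^2/2) * (Real.exp (t^2/2))⁻¹ := by gcongr
              _ = 1 := mul_inv_cancel₀ h5.ne'
          nlinarith [sq_nonneg t]
    have hd4 : den t (ρ^2) ≤ 4 * ρ^2 := by rw [den_eq_cosh]; nlinarith
    have hta : t ^ α = t ^ (α - 1) * t := by rw [Real.rpow_sub_one ht0.ne']; field_simp
    rw [hta]
    calc 1 / (16 * ρ ^ 4) * (t ^ (α - 1) * t) = t ^ (α - 1) * (t / (4 * ρ^2)^(0+2)) := by ring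
      _ ≤ _ := by gcongr
  rw [integral_const_mul, ← intervalIntegral.integral_of_le hρ.le, integral_rpow (Or.inl (by linarith)),
    Real.zero_rpow (by positivity), sub_zero] at h2
  refine le_trans (le_of_eq ?_) (h2.trans h1)
  have : ρ ^ (α - 3) = ρ ^ (α + 1) / ρ ^ 4 := by
    rw [← Real.rpow_natCast ρ 4, ← Real.rpow_sub hρ]; congr 1; push_cast; ring
  rw [this]
  field_simp


lemma Kker_eq {α x : ℝ} (hx : Real.cos x < 1) :
    Kker α x = (1 / (π * Real.Gamma α)) * kfun α (1 - Real.cos x) := by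
  unfold Kker kfun
  rw [if_neg]
  · congr 1
    apply setIntegral_congr_fun measurableSet_Ioi
    intro t ht
    simp only
    rw [mul_div_assoc]
    congr 1
    have hd := den_pos (t := t) (show 0 < 1 - Real.cos x by linarith)
    have he := Real.exp_pos t
    have h2 : 1 - 2 * Real.exp t * Real.cos x + Real.exp (2 * t) = Real.exp t * den t (1 - Real.cos x) := by
      unfold den
      rw [Real.exp_neg, two_mul t, Real.exp_add]
      field_simp; ring
    rw [h2]
    have h3 : Real.exp t * Real.cos x - 1 = Real.exp t * (1 - Real.exp (-t) - (1 - Real.cos x)) := by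
      rw [Real.exp_neg]; field_simp; ring
    rw [h3, mul_div_mul_left _ _ he.ne']
  · rintro ⟨k, hk⟩
    have : Real.cos x = 1 := (Real.cos_eq_one_iff x).2 ⟨k, by rw [hk]; ring⟩
    linarith

lemma Kker_zero {α x : ℝ} (hx : Real.cos x = 1) : Kker α x = 0 := by
  unfold Kker
  rw [if_pos]
  obtain ⟨k, hk⟩ := (Real.cos_eq_one_iff x).1 hx
  exact ⟨k, by rw [← hk]; ring⟩

lemma cos_lt_one_or (x : ℝ) : Real.cos x < 1 ∨ Real.cos x = 1 := (Real.cos_le_one x).lt_or_eq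

lemma Kker_congr {α x y : ℝ} (h : Real.cos x = Real.cos y) : Kker α x = Kker α y := by
  rcases cos_lt_one_or x with hx | hx
  · rw [Kker_eq hx, Kker_eq (h ▸ hx), h]
  · rw [Kker_zero hx, Kker_zero (h ▸ hx)]

lemma Kker_even (α x : ℝ) : Kker α (-x) = Kker α x := Kker_congr (Real.cos_neg x)

lemma Kker_periodic (α : ℝ) : Function.Periodic (Kker α) (2 * π) :=
  fun x => Kker_congr (Real.cos_add_two_pi x)

lemma kc_pos {α : ℝ} (hα : 0 < α) : 0 < 1 / (π * Real.Gamma α) := by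
  have := Real.Gamma_pos_of_pos hα
  positivity

lemma kfun_strictAnti {α : ℝ} (hα : 0 < α) : StrictAntiOn (kfun α) (Ioi 0) := by
  apply strictAntiOn_of_deriv_neg (convex_Ioi 0)
  · intro s hs
    exact (kfun_hasDerivAt hα hs).continuousAt.continuousWithinAt
  · intro s hs
    rw [interior_Ioi] at hs
    rw [(kfun_hasDerivAt hα hs).deriv]
    have := Jk_pos hα hs 0
    linarith

lemma Kker_lt {α x y : ℝ} (hα : 0 < α) (h : Real.cos x < Real.cos y) (hy : Real.cos y < 1) :
    Kker α x < Kker α y := by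
  rw [Kker_eq hy, Kker_eq (h.trans hy)]
  apply mul_lt_mul_of_pos_left _ (kc_pos hα)
  exact kfun_strictAnti hα (by simp; linarith) (by simp; linarith) (by linarith)

lemma Kker_le {α x y : ℝ} (hα : 0 < α) (h : Real.cos x ≤ Real.cos y) (hy : Real.cos y < 1) :
    Kker α x ≤ Kker α y := by
  rcases h.lt_or_eq with h | h
  · exact (Kker_lt hα h hy).le
  · exact (Kker_congr h).le

lemma isOpen_cosLt : IsOpen {x : ℝ | Real.cos x < 1} :=
  isOpen_lt Real.continuous_cos continuous_const

lemma Kker_eventuallyEq {α x : ℝ} (hx : Real.cos x < 1) :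
    Kker α =ᶠ[𝓝 x] fun x => (1 / (π * Real.Gamma α)) * kfun α (1 - Real.cos x) := by
  filter_upwards [isOpen_cosLt.mem_nhds hx] with y hy
  exact Kker_eq hy

lemma Kker_contDiffAt {α x : ℝ} (hα : 0 < α) (hx : Real.cos x < 1) :
    ContDiffAt ℝ (⊤ : ℕ∞) (Kker α) x := by
  refine ContDiffAt.congr_of_eventuallyEq ?_ (Kker_eventuallyEq hx)
  apply contDiffAt_const.mul
  apply ContDiffAt.comp (g := kfun α) x (kfun_contDiffAt hα (by linarith))
  exact contDiffAt_const.sub (Real.contDiff_cos.contDiffAt)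

noncomputable def dK (α x : ℝ) : ℝ :=
  (1 / (π * Real.Gamma α)) * (-2 * Jk α 0 (1 - Real.cos x) * Real.sin x)

noncomputable def ddK (α x : ℝ) : ℝ :=
  (1 / (π * Real.Gamma α)) * (8 * Jk α 1 (1 - Real.cos x) * Real.sin x ^ 2
    - 2 * Jk α 0 (1 - Real.cos x) * Real.cos x)

lemma hasDerivAt_one_sub_cos (x : ℝ) : HasDerivAt (fun x => 1 - Real.cos x) (Real.sin x) x := by
  simpa using (Real.hasDerivAt_cos x).const_sub 1

lemma Kker_hasDerivAt {α x : ℝ} (hα : 0 < α) (hx : Real.cos x < 1) :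
    HasDerivAt (Kker α) (dK α x) x := by
  refine HasDerivAt.congr_of_eventuallyEq ?_ (Kker_eventuallyEq hx)
  apply HasDerivAt.const_mul
  exact HasDerivAt.comp (h₂ := kfun α) x (kfun_hasDerivAt hα (by linarith)) (hasDerivAt_one_sub_cos x)

lemma dK_hasDerivAt {α x : ℝ} (hα : 0 < α) (hx : Real.cos x < 1) :
    HasDerivAt (dK α) (ddK α x) x := by
  unfold dK ddK
  apply HasDerivAt.const_mul
  have h1 := HasDerivAt.comp (h₂ := Jk α 0) x (Jk_hasDerivAt hα (by linarith) 0) (hasDerivAt_one_sub_cos x)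
  have h2 := (h1.const_mul (-2)).mul (Real.hasDerivAt_sin x)
  refine h2.congr_deriv ?_
  simp only [Function.comp]
  push_cast
  ring

lemma cos_eq_half (x : ℝ) : 1 - Real.cos x = (√2 * |Real.sin (x/2)|) ^ 2 := by
  rw [mul_pow, sq_abs, Real.sq_sqrt (by norm_num), Real.sin_sq, Real.cos_sq]
  rw [show 2 * (x/2) = x by ring]; ring

lemma abs_sin_half_lower {x : ℝ} (hx : |x| ≤ 3 * π / 2) : (1 / (3 * π)) * |x| ≤ |Real.sin (x/2)| := by
  have hpi := Real.pi_pos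
  have key : ∀ y : ℝ, 0 ≤ y → y ≤ 3 * π / 4 → (2 / (3 * π)) * y ≤ Real.sin y := by
    intro y hy0 hy
    by_cases h : y ≤ π / 2
    · have := Real.mul_le_sin hy0 h
      refine le_trans ?_ this
      have : 2 / (3 * π) ≤ 2 / π := by
        apply div_le_div_of_nonneg_left <;> nlinarith
      nlinarith
    · push Not at h
      have := Real.mul_le_sin (x := π - y) (by linarith) (by linarith)
      rw [Real.sin_pi_sub] at this
      refine le_trans ?_ this
      have h1 : 2 / (3 * π) * y ≤ 1/2 := by
        rw [div_mul_eq_mul_div, div_le_iff₀ (by positivity)]; linarith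
      have h2 : 1/2 ≤ 2 / π * (π - y) := by
        rw [div_mul_eq_mul_div, le_div_iff₀ (by positivity)]; linarith
      linarith
  have h1 : |Real.sin (x/2)| = |Real.sin (|x|/2)| := by
    rcases abs_cases x with ⟨h, _⟩ | ⟨h, _⟩
    · rw [h]
    · rw [h, neg_div, Real.sin_neg, abs_neg]
  rw [h1]
  have := key (|x|/2) (by positivity) (by linarith)
  refine le_trans (le_trans (le_of_eq ?_) this) (le_abs_self _)
  field_simp

lemma cos_lt_one_of {x : ℝ} (hx0 : x ≠ 0) (hx : |x| ≤ 3 * π / 2) : Real.cos x < 1 := by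
  have h1 := abs_sin_half_lower hx
  have h2 := cos_eq_half x
  have h3 : 0 < |Real.sin (x/2)| := lt_of_lt_of_le (by have := Real.pi_pos; have := abs_pos.2 hx0; positivity) h1
  have : 0 < (√2 * |Real.sin (x/2)|) ^ 2 := by positivity
  linarith

lemma rho_bounds {x : ℝ} (hx0 : x ≠ 0) (hx : |x| ≤ 3 * π / 2) :
    ∃ ρ : ℝ, 0 < ρ ∧ ρ ^ 2 = 1 - Real.cos x ∧ (1 / (3 * π)) * |x| ≤ ρ ∧ ρ ≤ |x| ∧ |Real.sin x| ≤ 2 * ρ := by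
  have hpi := Real.pi_pos
  have habs := abs_pos.2 hx0
  have h1 := abs_sin_half_lower hx
  have hsq : 1 ≤ √2 := by rw [Real.one_le_sqrt]; norm_num
  have hsq2 : √2 ≤ 2 := by rw [Real.sqrt_le_left (by norm_num)]; norm_num
  have h3 : 0 < |Real.sin (x/2)| := lt_of_lt_of_le (by positivity) h1
  refine ⟨√2 * |Real.sin (x/2)|, by positivity, (cos_eq_half x).symm, by nlinarith, ?_, ?_⟩
  · have : |Real.sin (x/2)| ≤ |x|/2 := by
      have := Real.abs_sin_le_abs (x := x/2)
      rw [abs_div] at this; simpa using this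
    nlinarith
  · have : Real.sin x = 2 * Real.sin (x/2) * Real.cos (x/2) := by
      rw [← Real.sin_two_mul]; congr 1; ring
    rw [this, abs_mul, abs_mul, abs_two]
    have := Real.abs_cos_le_one (x/2)
    have h5 : |Real.sin (x/2)| * |Real.cos (x/2)| ≤ |Real.sin (x/2)| := by nlinarith
    nlinarith

lemma rho_rpow {x ρ e : ℝ} (he : e ≤ 0) (hx0 : x ≠ 0) (h : (1 / (3 * π)) * |x| ≤ ρ) :
    ρ ^ e ≤ (1 / (3 * π)) ^ e * |x| ^ e := by
  have hpi := Real.pi_pos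
  have habs := abs_pos.2 hx0
  rw [← Real.mul_rpow (by positivity) (by positivity)]
  exact Real.rpow_le_rpow_of_nonpos (by positivity) h he

lemma dK_bound {α : ℝ} (h0 : 0 < α) (h1 : α < 1) :
    ∃ C > 0, ∀ x : ℝ, x ≠ 0 → |x| ≤ 3 * π / 2 → |dK α x| ≤ C * |x| ^ (α - 2) := by
  obtain ⟨C, hC, hJ⟩ := Jk_upper h0 h1 0
  have hpi := Real.pi_pos
  have hkc := kc_pos h0
  set kc := 1 / (π * Real.Gamma α)
  refine ⟨kc * (4 * C) * (1 / (3 * π)) ^ (α - 2), by positivity, ?_⟩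
  intro x hx0 hx
  obtain ⟨ρ, hρ0, hρ, hl, hu, hsin⟩ := rho_bounds hx0 hx
  have hs : ρ ^ 2 ≤ 2 := by rw [hρ]; linarith [Real.neg_one_le_cos x]
  have hJ' := hJ ρ hρ0 hs
  have hJp := Jk_pos h0 (show 0 < ρ^2 by positivity) 0
  unfold dK
  rw [← hρ, abs_mul, abs_of_pos hkc, abs_mul, abs_mul, abs_of_pos hJp]
  have e1 : ρ ^ (α - 2) = ρ ^ (α + 1 - 2 * (((0:ℕ):ℝ) + 2)) * ρ := by
    rw [← Real.rpow_add_one hρ0.ne']; congr 1; push_cast; ring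
  have h2 : |(-2:ℝ)| = 2 := by norm_num
  rw [h2]
  have hpp : 0 < ρ ^ (α + 1 - 2 * (((0:ℕ):ℝ) + 2)) := by positivity
  calc kc * (2 * Jk α 0 (ρ ^ 2) * |Real.sin x|) ≤ kc * (2 * (C * ρ ^ (α + 1 - 2 * (((0:ℕ):ℝ) + 2))) * (2 * ρ)) := by gcongr
    _ = kc * (4 * C) * ρ ^ (α - 2) := by rw [e1]; ring
    _ ≤ kc * (4 * C) * ((1 / (3 * π)) ^ (α - 2) * |x| ^ (α - 2)) := by
        gcongr; exact rho_rpow (by linarith) hx0 hl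
    _ = _ := by ring

lemma ddK_bound {α : ℝ} (h0 : 0 < α) (h1 : α < 1) :
    ∃ C > 0, ∀ x : ℝ, x ≠ 0 → |x| ≤ 3 * π / 2 → |ddK α x| ≤ C * |x| ^ (α - 3) := by
  obtain ⟨C, hC, hJ⟩ := Jk_upper h0 h1 0
  obtain ⟨C1, hC1, hJ1⟩ := Jk_upper h0 h1 1
  have hpi := Real.pi_pos
  have hkc := kc_pos h0
  set kc := 1 / (π * Real.Gamma α)
  refine ⟨kc * (32 * C1 + 2 * C) * (1 / (3 * π)) ^ (α - 3), by positivity, ?_⟩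
  intro x hx0 hx
  obtain ⟨ρ, hρ0, hρ, hl, hu, hsin⟩ := rho_bounds hx0 hx
  have hs : ρ ^ 2 ≤ 2 := by rw [hρ]; linarith [Real.neg_one_le_cos x]
  have hJ' := hJ ρ hρ0 hs
  have hJp := Jk_pos h0 (show 0 < ρ^2 by positivity) 0
  have hJ1' := hJ1 ρ hρ0 hs
  have hJ1p := Jk_pos h0 (show 0 < ρ^2 by positivity) 1
  unfold ddK
  rw [← hρ, abs_mul, abs_of_pos hkc]
  have e1 : ρ ^ (α + 1 - 2 * (((0:ℕ):ℝ) + 2)) = ρ ^ (α - 3) := by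
    congr 1; push_cast; ring
  have e2 : ρ ^ (α - 3) = ρ ^ (α + 1 - 2 * (((1:ℕ):ℝ) + 2)) * ρ ^ 2 := by
    rw [← Real.rpow_natCast ρ 2, ← Real.rpow_add hρ0]; congr 1; push_cast; ring
  rw [e1] at hJ'
  have hsin2 : Real.sin x ^ 2 ≤ 4 * ρ ^ 2 := by
    rw [← sq_abs]; nlinarith [abs_nonneg (Real.sin x)]
  have hcos := Real.abs_cos_le_one x
  calc kc * |8 * Jk α 1 (ρ ^ 2) * Real.sin x ^ 2 - 2 * Jk α 0 (ρ ^ 2) * Real.cos x|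
      ≤ kc * (8 * Jk α 1 (ρ ^ 2) * Real.sin x ^ 2 + 2 * Jk α 0 (ρ ^ 2) * |Real.cos x|) := by
        gcongr
        refine (abs_sub _ _).trans ?_
        rw [abs_of_nonneg (show 0 ≤ 8 * Jk α 1 (ρ ^ 2) * Real.sin x ^ 2 by positivity), abs_mul,
          abs_of_pos (show 0 < 2 * Jk α 0 (ρ^2) by positivity)]
    _ ≤ kc * (8 * (C1 * ρ ^ (α + 1 - 2 * (((1:ℕ):ℝ) + 2))) * (4 * ρ ^ 2) + 2 * (C * ρ ^ (α - 3)) * 1) := by gcongr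
    _ = kc * (32 * C1 + 2 * C) * ρ ^ (α - 3) := by rw [e2]; ring
    _ ≤ kc * (32 * C1 + 2 * C) * ((1 / (3 * π)) ^ (α - 3) * |x| ^ (α - 3)) := by
        gcongr; exact rho_rpow (by linarith) hx0 hl
    _ = _ := by ring

lemma dK_neg_lower {α : ℝ} (h0 : 0 < α) (h1 : α < 1) :
    ∃ c > 0, ∀ x : ℝ, 0 < x → x ≤ 1 → dK α x ≤ -(c * x ^ (α - 2)) := by
  obtain ⟨c, hc, hJ⟩ := J0_lower h0
  have hpi := Real.pi_pos
  have hpi3 := Real.pi_gt_three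
  have hkc := kc_pos h0
  set kc := 1 / (π * Real.Gamma α)
  refine ⟨kc * (2 * c * (2 / π)), by positivity, ?_⟩
  intro x hx0 hx
  obtain ⟨ρ, hρ0, hρ, hl, hu, hsin⟩ := rho_bounds hx0.ne' (by rw [abs_of_pos hx0]; linarith)
  rw [abs_of_pos hx0] at hu
  have hJ' := hJ ρ hρ0 (hu.trans hx)
  have hs := Real.mul_le_sin hx0.le (by linarith)
  have h3 : x ^ (α - 3) ≤ ρ ^ (α - 3) := Real.rpow_le_rpow_of_nonpos hρ0 hu (by linarith)
  have e : x ^ (α - 2) = x ^ (α - 3) * x := by rw [← Real.rpow_add_one hx0.ne']; congr 1; ring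
  unfold dK
  rw [← hρ]
  have : kc * (2 * (c * x ^ (α - 3)) * (2 / π * x)) ≤ kc * (2 * Jk α 0 (ρ^2) * Real.sin x) := by
    have : c * x ^ (α - 3) ≤ Jk α 0 (ρ^2) := le_trans (by gcongr) hJ'
    have h5 : 0 < Jk α 0 (ρ^2) := Jk_pos h0 (by positivity) 0
    gcongr
  rw [e]
  calc kc * (-2 * Jk α 0 (ρ ^ 2) * Real.sin x) = -(kc * (2 * Jk α 0 (ρ^2) * Real.sin x)) := by ring
    _ ≤ -(kc * (2 * (c * x ^ (α - 3)) * (2 / π * x))) := by linarith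
    _ = _ := by ring

lemma Kker_bound {α : ℝ} (h0 : 0 < α) (h1 : α < 1) :
    ∃ C > 0, ∀ x : ℝ, x ≠ 0 → |x| ≤ 3 * π / 2 → |Kker α x| ≤ C * |x| ^ (α - 1) := by
  obtain ⟨C, hC, hd⟩ := dK_bound h0 h1
  have hpi := Real.pi_pos
  set B := C / (1 - α) with hB
  have hBC : B * (1 - α) = C := by rw [hB]; field_simp [show (1 - α) ≠ 0 by linarith]
  have hB0 : 0 < B := div_pos hC (by linarith)
  set M := |Kker α (3 * π / 2)|
  set e := (3 * π / 2) ^ (α - 1)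
  have he : 0 < e := by positivity
  refine ⟨B + M / e, by positivity, ?_⟩
  have hder : ∀ x ∈ Ioc 0 (3 * π / 2), ∀ b : ℝ, HasDerivAt (fun x => Kker α x + b * x ^ (α - 1))
      (dK α x + b * ((α - 1) * x ^ (α - 1 - 1))) x := by
    intro x hx b
    have hc := cos_lt_one_of (x := x) hx.1.ne' (by rw [abs_of_pos hx.1]; exact hx.2)
    exact (Kker_hasDerivAt h0 hc).add ((Real.hasDerivAt_rpow_const (Or.inl hx.1.ne')).const_mul b)
  have hbd : ∀ x ∈ Ioc 0 (3 * π / 2), |dK α x| ≤ B * ((1 - α) * x ^ (α - 1 - 1)) := by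
    intro x hx
    have := hd x hx.1.ne' (by rw [abs_of_pos hx.1]; exact hx.2)
    rw [abs_of_pos hx.1] at this
    rw [← mul_assoc, hBC, show α - 1 - 1 = α - 2 by ring]; exact this
  have hanti : AntitoneOn (fun x => Kker α x + B * x ^ (α - 1)) (Ioc 0 (3 * π / 2)) := by
    apply antitoneOn_of_deriv_nonpos (convex_Ioc _ _)
    · intro x hx; exact (hder x hx B).continuousAt.continuousWithinAt
    · intro x hx; exact (hder x (interior_subset hx) B).differentiableAt.differentiableWithinAt
    · intro x hx
      rw [(hder x (interior_subset hx) B).deriv]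
      have := (abs_le.1 (hbd x (interior_subset hx))).2
      nlinarith
  have hmono : MonotoneOn (fun x => Kker α x + (-B) * x ^ (α - 1)) (Ioc 0 (3 * π / 2)) := by
    apply monotoneOn_of_deriv_nonneg (convex_Ioc _ _)
    · intro x hx; exact (hder x hx (-B)).continuousAt.continuousWithinAt
    · intro x hx; exact (hder x (interior_subset hx) (-B)).differentiableAt.differentiableWithinAt
    · intro x hx
      rw [(hder x (interior_subset hx) (-B)).deriv]
      have := (abs_le.1 (hbd x (interior_subset hx))).1
      nlinarith
  have key : ∀ x : ℝ, 0 < x → x ≤ 3 * π / 2 → |Kker α x| ≤ (B + M / e) * x ^ (α - 1) := by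
    intro x hx0 hx
    have a1 := hanti ⟨hx0, hx⟩ (show 3 * π / 2 ∈ Ioc 0 (3 * π / 2) from ⟨by positivity, le_rfl⟩) hx
    have a2 := hmono ⟨hx0, hx⟩ (show 3 * π / 2 ∈ Ioc 0 (3 * π / 2) from ⟨by positivity, le_rfl⟩) hx
    simp only at a1 a2
    have h3 : e ≤ x ^ (α - 1) := Real.rpow_le_rpow_of_nonpos hx0 hx (by linarith)
    have h4 : M ≤ M / e * x ^ (α - 1) := by
      have hM : 0 ≤ M := abs_nonneg _
      calc M = M / e * e := by field_simp
        _ ≤ _ := by gcongr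
    have h5 := le_abs_self (Kker α (3 * π / 2))
    have h6 := neg_abs_le (Kker α (3 * π / 2))
    rw [abs_le]
    constructor <;> nlinarith
  intro x hx0 hx
  have h7 := key |x| (abs_pos.2 hx0) hx
  have : Kker α |x| = Kker α x := by
    apply Kker_congr; exact Real.cos_abs x
  rwa [this] at h7

lemma Kker_measurable {α : ℝ} (h0 : 0 < α) : Measurable (Kker α) := by
  classical
  have h : Kker α = Set.piecewise {x : ℝ | Real.cos x < 1} (Kker α) (fun _ => 0) := by
    ext x
    by_cases hx : Real.cos x < 1
    · rw [Set.piecewise_eq_of_mem {x : ℝ | Real.cos x < 1} _ _ hx]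
    · rw [Set.piecewise_eq_of_notMem {x : ℝ | Real.cos x < 1} _ _ hx]
      exact Kker_zero (le_antisymm (Real.cos_le_one x) (not_lt.1 hx))
  rw [h]
  apply ContinuousOn.measurable_piecewise
  · intro x hx
    exact (Kker_contDiffAt h0 hx).continuousAt.continuousWithinAt
  · exact continuousOn_const
  · exact isOpen_cosLt.measurableSet

lemma absrpow_intervalIntegrable {e : ℝ} (he : -1 < e) (a b : ℝ) :
    IntervalIntegrable (fun x : ℝ => |x| ^ e) volume a b := by
  have key : ∀ b : ℝ, 0 ≤ b → IntervalIntegrable (fun x : ℝ => |x| ^ e) volume 0 b := by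
    intro b hb
    refine (intervalIntegral.intervalIntegrable_rpow' (a := 0) (b := b) he).congr ?_
    intro x hx
    rw [uIoc_of_le hb] at hx
    simp only [abs_of_pos hx.1]
  have key2 : ∀ b : ℝ, IntervalIntegrable (fun x : ℝ => |x| ^ e) volume 0 b := by
    intro b
    rcases le_total 0 b with hb | hb
    · exact key b hb
    · have := (key (-b) (by linarith))
      rw [IntervalIntegrable.iff_comp_neg] at this
      simpa using this
  exact (key2 a).symm.trans (key2 b)

lemma Kker_intervalIntegrable {α : ℝ} (h0 : 0 < α) (h1 : α < 1) (a b : ℝ) :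
    IntervalIntegrable (Kker α) volume a b := by
  have hpi := Real.pi_pos
  obtain ⟨C, hC, hb⟩ := Kker_bound h0 h1
  have h : IntervalIntegrable (Kker α) volume (-π) (-π + 2 * π) := by
    refine IntervalIntegrable.mono_fun ((absrpow_intervalIntegrable (e := α - 1) (by linarith) _ _).const_mul C)
      (Kker_measurable h0).aestronglyMeasurable ?_
    rw [uIoc_of_le (by linarith)]
    filter_upwards [ae_restrict_mem measurableSet_Ioc] with x hx
    rw [Real.norm_eq_abs]
    by_cases hx0 : x = 0
    · subst hx0; rw [Kker_zero (by simp)]; simp; positivity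
    · refine (hb x hx0 ?_).trans (le_abs_self _)
      rw [abs_le]; constructor <;> linarith [hx.1, hx.2]
  exact (Kker_periodic α).intervalIntegrable (by positivity) h a b


noncomputable def conv (α : ℝ) (ψ : ℝ → ℝ) (x : ℝ) : ℝ := ∫ y in (-π)..π, Kker α (x - y) * ψ y

structure CSym (ψ : ℝ → ℝ) : Prop where
  cont : Continuous ψ
  mono : ∀ x y, Real.cos x ≤ Real.cos y → ψ x ≤ ψ y
  anti : ∀ x, ψ (x + π) = -ψ x

namespace CSym
variable {ψ : ℝ → ℝ}
lemma congr (h : CSym ψ) {x y : ℝ} (hxy : Real.cos x = Real.cos y) : ψ x = ψ y :=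
  le_antisymm (h.mono _ _ hxy.le) (h.mono _ _ hxy.ge)
lemma even (h : CSym ψ) (x : ℝ) : ψ (-x) = ψ x := h.congr (Real.cos_neg x)
lemma periodic (h : CSym ψ) : Function.Periodic ψ (2 * π) := fun x => h.congr (Real.cos_add_two_pi x)
lemma le_zero (h : CSym ψ) (x : ℝ) : ψ x ≤ ψ 0 := h.mono _ _ (by simp [Real.cos_le_one])
lemma pi_eq (h : CSym ψ) : ψ π = - ψ 0 := by have := h.anti 0; simpa using this
lemma pi_sub (h : CSym ψ) (x : ℝ) : ψ (π - x) = - ψ x := by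
  have := h.anti (-x); rw [h.even] at this; rw [← this]; congr 1; ring
lemma ge_neg (h : CSym ψ) (x : ℝ) : -ψ 0 ≤ ψ x := by
  rw [← h.pi_eq]; exact h.mono _ _ (by simp [Real.neg_one_le_cos])
lemma abs_le (h : CSym ψ) (x : ℝ) : |ψ x| ≤ ψ 0 := _root_.abs_le.2 ⟨h.ge_neg x, h.le_zero x⟩
lemma half_pi (h : CSym ψ) : ψ (π / 2) = 0 := by
  have := h.pi_sub (π/2); rw [show π - π/2 = π/2 by ring] at this; linarith
lemma nonneg (h : CSym ψ) {x : ℝ} (hx : 0 ≤ Real.cos x) : 0 ≤ ψ x := by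
  rw [← h.half_pi]; exact h.mono _ _ (by simpa using hx)
lemma zero_nonneg (h : CSym ψ) : 0 ≤ ψ 0 := h.nonneg (by simp)
lemma antitoneOn (h : CSym ψ) : AntitoneOn ψ (Icc 0 π) := by
  intro x hx y hy hxy
  exact h.mono _ _ (Real.strictAntiOn_cos.antitoneOn hx hy hxy)
end CSym

section
variable {α : ℝ}

lemma KK_intervalIntegrable (h0 : 0 < α) (h1 : α < 1) {f : ℝ → ℝ} (hf : Continuous f) (x a b : ℝ) :
    IntervalIntegrable (fun y => Kker α (x - y) * f y) volume a b := by
  apply IntervalIntegrable.mul_continuousOn _ hf.continuousOn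
  have := (Kker_intervalIntegrable h0 h1 (x - a) (x - b)).comp_sub_left x
  simpa using this

lemma conv_shift {ψ : ℝ → ℝ} (hp : Function.Periodic ψ (2 * π)) (x a : ℝ) :
    conv α ψ x = ∫ y in a..(a + 2 * π), Kker α (x - y) * ψ y := by
  have hper : Function.Periodic (fun y => Kker α (x - y) * ψ y) (2 * π) := by
    intro y
    simp only
    rw [hp y]
    congr 1
    rw [← (Kker_periodic α) (x - (y + 2 * π))]; congr 1; ring
  have := hper.intervalIntegral_add_eq (-π) a
  unfold conv
  rw [← this]; congr 1; ring

lemma conv_sub {ψ : ℝ → ℝ} (hp : Function.Periodic ψ (2 * π)) (x : ℝ) :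
    conv α ψ x = ∫ z in (-π)..π, Kker α z * ψ (x - z) := by
  rw [conv_shift hp x (x - π)]
  have := intervalIntegral.integral_comp_sub_left (a := -π) (b := π) (fun y => Kker α (x - y) * ψ y) x
  simp only [sub_sub_cancel] at this
  rw [this]; congr 1; ring

lemma ae_cos_ne (x : ℝ) : ∀ᵐ y : ℝ, Real.cos (x - y) < 1 := by
  have : ({y : ℝ | Real.cos (x - y) < 1})ᶜ ⊆ range (fun k : ℤ => x - k * (2 * π)) := by
    intro y hy
    simp only [mem_compl_iff, mem_ofPred_eq, not_lt] at hy
    obtain ⟨k, hk⟩ := (Real.cos_eq_one_iff _).1 (le_antisymm (Real.cos_le_one _) hy)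
    exact ⟨k, by simp only [hk]; ring⟩
  rw [ae_iff]
  exact (Set.Countable.mono this (countable_range _)).measure_zero _

lemma conv_reflect (h0 : 0 < α) (h1 : α < 1) {ψ : ℝ → ℝ} (hψ : CSym ψ) (x x' : ℝ) :
    conv α ψ x - conv α ψ x' = ∫ y in ((x + x')/2 - π)..((x + x')/2),
      (Kker α (x - y) - Kker α (x' - y)) * (ψ y - ψ (x + x' - y)) := by
  set m := (x + x')/2 with hm
  have key : ∀ x x' : ℝ, (x + x')/2 = m → conv α ψ x = ∫ y in (m - π)..m,
      (Kker α (x - y) * ψ y + Kker α (x' - y) * ψ (x + x' - y)) := by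
    intro x x' hmm
    rw [conv_shift hψ.periodic x (m - π), ← intervalIntegral.integral_add_adjacent_intervals
      (KK_intervalIntegrable h0 h1 hψ.cont x (m - π) m) (KK_intervalIntegrable h0 h1 hψ.cont x m _)]
    rw [intervalIntegral.integral_add (KK_intervalIntegrable h0 h1 hψ.cont x _ _)
      (KK_intervalIntegrable (f := fun y => ψ (x + x' - y)) h0 h1 (hψ.cont.comp (by fun_prop)) x' _ _)]
    congr 1
    have := intervalIntegral.integral_comp_sub_left (a := m - π) (b := m) (fun y => Kker α (x - y) * ψ y) (2 * m)
    rw [show 2 * m - m = m by ring, show 2 * m - (m - π) = m - π + 2 * π by ring] at this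
    rw [← this]
    apply intervalIntegral.integral_congr
    intro y _
    simp only
    have e1 : x + x' - y = 2 * m - y := by rw [← hmm]; ring
    rw [e1]
    congr 1
    rw [← Kker_even]; congr 1; rw [← hmm]; ring
  rw [key x x' rfl, key x' x (by rw [hm]; ring), ← intervalIntegral.integral_sub]
  · apply intervalIntegral.integral_congr
    intro y _
    simp only
    rw [add_comm x' x]; ring
  · exact (KK_intervalIntegrable h0 h1 hψ.cont x _ _).add
      (KK_intervalIntegrable (f := fun y => ψ (x + x' - y)) h0 h1 (hψ.cont.comp (by fun_prop)) x' _ _)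
  · exact (KK_intervalIntegrable h0 h1 hψ.cont x' _ _).add
      (KK_intervalIntegrable (f := fun y => ψ (x' + x - y)) h0 h1 (hψ.cont.comp (by fun_prop)) x _ _)

lemma KKK_intervalIntegrable (h0 : 0 < α) (h1 : α < 1) {f : ℝ → ℝ} (hf : Continuous f) (x x' a b : ℝ) :
    IntervalIntegrable (fun y => (Kker α (x - y) - Kker α (x' - y)) * f y) volume a b := by
  simp only [sub_mul]
  exact (KK_intervalIntegrable h0 h1 hf x a b).sub (KK_intervalIntegrable h0 h1 hf x' a b)

lemma cos_sub_cos' (x x' y : ℝ) :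
    Real.cos (x - y) - Real.cos (x' - y) = 2 * Real.sin ((x + x')/2 - y) * Real.sin ((x' - x)/2) := by
  rw [Real.cos_sub_cos, show (x - y + (x' - y))/2 = (x+x')/2 - y by ring,
    show (x - y - (x' - y))/2 = -((x'-x)/2) by ring, Real.sin_neg]; ring

lemma cos_sub_cos'' (x x' y : ℝ) :
    Real.cos y - Real.cos (x + x' - y) = 2 * Real.sin ((x + x')/2) * Real.sin ((x+x')/2 - y) := by
  rw [Real.cos_sub_cos, show (y + (x + x' - y))/2 = (x+x')/2 by ring,
    show (y - (x + x' - y))/2 = -((x+x')/2 - y) by ring, Real.sin_neg]; ring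

lemma conv_congr {ψ : ℝ → ℝ} (hψ : CSym ψ) {x y : ℝ} (h : Real.cos x = Real.cos y) :
    conv α ψ x = conv α ψ y := by
  have hev : ∀ x, conv α ψ (-x) = conv α ψ x := by
    intro x
    unfold conv
    have := intervalIntegral.integral_comp_neg (a := -π) (b := π) (fun y => Kker α (-x - y) * ψ y)
    rw [neg_neg] at this
    rw [← this]
    apply intervalIntegral.integral_congr
    intro y _
    simp only
    rw [hψ.even, ← Kker_even]; congr 2; ring
  have hper : ∀ (x : ℝ) (k : ℤ), conv α ψ (x + k * (2 * π)) = conv α ψ x := by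
    intro x k
    unfold conv
    congr 1; ext y; congr 1
    rw [show x + k * (2 * π) - y = (x - y) + k * (2 * π) by ring]
    exact (Kker_periodic α).int_mul k (x - y)
  obtain ⟨k, hk | hk⟩ := (Real.cos_eq_cos_iff).1 h
  · rw [hk, show 2 * k * π + x = x + k * (2 * π) by ring, hper]
  · rw [hk, show 2 * k * π - x = -x + k * (2 * π) by ring, hper, hev]

lemma conv_anti_nonneg (h0 : 0 < α) (h1 : α < 1) {ψ : ℝ → ℝ} (hψ : CSym ψ) {x x' : ℝ}
    (hx : 0 ≤ x) (hxx : x ≤ x') (hx' : x' ≤ π) (y : ℝ)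
    (hy : y ∈ Icc ((x+x')/2 - π) ((x+x')/2)) (hc : Real.cos (x - y) < 1) :
    0 ≤ (Kker α (x - y) - Kker α (x' - y)) * (ψ y - ψ (x + x' - y)) := by
  have s1 : 0 ≤ Real.sin ((x+x')/2) := Real.sin_nonneg_of_nonneg_of_le_pi (by linarith) (by linarith)
  have s2 : 0 ≤ Real.sin ((x+x')/2 - y) := Real.sin_nonneg_of_nonneg_of_le_pi (by linarith [hy.2]) (by linarith [hy.1])
  have s3 : 0 ≤ Real.sin ((x'-x)/2) := Real.sin_nonneg_of_nonneg_of_le_pi (by linarith) (by linarith)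
  apply mul_nonneg
  · apply sub_nonneg.2
    apply Kker_le h0 _ hc
    have := cos_sub_cos' x x' y
    nlinarith [mul_nonneg s2 s3]
  · apply sub_nonneg.2
    apply hψ.mono
    have := cos_sub_cos'' x x' y
    nlinarith [mul_nonneg s1 s2]

lemma conv_antitone (h0 : 0 < α) (h1 : α < 1) {ψ : ℝ → ℝ} (hψ : CSym ψ) {x x' : ℝ}
    (hx : 0 ≤ x) (hxx : x ≤ x') (hx' : x' ≤ π) : conv α ψ x' ≤ conv α ψ x := by
  rw [← sub_nonneg, conv_reflect h0 h1 hψ]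
  apply intervalIntegral.integral_nonneg_of_ae_restrict (by linarith [Real.pi_pos])
  filter_upwards [ae_restrict_mem measurableSet_Icc, ae_restrict_of_ae (ae_cos_ne x)] with y hy hc
  exact conv_anti_nonneg h0 h1 hψ hx hxx hx' y hy hc

lemma conv_mono (h0 : 0 < α) (h1 : α < 1) {ψ : ℝ → ℝ} (hψ : CSym ψ) (x y : ℝ)
    (h : Real.cos x ≤ Real.cos y) : conv α ψ x ≤ conv α ψ y := by
  have e : ∀ x, conv α ψ x = conv α ψ (Real.arccos (Real.cos x)) := fun x =>
    conv_congr hψ (Real.cos_arccos (Real.neg_one_le_cos x) (Real.cos_le_one x)).symm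
  rw [e x, e y]
  exact conv_antitone h0 h1 hψ (Real.arccos_nonneg _) (Real.arccos_le_arccos h) (Real.arccos_le_pi _)

lemma conv_anti {ψ : ℝ → ℝ} (hψ : CSym ψ) (x : ℝ) : conv α ψ (x + π) = - conv α ψ x := by
  rw [conv_sub hψ.periodic, conv_sub hψ.periodic, ← intervalIntegral.integral_neg]
  congr 1; ext z
  rw [show x + π - z = x - z + π by ring, hψ.anti]; ring

lemma conv_strict (h0 : 0 < α) (h1 : α < 1) {ψ : ℝ → ℝ} (hψ : CSym ψ) (hψ0 : 0 < ψ 0) {x x' : ℝ}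
    (hx : 0 ≤ x) (hxx : x < x') (hx' : x' ≤ π) : conv α ψ x' < conv α ψ x := by
  have hpi := Real.pi_pos
  set m := (x+x')/2 with hm
  have hm0 : 0 < m := by rw [hm]; linarith
  have hmpi : m < π := by rw [hm]; linarith
  have s1 : 0 < Real.sin m := Real.sin_pos_of_pos_of_lt_pi hm0 hmpi
  have s3 : 0 < Real.sin ((x'-x)/2) := Real.sin_pos_of_pos_of_lt_pi (by linarith) (by linarith)
  -- existence of a point of positivity
  have hex : ∃ y ∈ Ioo (m - π) m, 0 < ψ y - ψ (x + x' - y) := by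
    by_contra hcon
    push Not at hcon
    have heq : ∀ y ∈ Icc (m - π) m, ψ y = ψ (2 * m - y) := by
      have h1 : ∀ y ∈ Ioo (m - π) m, ψ y - ψ (2 * m - y) = 0 := by
        intro y hy
        have e1 : x + x' - y = 2 * m - y := by rw [hm]; ring
        have h2 := hcon y hy
        rw [e1] at h2
        refine le_antisymm h2 ?_
        apply sub_nonneg.2
        apply hψ.mono
        have := cos_sub_cos'' x x' y
        rw [e1] at this
        have s2 : 0 ≤ Real.sin (m - y) := Real.sin_nonneg_of_nonneg_of_le_pi (by linarith [hy.2]) (by linarith [hy.1])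
        nlinarith [mul_nonneg s1.le s2]
      have hcl : IsClosed {y | ψ y - ψ (2 * m - y) = 0} :=
        isClosed_eq (hψ.cont.sub (hψ.cont.comp (by fun_prop))) continuous_const
      have hsub : closure (Ioo (m - π) m) ⊆ {y | ψ y - ψ (2 * m - y) = 0} :=
        hcl.closure_subset_iff.2 h1
      rw [closure_Ioo (by linarith)] at hsub
      intro y hy
      exact sub_eq_zero.1 (hsub hy)
    have heq2 : ∀ y ∈ Icc (m - π) (m + π), ψ y = ψ (2 * m - y) := by
      intro y hy
      by_cases h : y ≤ m
      · exact heq y ⟨hy.1, h⟩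
      · have := heq (2 * m - y) ⟨by linarith [hy.2], by push Not at h; linarith⟩
        rw [this]; congr 1; ring
    have heq3 : ∀ y, ψ y = ψ (2 * m - y) := by
      intro y
      obtain ⟨k, hk, _⟩ := existsUnique_add_zsmul_mem_Ico (show (0:ℝ) < 2 * π by positivity) y (m - π)
      simp only [zsmul_eq_mul] at hk
      have := heq2 (y + k * (2 * π)) ⟨hk.1, by linarith [hk.2]⟩
      rw [hψ.periodic.int_mul k y] at this
      rw [this, show 2 * m - (y + k * (2 * π)) = (2 * m - y) - k * (2 * π) by ring]
      exact hψ.periodic.sub_int_mul_eq k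
    have hperm : ∀ y, ψ (y + 2 * m) = ψ y := by
      intro y
      rw [← hψ.even y, heq3 (-y)]; congr 1; ring
    have hθ : ∃ θ, 0 < θ ∧ θ ≤ π ∧ ∀ y, ψ (y + θ) = ψ y := by
      by_cases h : 2 * m ≤ π
      · exact ⟨2 * m, by linarith, h, hperm⟩
      · refine ⟨2 * π - 2 * m, by linarith, by linarith, ?_⟩
        intro y
        have := hperm (y + (2 * π - 2 * m))
        rw [← this, show y + (2 * π - 2 * m) + 2 * m = y + 2 * π by ring]
        exact hψ.periodic y
    obtain ⟨θ, hθ0, hθ1, hθ⟩ := hθ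
    have hk : ∀ k : ℕ, ψ (k * θ) = ψ 0 := by
      intro k
      induction k with
      | zero => simp
      | succ k ih => push_cast; rw [add_mul, one_mul, hθ, ih]
    have h5 := hk ⌈π / (2 * θ)⌉₊
    set k := ⌈π / (2 * θ)⌉₊
    have h6 : π / (2 * θ) ≤ k := Nat.le_ceil _
    have h7 : (k:ℝ) < π / (2 * θ) + 1 := Nat.ceil_lt_add_one (by positivity)
    have h8 : π / 2 ≤ k * θ := by
      rw [div_le_iff₀ (by positivity)] at h6; linarith
    have h9 : k * θ ≤ π + π / 2 := by
      have : k * θ ≤ (π / (2 * θ) + 1) * θ := by gcongr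
      have e : (π / (2 * θ) + 1) * θ = π / 2 + θ := by field_simp
      linarith
    have h10 := Real.cos_nonpos_of_pi_div_two_le_of_le h8 h9
    have h11 : ψ (k * θ) ≤ ψ (π/2) := hψ.mono _ _ (by simpa using h10)
    rw [hψ.half_pi] at h11
    linarith
  obtain ⟨y0, hy0, hpos⟩ := hex
  rw [← sub_pos, conv_reflect h0 h1 hψ]
  rw [intervalIntegral.integral_pos_iff_support_of_nonneg_ae']
  · refine ⟨by linarith, ?_⟩
    set U := {y | 0 < ψ y - ψ (x + x' - y)} ∩ Ioo (m - π) m ∩ {x}ᶜ with hU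
    have hUo : IsOpen ({y | 0 < ψ y - ψ (x + x' - y)} ∩ Ioo (m - π) m) :=
      (isOpen_lt continuous_const (hψ.cont.sub (hψ.cont.comp (by fun_prop)))).inter isOpen_Ioo
    have hUpos : 0 < volume U := by
      rw [hU, ← Set.sdiff_eq, measure_sdiff_null (by simp)]
      exact hUo.measure_pos _ ⟨y0, hpos, hy0⟩
    refine lt_of_lt_of_le hUpos (measure_mono ?_)
    rintro y ⟨⟨hy1, hy2⟩, hy3⟩
    refine ⟨?_, hy2.1, hy2.2.le⟩
    rw [Function.mem_support]
    have hy1 : 0 < ψ y - ψ (x + x' - y) := hy1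
    have hne : x - y ≠ 0 := fun h => hy3 (by simp; linarith)
    have hcos : Real.cos (x - y) < 1 := by
      rcases cos_lt_one_or (x - y) with h | h
      · exact h
      · exfalso
        apply hne
        have := (Real.cos_eq_one_iff_of_lt_of_lt (x := x - y) (by linarith [hy2.2]) (by linarith [hy2.1])).1 h
        exact this
    have s2 : 0 < Real.sin (m - y) := Real.sin_pos_of_pos_of_lt_pi (by linarith [hy2.2]) (by linarith [hy2.1])
    have hK : 0 < Kker α (x - y) - Kker α (x' - y) := by
      apply sub_pos.2
      apply Kker_lt h0 _ hcos
      have := cos_sub_cos' x x' y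
      rw [← hm] at this
      nlinarith [mul_pos s2 s3]
    exact (mul_pos hK hy1).ne'
  · rw [uIoc_of_le (by linarith)]
    filter_upwards [ae_restrict_mem measurableSet_Ioc, ae_restrict_of_ae (ae_cos_ne x)] with y hy hc
    exact conv_anti_nonneg h0 h1 hψ hx hxx.le hx' y ⟨hy.1.le, hy.2⟩ hc
  · exact KKK_intervalIntegrable (f := fun y => ψ y - ψ (x + x' - y)) h0 h1
      (hψ.cont.sub (hψ.cont.comp (by fun_prop))) x x' _ _
end

section
variable {α : ℝ}

/-- first difference bound away from the singularity -/
lemma K_diff_bound (h0 : 0 < α) (h1 : α < 1) :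
    ∃ C > 0, ∀ z h : ℝ, z ≠ 0 → |z| ≤ π → |h| ≤ |z|/2 →
      |Kker α (z + h) - Kker α z| ≤ C * |h| * |z| ^ (α - 2) := by
  obtain ⟨C, hC, hd⟩ := dK_bound h0 h1
  have hpi := Real.pi_pos
  refine ⟨C * (1/2) ^ (α - 2), by positivity, ?_⟩
  intro z h hz hzpi hh
  have hz0 := abs_pos.2 hz
  have key : ∀ ξ ∈ uIcc z (z+h), |z|/2 ≤ |ξ| ∧ |ξ| ≤ 3 * π / 2 := by
    intro ξ hξ
    have h2 : |ξ - z| ≤ |h| := by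
      have := abs_sub_left_of_mem_uIcc hξ
      simpa using this
    have a1 := abs_sub_abs_le_abs_sub z ξ
    have a2 := abs_sub_abs_le_abs_sub ξ z
    rw [abs_sub_comm] at a1
    constructor <;> linarith
  have := Convex.norm_image_sub_le_of_norm_hasDerivWithin_le (f := Kker α) (f' := dK α)
    (C := C * ((1/2) ^ (α - 2) * |z| ^ (α - 2))) (s := uIcc z (z+h)) (x := z) (y := z + h)
    (by
      intro ξ hξ
      obtain ⟨k1, k2⟩ := key ξ hξ
      have hξ0 : ξ ≠ 0 := abs_pos.1 (by linarith)
      exact (Kker_hasDerivAt h0 (cos_lt_one_of hξ0 k2)).hasDerivWithinAt)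
    (by
      intro ξ hξ
      obtain ⟨k1, k2⟩ := key ξ hξ
      have hξ0 : ξ ≠ 0 := abs_pos.1 (by linarith)
      refine (hd ξ hξ0 k2).trans ?_
      rw [← Real.mul_rpow (by norm_num) hz0.le]
      gcongr 1
      exact Real.rpow_le_rpow_of_nonpos (by positivity) (by linarith) (by linarith))
    (convex_uIcc _ _) left_mem_uIcc right_mem_uIcc
  simp only [Real.norm_eq_abs, add_sub_cancel_left] at this
  refine this.trans (le_of_eq (by ring))

/-- symmetrized second difference bound -/
lemma K_sym_bound (h0 : 0 < α) (h1 : α < 1) :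
    ∃ C > 0, ∀ x y z : ℝ, 0 ≤ x → x ≤ y → 2 * y ≤ z → 0 < z → z ≤ π →
      |Kker α (z + y) + Kker α (z - y) - Kker α (z + x) - Kker α (z - x)| ≤
        C * (y - x) * y * z ^ (α - 3) := by
  obtain ⟨C, hC, hd⟩ := ddK_bound h0 h1
  have hpi := Real.pi_pos
  refine ⟨2 * C * (1/2) ^ (α - 3), by positivity, ?_⟩
  intro x y z hx hxy hyz hz0 hzpi
  have key : ∀ ξ : ℝ, |ξ - z| ≤ z/2 → ξ ≠ 0 ∧ Real.cos ξ < 1 ∧ |ddK α ξ| ≤ C * ((1/2) ^ (α - 3) * z ^ (α - 3)) := by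
    intro ξ hξ
    rw [abs_le] at hξ
    have hξ0 : 0 < ξ := by linarith
    have hξ1 : |ξ| ≤ 3 * π / 2 := by rw [abs_of_pos hξ0]; linarith
    refine ⟨hξ0.ne', cos_lt_one_of hξ0.ne' hξ1, (hd ξ hξ0.ne' hξ1).trans ?_⟩
    rw [← Real.mul_rpow (by norm_num) hz0.le, abs_of_pos hξ0]
    gcongr 1
    exact Real.rpow_le_rpow_of_nonpos (by positivity) (by linarith) (by linarith)
  have hdd : ∀ t : ℝ, 0 ≤ t → t ≤ y → |dK α (z + t) - dK α (z - t)| ≤ C * ((1/2) ^ (α - 3) * z ^ (α - 3)) * (2 * t) := by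
    intro t ht hty
    have hin : ∀ ξ ∈ Icc (z - t) (z + t), |ξ - z| ≤ z/2 := by
      intro ξ hξ
      rw [abs_le]; constructor <;> linarith [hξ.1, hξ.2]
    have := Convex.norm_image_sub_le_of_norm_hasDerivWithin_le (f := dK α) (f' := ddK α)
      (C := C * ((1/2) ^ (α - 3) * z ^ (α - 3))) (s := Icc (z-t) (z+t)) (x := z - t) (y := z + t)
      (fun ξ hξ => (dK_hasDerivAt h0 (key ξ (hin ξ hξ)).2.1).hasDerivWithinAt)
      (fun ξ hξ => (key ξ (hin ξ hξ)).2.2)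
      (convex_Icc _ _) ⟨le_rfl, by linarith⟩ ⟨by linarith, le_rfl⟩
    simp only [Real.norm_eq_abs] at this
    rw [show z + t - (z - t) = 2 * t by ring, abs_of_nonneg (show 0 ≤ 2 * t by linarith)] at this
    exact this
  have := Convex.norm_image_sub_le_of_norm_hasDerivWithin_le (f := fun t => Kker α (z + t) + Kker α (z - t))
      (f' := fun t => dK α (z + t) - dK α (z - t))
      (C := C * ((1/2) ^ (α - 3) * z ^ (α - 3)) * (2 * y)) (s := Icc x y) (x := x) (y := y)
      (by
        intro t ht
        have c1 := (key (z + t) (by rw [abs_le]; constructor <;> linarith [ht.1, ht.2])).2.1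
        have c2 := (key (z - t) (by rw [abs_le]; constructor <;> linarith [ht.1, ht.2])).2.1
        have d1 := (Kker_hasDerivAt h0 c1).comp_const_add z t
        have d2 := (Kker_hasDerivAt h0 c2).comp_const_sub z t
        exact (d1.add d2).hasDerivWithinAt)
      (by
        intro t ht
        refine (hdd t (by linarith [ht.1]) ht.2).trans ?_
        have := ht.2
        gcongr)
      (convex_Icc _ _) ⟨le_rfl, hxy⟩ ⟨hxy, le_rfl⟩
  simp only [Real.norm_eq_abs] at this
  rw [abs_of_nonneg (show 0 ≤ y - x by linarith)] at this
  rw [show Kker α (z + y) + Kker α (z - y) - Kker α (z + x) - Kker α (z - x) =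
    Kker α (z + y) + Kker α (z - y) - (Kker α (z + x) + Kker α (z - x)) by ring]
  refine this.trans (le_of_eq (by ring))

lemma integral_abs_rpow {e r : ℝ} (he : -1 < e) (hr : 0 ≤ r) :
    ∫ z in (-r)..r, |z| ^ e = 2 * (r ^ (e + 1) / (e + 1)) := by
  have h1 : ∫ z in (0:ℝ)..r, |z| ^ e = r ^ (e+1) / (e+1) := by
    have : ∫ z in (0:ℝ)..r, |z| ^ e = ∫ z in (0:ℝ)..r, z ^ e := by
      apply intervalIntegral.integral_congr
      intro z hz
      rw [uIcc_of_le hr] at hz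
      simp only [abs_of_nonneg hz.1]
    rw [this, integral_rpow (Or.inl he), Real.zero_rpow (by linarith), sub_zero]
  have h2 : ∫ z in (-r)..0, |z| ^ e = r ^ (e+1) / (e+1) := by
    have := intervalIntegral.integral_comp_neg (a := 0) (b := r) (fun z : ℝ => |z| ^ e)
    simp only [abs_neg, neg_zero] at this
    rw [← this, h1]
  rw [← intervalIntegral.integral_add_adjacent_intervals (absrpow_intervalIntegrable he _ 0)
    (absrpow_intervalIntegrable he 0 _), h1, h2]; ring

lemma K_int_near (h0 : 0 < α) (h1 : α < 1) :
    ∃ C > 0, ∀ r : ℝ, 0 ≤ r → r ≤ 3 * π / 2 → ∫ z in (-r)..r, |Kker α z| ≤ C * r ^ α := by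
  obtain ⟨C, hC, hb⟩ := Kker_bound h0 h1
  refine ⟨C * 2 / α, by positivity, ?_⟩
  intro r hr hr2
  calc ∫ z in (-r)..r, |Kker α z| ≤ ∫ z in (-r)..r, C * |z| ^ (α - 1) := by
        apply intervalIntegral.integral_mono_on (by linarith) (Kker_intervalIntegrable h0 h1 _ _).abs
          ((absrpow_intervalIntegrable (by linarith) _ _).const_mul C)
        intro z hz
        by_cases hz0 : z = 0
        · rw [hz0, Kker_zero (by simp)]; simp; positivity
        · exact hb z hz0 (abs_le.2 ⟨by linarith [hz.1], by linarith [hz.2]⟩)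
    _ = _ := by
      rw [intervalIntegral.integral_const_mul, integral_abs_rpow (by linarith) hr]
      rw [sub_add_cancel]; ring

lemma integral_rpow_tail {e a b : ℝ} (he : e < -1) (ha : 0 < a) (hab : a ≤ b) :
    ∫ z in a..b, z ^ e ≤ a ^ (e + 1) / (-(e + 1)) := by
  rw [integral_rpow (Or.inr ⟨by linarith, by rw [uIcc_of_le hab]; intro h; linarith [h.1]⟩)]
  have hb : 0 < b ^ (e+1) := by have : 0 < b := by linarith
                                positivity
  rw [div_neg, ← neg_div]
  exact div_le_div_of_nonpos_of_le (by linarith) (by linarith)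

lemma rpow_intervalIntegrable {e a b : ℝ} (ha : 0 < a) (hab : a ≤ b) :
    IntervalIntegrable (fun z : ℝ => z ^ e) volume a b := by
  apply intervalIntegral.intervalIntegrable_rpow
  right; rw [uIcc_of_le hab]; intro h; linarith [h.1]

lemma K_L1_modulus (h0 : 0 < α) (h1 : α < 1) :
    ∃ C > 0, ∀ h : ℝ, ∫ z in (-π)..π, |Kker α (z + h) - Kker α z| ≤ C * |h| ^ α := by
  obtain ⟨C1, hC1, hb⟩ := K_diff_bound h0 h1
  obtain ⟨C2, hC2, hn⟩ := K_int_near h0 h1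
  have hpi := Real.pi_pos
  set N := ∫ z in (-π)..π, |Kker α z| with hN
  have hN0 : 0 ≤ N := intervalIntegral.integral_nonneg (by linarith) fun _ _ => abs_nonneg _
  have hKi := Kker_intervalIntegrable h0 h1
  have hKh : ∀ h a b : ℝ, IntervalIntegrable (fun z => Kker α (z + h)) volume a b := by
    intro h a b
    have := (hKi (a + h) (b + h)).comp_add_right h
    simpa using this
  have hDi : ∀ h a b : ℝ, IntervalIntegrable (fun z => |Kker α (z + h) - Kker α z|) volume a b :=
    fun h a b => ((hKh h a b).sub (hKi a b)).abs
  have hper : Function.Periodic (fun z => |Kker α z|) (2 * π) := fun z => by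
    simp only [(Kker_periodic α) z]
  refine ⟨2 * N / (π/4) ^ α + 2 * C2 * 3 ^ α + 2 * (C1 * (2 ^ (α - 1) / (1 - α))) + 1, ?_, ?_⟩
  · have : 0 < 1 - α := by linarith
    positivity
  intro h
  have hα1 : 0 < 1 - α := by linarith
  have hh0 : 0 ≤ |h| ^ α := by positivity
  have t1 : 0 ≤ 2 * N / (π/4) ^ α := by positivity
  have t2 : 0 ≤ 2 * C2 * 3 ^ α := by positivity
  have t3 : 0 ≤ 2 * (C1 * (2 ^ (α - 1) / (1 - α))) := by positivity
  by_cases hbig : π / 4 ≤ |h|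
  · have h2 : ∫ z in (-π)..π, |Kker α (z + h) - Kker α z| ≤ 2 * N := by
      calc _ ≤ ∫ z in (-π)..π, (|Kker α (z + h)| + |Kker α z|) := by
            apply intervalIntegral.integral_mono_on (by linarith) (hDi h _ _) ((hKh h _ _).abs.add (hKi _ _).abs)
            intro z _; exact abs_sub _ _
        _ = N + N := by
            rw [intervalIntegral.integral_add (hKh h _ _).abs (hKi _ _).abs]
            congr 1
            rw [intervalIntegral.integral_comp_add_right (fun z => |Kker α z|) h, hN]
            have := hper.intervalIntegral_add_eq (-π + h) (-π)
            rw [show -π + h + 2 * π = π + h by ring, show -π + 2 * π = π by ring] at this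
            exact this
        _ = _ := by ring
    have h3 : 2 * N ≤ 2 * N / (π/4) ^ α * |h| ^ α := by
      have : (π/4) ^ α ≤ |h| ^ α := by gcongr
      have hp : 0 < (π/4) ^ α := by positivity
      calc 2 * N = 2 * N / (π/4) ^ α * (π/4) ^ α := by field_simp
        _ ≤ _ := by gcongr
    nlinarith [mul_nonneg t2 hh0, mul_nonneg t3 hh0]
  · push Not at hbig
    by_cases hz : h = 0
    · subst hz; simp [Real.zero_rpow h0.ne']
    have hH : 0 < |h| := abs_pos.2 hz
    set H := |h| with hHdef
    have i1 : ∫ z in (-(2 * H))..(2 * H), |Kker α (z + h) - Kker α z| ≤ 2 * C2 * 3 ^ α * H ^ α := by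
      have j1 : ∫ z in (-(2 * H))..(2 * H), |Kker α (z + h)| ≤ C2 * (3 * H) ^ α := by
        rw [intervalIntegral.integral_comp_add_right (fun z => |Kker α z|) h]
        refine le_trans ?_ (hn (3 * H) (by positivity) (by linarith))
        apply intervalIntegral.integral_mono_interval
        · linarith [neg_abs_le h]
        · linarith
        · linarith [le_abs_self h]
        · exact Eventually.of_forall fun _ => abs_nonneg _
        · exact (hKi _ _).abs
      have j2 : ∫ z in (-(2 * H))..(2 * H), |Kker α z| ≤ C2 * (3 * H) ^ α := by
        refine (hn (2 * H) (by positivity) (by linarith)).trans ?_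
        gcongr; norm_num
      calc _ ≤ ∫ z in (-(2 * H))..(2 * H), (|Kker α (z + h)| + |Kker α z|) := by
            apply intervalIntegral.integral_mono_on (by linarith) (hDi h _ _) ((hKh h _ _).abs.add (hKi _ _).abs)
            intro z _; exact abs_sub _ _
        _ ≤ C2 * (3 * H) ^ α + C2 * (3 * H) ^ α := by
            rw [intervalIntegral.integral_add (hKh h _ _).abs (hKi _ _).abs]
            exact add_le_add j1 j2
        _ = _ := by rw [Real.mul_rpow (by norm_num) hH.le]; ring
    have tail : ∫ z in (2 * H)..π, C1 * H * z ^ (α - 2) ≤ C1 * (2 ^ (α - 1) / (1 - α)) * H ^ α := by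
      rw [intervalIntegral.integral_const_mul]
      have := integral_rpow_tail (e := α - 2) (a := 2 * H) (b := π) (by linarith) (by positivity) (by linarith)
      calc C1 * H * ∫ z in (2 * H)..π, z ^ (α - 2) ≤ C1 * H * ((2 * H) ^ (α - 2 + 1) / (-(α - 2 + 1))) := by gcongr
        _ = _ := by
          rw [show α - 2 + 1 = α - 1 by ring, Real.mul_rpow (by norm_num) hH.le, Real.rpow_sub_one hH.ne' α,
            show -(α - 1) = 1 - α by ring]
          field_simp
    have i2 : ∫ z in (2 * H)..π, |Kker α (z + h) - Kker α z| ≤ C1 * (2 ^ (α - 1) / (1 - α)) * H ^ α := by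
      refine le_trans ?_ tail
      apply intervalIntegral.integral_mono_on (by linarith) (hDi h _ _)
      · exact (rpow_intervalIntegrable (by positivity) (by linarith)).const_mul _
      · intro z hz
        have hz0 : 0 < z := by linarith [hz.1]
        have := hb z h hz0.ne' (by rw [abs_of_pos hz0]; exact hz.2) (by rw [abs_of_pos hz0]; linarith [hz.1])
        rwa [abs_of_pos hz0] at this
    have i3 : ∫ z in (-π)..(-(2 * H)), |Kker α (z + h) - Kker α z| ≤ C1 * (2 ^ (α - 1) / (1 - α)) * H ^ α := by
      have e := intervalIntegral.integral_comp_neg (a := 2 * H) (b := π) (fun z => |Kker α (z + h) - Kker α z|)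
      rw [← e]
      refine le_trans ?_ tail
      apply intervalIntegral.integral_mono_on (by linarith)
      · have := (hDi h (-(2 * H)) (-π))
        rw [IntervalIntegrable.iff_comp_neg] at this
        simpa using this
      · exact (rpow_intervalIntegrable (by positivity) (by linarith)).const_mul _
      · intro z hz
        have hz0 : 0 < z := by linarith [hz.1]
        have := hb (-z) h (by linarith) (by rw [abs_neg, abs_of_pos hz0]; exact hz.2) (by rw [abs_neg, abs_of_pos hz0]; linarith [hz.1])
        rwa [abs_neg, abs_of_pos hz0] at this
    rw [← intervalIntegral.integral_add_adjacent_intervals (hDi h (-π) (-(2 * H))) (hDi h _ π),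
      ← intervalIntegral.integral_add_adjacent_intervals (hDi h (-(2 * H)) (2 * H)) (hDi h _ π)]
    nlinarith [mul_nonneg t1 hh0]

lemma conv_holder (h0 : 0 < α) (h1 : α < 1) :
    ∃ C > 0, ∀ (ψ : ℝ → ℝ) (M : ℝ), Continuous ψ → (∀ x, |ψ x| ≤ M) → ∀ x y : ℝ,
      |conv α ψ x - conv α ψ y| ≤ C * M * |x - y| ^ α := by
  obtain ⟨C, hC, hL⟩ := K_L1_modulus h0 h1
  refine ⟨C, hC, ?_⟩
  intro ψ M hψ hM x y
  have hM0 : 0 ≤ M := (abs_nonneg _).trans (hM 0)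
  have hi := Kker_intervalIntegrable h0 h1
  have hKs : ∀ x a b : ℝ, IntervalIntegrable (fun z => Kker α (x - z)) volume a b := by
    intro x a b
    have := (hi (x - a) (x - b)).comp_sub_left x
    simpa using this
  have hpi := Real.pi_pos
  unfold conv
  rw [← intervalIntegral.integral_sub (KK_intervalIntegrable h0 h1 hψ x _ _) (KK_intervalIntegrable h0 h1 hψ y _ _)]
  calc |∫ z in (-π)..π, (Kker α (x - z) * ψ z - Kker α (y - z) * ψ z)|
      ≤ ∫ z in (-π)..π, |Kker α (x - z) * ψ z - Kker α (y - z) * ψ z| :=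
        intervalIntegral.abs_integral_le_integral_abs (by linarith)
    _ ≤ ∫ z in (-π)..π, M * |Kker α (x - z) - Kker α (y - z)| := by
        apply intervalIntegral.integral_mono_on (by linarith)
        · exact ((KK_intervalIntegrable h0 h1 hψ x _ _).sub (KK_intervalIntegrable h0 h1 hψ y _ _)).abs
        · exact ((hKs x _ _).sub (hKs y _ _)).abs.const_mul M
        · intro z _
          rw [← sub_mul, abs_mul, mul_comm]
          gcongr; exact hM z
    _ = M * ∫ z in (-π)..π, |Kker α (x - z) - Kker α (y - z)| := intervalIntegral.integral_const_mul _ _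
    _ = M * ∫ z in (-π)..π, |Kker α (z + (x - y)) - Kker α z| := by
        congr 1
        have e1 := intervalIntegral.integral_comp_sub_left (a := -π) (b := π) (fun z => |Kker α (z + (x - y)) - Kker α z|) y
        have e2 : ∀ z, |Kker α (y - z + (x - y)) - Kker α (y - z)| = |Kker α (x - z) - Kker α (y - z)| := by
          intro z; congr 3; ring
        simp only [e2] at e1
        rw [e1]
        have hper : Function.Periodic (fun z => |Kker α (z + (x - y)) - Kker α z|) (2 * π) := fun z => by
          simp only [(Kker_periodic α) z]
          rw [show z + 2 * π + (x - y) = z + (x - y) + 2 * π by ring, (Kker_periodic α)]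
        have := hper.intervalIntegral_add_eq (y - π) (-π)
        rw [show y - π + 2 * π = y - -π by ring, show -π + 2 * π = π by ring] at this
        exact this
    _ ≤ M * (C * |x - y| ^ α) := by gcongr; exact hL _
    _ = _ := by ring

end

section
variable {α : ℝ}

lemma conv_half (h0 : 0 < α) (h1 : α < 1) {ψ : ℝ → ℝ} (hψ : CSym ψ) (x : ℝ) :
    conv α ψ x = ∫ y in (-(π/2))..(π/2), (Kker α (x - y) - Kker α (π - x - y)) * ψ y := by
  rw [conv_shift hψ.periodic x (-(π/2)), ← intervalIntegral.integral_add_adjacent_intervals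
      (KK_intervalIntegrable h0 h1 hψ.cont x _ (π/2)) (KK_intervalIntegrable h0 h1 hψ.cont x _ _)]
  have e := intervalIntegral.integral_comp_sub_left (a := -(π/2)) (b := π/2) (fun y => Kker α (x - y) * ψ y) π
  rw [show π - π/2 = π/2 by ring, show π - -(π/2) = -(π/2) + 2 * π by ring] at e
  rw [← e]
  simp only [sub_mul]
  rw [intervalIntegral.integral_sub (KK_intervalIntegrable h0 h1 hψ.cont x _ _) (KK_intervalIntegrable h0 h1 hψ.cont (π - x) _ _),
    sub_eq_add_neg, ← intervalIntegral.integral_neg]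
  congr 1
  apply intervalIntegral.integral_congr
  intro y _
  simp only
  rw [hψ.pi_sub, ← Kker_even, show -(x - (π - y)) = π - x - y by ring]; ring

lemma half_nonneg (h0 : 0 < α) {ψ : ℝ → ℝ} (hψ : CSym ψ) {x y : ℝ} (hx : 0 ≤ x) (hx2 : x ≤ π/2)
    (hy : y ∈ Icc (-(π/2)) (π/2)) (hc : Real.cos (x - y) < 1) :
    0 ≤ (Kker α (x - y) - Kker α (π - x - y)) * ψ y := by
  have hcy : 0 ≤ Real.cos y := Real.cos_nonneg_of_mem_Icc ⟨by linarith [hy.1], hy.2⟩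
  have hcx : 0 ≤ Real.cos x := Real.cos_nonneg_of_mem_Icc ⟨by linarith, hx2⟩
  apply mul_nonneg _ (hψ.nonneg hcy)
  apply sub_nonneg.2
  apply Kker_le h0 _ hc
  rw [show π - x - y = π - (x + y) by ring, Real.cos_pi_sub, Real.cos_add, Real.cos_sub]
  nlinarith [mul_nonneg hcx hcy]

lemma mass_lower (h0 : 0 < α) (h1 : α < 1) :
    ∃ κ > 0, ∀ ψ : ℝ → ℝ, CSym ψ → κ * ∫ y in (0:ℝ)..(π/4), ψ y ≤ conv α ψ (π/4) := by
  have hpi := Real.pi_pos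
  refine ⟨Kker α (π/4) - Kker α (π/2), ?_, ?_⟩
  · apply sub_pos.2
    apply Kker_lt h0
    · rw [Real.cos_pi_div_two]; exact Real.cos_pos_of_mem_Ioo ⟨by linarith, by linarith⟩
    · exact cos_lt_one_of (by positivity) (by rw [abs_of_pos (by positivity)]; linarith)
  intro ψ hψ
  rw [conv_half h0 h1 hψ]
  have hi := KKK_intervalIntegrable h0 h1 hψ.cont (π/4) (π - π/4)
  calc (Kker α (π/4) - Kker α (π/2)) * ∫ y in (0:ℝ)..(π/4), ψ y
      = ∫ y in (0:ℝ)..(π/4), (Kker α (π/4) - Kker α (π/2)) * ψ y := by rw [intervalIntegral.integral_const_mul]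
    _ ≤ ∫ y in (0:ℝ)..(π/4), (Kker α (π/4 - y) - Kker α (π - π/4 - y)) * ψ y := by
        apply intervalIntegral.integral_mono_ae_restrict (by linarith) ((hψ.cont.intervalIntegrable _ _).const_mul _) (hi _ _)
        filter_upwards [ae_restrict_mem measurableSet_Icc, ae_restrict_of_ae (ae_cos_ne (π/4))] with y hy hc
        have hy1 := hy.1
        have hy2 := hy.2
        have hψ0 : 0 ≤ ψ y := hψ.nonneg (Real.cos_nonneg_of_mem_Icc ⟨by linarith, by linarith⟩)
        apply mul_le_mul_of_nonneg_right _ hψ0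
        apply sub_le_sub
        · apply Kker_le h0 _ hc
          exact Real.cos_le_cos_of_nonneg_of_le_pi (by linarith) (by linarith) (by linarith)
        · apply Kker_le h0
          · exact Real.cos_le_cos_of_nonneg_of_le_pi (by linarith) (by linarith) (by linarith)
          · exact cos_lt_one_of (by positivity) (by rw [abs_of_pos (by positivity)]; linarith)
    _ ≤ _ := by
        apply intervalIntegral.integral_mono_interval (by linarith) (by linarith) (by linarith) _ (hi _ _)
        filter_upwards [ae_restrict_mem measurableSet_Ioc, ae_restrict_of_ae (ae_cos_ne (π/4))] with y hy hc
        exact half_nonneg h0 hψ (by linarith) (by linarith) ⟨hy.1.le, hy.2⟩ hc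

lemma mass_half {ψ : ℝ → ℝ} (hψ : CSym ψ) : ∫ y in (0:ℝ)..(π/2), ψ y ≤ 2 * ∫ y in (0:ℝ)..(π/4), ψ y := by
  have hpi := Real.pi_pos
  have hi := fun a b : ℝ => hψ.cont.intervalIntegrable (μ := volume) a b
  rw [← intervalIntegral.integral_add_adjacent_intervals (hi 0 (π/4)) (hi (π/4) (π/2)), two_mul]
  gcongr 1
  have e := intervalIntegral.integral_comp_add_right (a := 0) (b := π/4) ψ (π/4)
  rw [zero_add, show π/4 + π/4 = π/2 by ring] at e
  rw [← e]
  apply intervalIntegral.integral_mono_on (by linarith)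
    ((hψ.cont.comp (by fun_prop : Continuous fun x : ℝ => x + π/4)).intervalIntegrable _ _) (hi _ _)
  intro y hy
  exact hψ.antitoneOn ⟨hy.1, by linarith [hy.2]⟩ ⟨by linarith [hy.1], by linarith [hy.2]⟩ (by linarith)

lemma u0_upper (h0 : 0 < α) (h1 : α < 1) :
    ∃ C > 0, ∀ ψ : ℝ → ℝ, CSym ψ → ψ 0 = 1 → 0 < ∫ y in (0:ℝ)..(π/4), ψ y →
      conv α ψ 0 ≤ C * (∫ y in (0:ℝ)..(π/4), ψ y) ^ α := by
  have hpi := Real.pi_pos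
  obtain ⟨C, hC, hb⟩ := Kker_bound h0 h1
  have hα1 : 0 < 1 - α := by linarith
  refine ⟨4 * C / α + 8 * C, by positivity, ?_⟩
  intro ψ hψ hψ1 hm
  set m := ∫ y in (0:ℝ)..(π/4), ψ y with hmdef
  have hmpi : m ≤ π / 4 := by
    calc m ≤ ∫ y in (0:ℝ)..(π/4), (1:ℝ) := by
          apply intervalIntegral.integral_mono_on (by linarith) (hψ.cont.intervalIntegrable _ _) (by simp)
          intro y _; rw [← hψ1]; exact hψ.le_zero y
      _ = _ := by simp
  have hi := KKK_intervalIntegrable h0 h1 hψ.cont 0 (π - 0)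
  have hpt : ∀ y : ℝ, 0 < y → y ≤ π/2 → (Kker α (0 - y) - Kker α (π - 0 - y)) * ψ y ≤ 2 * C * y ^ (α - 1) * ψ y := by
    intro y hy0 hy
    have hψ0 : 0 ≤ ψ y := hψ.nonneg (Real.cos_nonneg_of_mem_Icc ⟨by linarith, by linarith⟩)
    apply mul_le_mul_of_nonneg_right _ hψ0
    have k1 := hb y hy0.ne' (by rw [abs_of_pos hy0]; linarith)
    have k2 := hb (π - y) (by linarith) (by rw [abs_of_pos (by linarith)]; linarith)
    rw [abs_of_pos hy0] at k1
    rw [abs_of_pos (show 0 < π - y by linarith)] at k2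
    have k3 : (π - y) ^ (α - 1) ≤ y ^ (α - 1) := Real.rpow_le_rpow_of_nonpos hy0 (by linarith) (by linarith)
    rw [zero_sub, Kker_even, sub_zero]
    have := (abs_le.1 k1).2
    have := (abs_le.1 k2).1
    nlinarith
  have hrp : ∀ a b : ℝ, IntervalIntegrable (fun y : ℝ => y ^ (α - 1)) volume a b := fun a b =>
    intervalIntegral.intervalIntegrable_rpow' (by linarith)
  have near : ∫ y in (0:ℝ)..m, (Kker α (0 - y) - Kker α (π - 0 - y)) * ψ y ≤ 2 * C / α * m ^ α := by
    calc _ ≤ ∫ y in (0:ℝ)..m, 2 * C * y ^ (α - 1) := by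
          apply intervalIntegral.integral_mono_ae_restrict hm.le (hi _ _) ((hrp _ _).const_mul _)
          filter_upwards [ae_restrict_mem measurableSet_Icc, ae_restrict_of_ae (ae_cos_ne 0)] with y hy hc
          have hy0 : 0 < y := by
            rcases hy.1.lt_or_eq with h | h
            · exact h
            · rw [← h] at hc; simp at hc
          refine (hpt y hy0 (by linarith [hy.2])).trans ?_
          have : ψ y ≤ 1 := by rw [← hψ1]; exact hψ.le_zero y
          have h3 : 0 < 2 * C * y ^ (α - 1) := by positivity
          nlinarith
      _ = _ := by
          rw [intervalIntegral.integral_const_mul, integral_rpow (Or.inl (by linarith)), sub_add_cancel,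
            Real.zero_rpow h0.ne', sub_zero]; ring
  have far : ∫ y in m..(π/2), (Kker α (0 - y) - Kker α (π - 0 - y)) * ψ y ≤ 4 * C * m ^ α := by
    calc _ ≤ ∫ y in m..(π/2), 2 * C * m ^ (α - 1) * ψ y := by
          apply intervalIntegral.integral_mono_on (by linarith) (hi _ _) ((hψ.cont.intervalIntegrable _ _).const_mul _)
          intro y hy
          have hy0 : 0 < y := by linarith [hy.1]
          refine (hpt y hy0 hy.2).trans ?_
          have hψ0 : 0 ≤ ψ y := hψ.nonneg (Real.cos_nonneg_of_mem_Icc ⟨by linarith, by linarith [hy.2]⟩)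
          have : y ^ (α - 1) ≤ m ^ (α - 1) := Real.rpow_le_rpow_of_nonpos hm hy.1 (by linarith)
          gcongr
      _ = 2 * C * m ^ (α - 1) * ∫ y in m..(π/2), ψ y := by rw [intervalIntegral.integral_const_mul]
      _ ≤ 2 * C * m ^ (α - 1) * (2 * m) := by
          have : ∫ y in m..(π/2), ψ y ≤ ∫ y in (0:ℝ)..(π/2), ψ y := by
            apply intervalIntegral.integral_mono_interval hm.le (by linarith) le_rfl _ (hψ.cont.intervalIntegrable _ _)
            filter_upwards [ae_restrict_mem measurableSet_Ioc] with y hy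
            exact hψ.nonneg (Real.cos_nonneg_of_mem_Icc ⟨by linarith [hy.1], hy.2⟩)
          have h3 := mass_half hψ
          gcongr
          linarith
      _ = _ := by rw [Real.rpow_sub_one hm.ne']; field_simp; ring
  have tot : conv α ψ 0 = 2 * ∫ y in (0:ℝ)..(π/2), (Kker α (0 - y) - Kker α (π - 0 - y)) * ψ y := by
    rw [conv_half h0 h1 hψ, ← intervalIntegral.integral_add_adjacent_intervals (hi _ 0) (hi 0 _), two_mul]
    congr 1
    have e := intervalIntegral.integral_comp_neg (a := 0) (b := π/2) (fun y => (Kker α (0 - y) - Kker α (π - 0 - y)) * ψ y)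
    rw [neg_zero] at e
    rw [← e]
    apply intervalIntegral.integral_congr
    intro y _
    simp only
    rw [hψ.even]
    congr 2
    · rw [← Kker_even]; congr 1; ring
    · rw [← Kker_even, ← Kker_periodic]; congr 1; ring
  rw [tot, ← intervalIntegral.integral_add_adjacent_intervals (hi 0 m) (hi m _)]
  calc _ ≤ 2 * (2 * C / α * m ^ α + 4 * C * m ^ α) := by linarith
    _ = _ := by ring
end


/-- normalised nonlinearity, extended linearly outside [-1,1] -/
noncomputable def gt (p s : ℝ) : ℝ := s - nSgn p (max (-1) (min s 1)) / p

section
variable {p : ℝ}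

lemma nSgn_continuous (hp : 1 < p) : Continuous (nSgn p) := by
  unfold nSgn
  exact continuous_id.mul (continuous_abs.rpow_const fun _ => Or.inr (by linarith))

lemma nSgn_neg (x : ℝ) : nSgn p (-x) = - nSgn p x := by unfold nSgn; rw [abs_neg]; ring

lemma nSgn_of_nonneg (hp : 1 < p) {x : ℝ} (hx : 0 ≤ x) : nSgn p x = x ^ p := by
  unfold nSgn
  rw [abs_of_nonneg hx]
  rcases hx.lt_or_eq with h | h
  · rw [Real.rpow_sub_one h.ne']; field_simp
  · rw [← h]; simp [Real.zero_rpow (show p ≠ 0 by linarith)]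

lemma gt_continuous (hp : 1 < p) : Continuous (gt p) := by
  unfold gt
  exact continuous_id.sub (((nSgn_continuous hp).comp (by fun_prop)).div_const p)

lemma gt_odd (s : ℝ) : gt p (-s) = - gt p s := by
  unfold gt
  have : max (-1) (min (-s) 1) = - max (-1) (min s 1) := by
    rw [← min_neg_neg, ← max_neg_neg, neg_neg]
    rcases le_total s 1 with h | h <;> rcases le_total s (-1) with h' | h' <;>
      simp only [max_def, min_def] <;> split_ifs <;> linarith
  rw [this, nSgn_neg]; ring

lemma gt_eq {s : ℝ} (h1 : -1 ≤ s) (h2 : s ≤ 1) : gt p s = s - nSgn p s / p := by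
  unfold gt; rw [min_eq_left h2, max_eq_right h1]

lemma gt_eq' (hp : 1 < p) {s : ℝ} (h1 : 0 ≤ s) (h2 : s ≤ 1) : gt p s = s - s ^ p / p := by
  rw [gt_eq (by linarith) h2, nSgn_of_nonneg hp h1]

lemma gt_hasDeriv (hp : 1 < p) {s : ℝ} (hs : 0 < s) :
    HasDerivAt (fun s : ℝ => s - s ^ p / p) (1 - s ^ (p - 1)) s := by
  have := (hasDerivAt_id s).sub ((Real.hasDerivAt_rpow_const (p := p) (Or.inl hs.ne')).div_const p)
  refine this.congr_deriv ?_
  field_simp [show p ≠ 0 by linarith]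

lemma rpow_p_cont (hp : 1 < p) : Continuous (fun s : ℝ => s - s ^ p / p) :=
  continuous_id.sub ((continuous_id.rpow_const fun _ => Or.inr (by linarith)).div_const p)

lemma g0_strictMono (hp : 1 < p) : StrictMonoOn (fun s : ℝ => s - s ^ p / p) (Icc 0 1) := by
  apply strictMonoOn_of_deriv_pos (convex_Icc _ _) (rpow_p_cont hp).continuousOn
  intro s hs
  rw [interior_Icc] at hs
  rw [(gt_hasDeriv hp hs.1).deriv]
  have := Real.rpow_lt_one hs.1.le hs.2 (show 0 < p - 1 by linarith)
  linarith

lemma gt_strictMono (hp : 1 < p) : StrictMono (gt p) := by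
  apply strictMono_of_odd_strictMonoOn_nonneg gt_odd
  intro a ha b hb hab
  have ha : 0 ≤ a := ha
  have hb : 0 ≤ b := hb
  have e : ∀ s : ℝ, 0 ≤ s → gt p s = (s - min s 1) + (min s 1 - (min s 1) ^ p / p) := by
    intro s hs
    have hm : 0 ≤ min s 1 := le_min hs zero_le_one
    unfold gt
    rw [max_eq_right (by linarith), nSgn_of_nonneg hp hm]; ring
  rw [e a ha, e b hb]
  rcases le_total b 1 with h | h
  · rw [min_eq_left h, min_eq_left (hab.le.trans h)]
    have := g0_strictMono hp ⟨ha, hab.le.trans h⟩ ⟨hb, h⟩ hab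
    simp only at this
    linarith
  · rw [min_eq_right h]
    rcases le_total a 1 with h2 | h2
    · rw [min_eq_left h2]
      rcases h2.lt_or_eq with h3 | h3
      · have := g0_strictMono hp ⟨ha, h2⟩ ⟨zero_le_one, le_rfl⟩ h3
        simp only at this
        linarith
      · subst h3; linarith
    · rw [min_eq_right h2]; linarith

lemma gt_surj (hp : 1 < p) : Function.Surjective (gt p) := by
  have hb : ∀ s, |nSgn p (max (-1) (min s 1)) / p| ≤ 1 := by
    intro s
    set r := max (-1) (min s 1)
    have h1 : |r| ≤ 1 := abs_le.2 ⟨le_max_left _ _, max_le (by norm_num) (min_le_right _ _)⟩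
    rw [abs_div, abs_of_pos (show 0 < p by linarith), div_le_one (by linarith)]
    unfold nSgn
    rw [abs_mul, abs_of_nonneg (show 0 ≤ |r| ^ (p-1) by positivity)]
    have := Real.rpow_le_one (abs_nonneg r) h1 (show 0 ≤ p - 1 by linarith)
    nlinarith [abs_nonneg r, show 0 ≤ |r| ^ (p-1) by positivity]
  apply (gt_continuous hp).surjective
  · apply tendsto_atTop_mono (f := fun s => s - 1)
    · intro s; unfold gt; linarith [(abs_le.1 (hb s)).2]
    · exact tendsto_atTop_add_const_right _ _ tendsto_id
  · have h1 : Tendsto (fun s : ℝ => s + 1) atBot atBot := tendsto_atBot_add_const_right _ _ tendsto_id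
    refine tendsto_atBot_mono ?_ h1
    intro s; unfold gt; linarith [(abs_le.1 (hb s)).1]

open Classical in
/-- inverse of `gt` -/
noncomputable def Gi (p : ℝ) (v : ℝ) : ℝ :=
  if hp : 1 < p then ((gt_strictMono hp).orderIsoOfSurjective (gt p) (gt_surj hp)).symm v else v

lemma Gi_eq (hp : 1 < p) : Gi p = ((gt_strictMono hp).orderIsoOfSurjective (gt p) (gt_surj hp)).symm := by
  ext v; unfold Gi; rw [dif_pos hp]

lemma Gi_continuous (hp : 1 < p) : Continuous (Gi p) := by
  rw [Gi_eq hp]; exact OrderIso.continuous _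

lemma Gi_strictMono (hp : 1 < p) : StrictMono (Gi p) := by
  rw [Gi_eq hp]; exact OrderIso.strictMono _

lemma gt_Gi (hp : 1 < p) (v : ℝ) : gt p (Gi p v) = v := by
  rw [Gi_eq hp]
  exact ((gt_strictMono hp).orderIsoOfSurjective (gt p) (gt_surj hp)).apply_symm_apply v

lemma Gi_gt (hp : 1 < p) (s : ℝ) : Gi p (gt p s) = s := by
  rw [Gi_eq hp]
  exact ((gt_strictMono hp).orderIsoOfSurjective (gt p) (gt_surj hp)).symm_apply_apply s

lemma Gi_odd (hp : 1 < p) (v : ℝ) : Gi p (-v) = - Gi p v := by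
  apply (gt_strictMono hp).injective
  rw [gt_Gi hp, gt_odd, gt_Gi hp]

lemma gt_one (hp : 1 < p) : gt p 1 = 1 - 1 / p := by
  rw [gt_eq' hp zero_le_one le_rfl, Real.one_rpow]

lemma gt_one_pos (hp : 1 < p) : 0 < gt p 1 := by
  rw [gt_one hp, sub_pos, div_lt_one (by linarith)]; exact hp

lemma gt_one_lt (hp : 1 < p) : gt p 1 < 1 := by
  rw [gt_one hp]; have : 0 < 1 / p := by have : 0 < p := by linarith
                                         positivity
  linarith

lemma Gi_ge (hp : 1 < p) {v : ℝ} (h0 : 0 ≤ v) (h1 : v ≤ 1) : v ≤ Gi p v := by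
  rw [← (gt_strictMono hp).le_iff_le, gt_Gi hp, gt_eq' hp h0 h1]
  have : 0 ≤ v ^ p / p := by have : 0 < p := by linarith
                             positivity
  linarith

/-- comparison of derivative -/
lemma one_sub_rpow_bounds {q : ℝ} (hq : 0 < q) :
    ∃ a > 0, ∃ b > 0, ∀ r : ℝ, 0 < r → r < 1 → a * (1 - r) ≤ 1 - r ^ q ∧ 1 - r ^ q ≤ b * (1 - r) := by
  rcases le_total 1 q with h | h
  · refine ⟨1, one_pos, q, hq, ?_⟩
    intro r h0 h1
    have e1 : r ^ q ≤ r := by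
      calc r ^ q ≤ r ^ (1:ℝ) := Real.rpow_le_rpow_of_exponent_ge h0 h1.le h
        _ = r := Real.rpow_one r
    have e2 := one_add_mul_self_le_rpow_one_add (s := r - 1) (by linarith) h
    rw [add_sub_cancel] at e2
    constructor <;> linarith
  · refine ⟨q, hq, 1, one_pos, ?_⟩
    intro r h0 h1
    have e1 : r ≤ r ^ q := by
      calc r = r ^ (1:ℝ) := (Real.rpow_one r).symm
        _ ≤ r ^ q := Real.rpow_le_rpow_of_exponent_ge h0 h1.le h
    have e2 := rpow_one_add_le_one_add_mul_self (s := r - 1) (by linarith) hq.le h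
    rw [add_sub_cancel] at e2
    constructor <;> linarith

lemma gt_compare (hp : 1 < p) :
    ∃ a > 0, ∃ b > 0, ∀ t s : ℝ, 0 ≤ t → t ≤ s → s ≤ 1 →
      a * ((s - t) * (1 - t)) ≤ gt p s - gt p t ∧ gt p s - gt p t ≤ b * ((s - t) * (1 - t)) := by
  obtain ⟨a, ha, b, hb, hab⟩ := one_sub_rpow_bounds (show 0 < p - 1 by linarith)
  refine ⟨a/2, by positivity, b, hb, ?_⟩
  have hd : ∀ c : ℝ, ∀ s : ℝ, 0 < s → HasDerivAt (fun s : ℝ => (s - s ^ p / p) - c * (s - s^2/2)) ((1 - s ^ (p - 1)) - c * (1 - s)) s := by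
    intro c s hs
    refine (gt_hasDeriv hp hs).sub (HasDerivAt.const_mul c ?_)
    have := (hasDerivAt_id s).sub (((hasDerivAt_id s).pow 2).div_const 2)
    refine this.congr_deriv ?_
    simp
  have hcont : ∀ c : ℝ, Continuous (fun s : ℝ => (s - s ^ p / p) - c * (s - s^2/2)) := fun c =>
    (rpow_p_cont hp).sub (by fun_prop)
  have m1 : MonotoneOn (fun s : ℝ => (s - s ^ p / p) - a * (s - s^2/2)) (Icc 0 1) := by
    apply monotoneOn_of_deriv_nonneg (convex_Icc _ _) (hcont a).continuousOn
    · intro s hs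
      rw [interior_Icc] at hs
      exact (hd a s hs.1).differentiableAt.differentiableWithinAt
    · intro s hs
      rw [interior_Icc] at hs
      rw [(hd a s hs.1).deriv]
      linarith [(hab s hs.1 hs.2).1]
  have m2 : AntitoneOn (fun s : ℝ => (s - s ^ p / p) - b * (s - s^2/2)) (Icc 0 1) := by
    apply antitoneOn_of_deriv_nonpos (convex_Icc _ _) (hcont b).continuousOn
    · intro s hs
      rw [interior_Icc] at hs
      exact (hd b s hs.1).differentiableAt.differentiableWithinAt
    · intro s hs
      rw [interior_Icc] at hs
      rw [(hd b s hs.1).deriv]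
      linarith [(hab s hs.1 hs.2).2]
  intro t s ht hts hs
  rw [gt_eq' hp ht (hts.trans hs), gt_eq' hp (ht.trans hts) hs]
  have k1 := m1 ⟨ht, hts.trans hs⟩ ⟨ht.trans hts, hs⟩ hts
  have k2 := m2 ⟨ht, hts.trans hs⟩ ⟨ht.trans hts, hs⟩ hts
  simp only at k1 k2
  have p1 : 0 ≤ (s - t) * (1 - s) := mul_nonneg (by linarith) (by linarith)
  have p2 : 0 ≤ (s - t) * (s - t) := mul_nonneg (by linarith) (by linarith)
  constructor
  · nlinarith [mul_nonneg ha.le p1]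
  · nlinarith [mul_nonneg hb.le p2]

/-- smoothness of the inverse -/
lemma Gi_contDiffAt (hp : 1 < p) {s : ℝ} (hs0 : s ≠ 0) (hs : |s| < 1) :
    ContDiffAt ℝ (⊤ : ℕ∞) (Gi p) (gt p s) := by
  have key : ∀ s : ℝ, 0 < s → s < 1 → ContDiffAt ℝ (⊤ : ℕ∞) (Gi p) (gt p s) := by
    intro s hs0 hs1
    have hev : gt p =ᶠ[𝓝 s] fun s : ℝ => s - s ^ p / p := by
      filter_upwards [Ioo_mem_nhds hs0 hs1] with r hr
      exact gt_eq' hp hr.1.le hr.2.le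
    have hcd : ContDiffAt ℝ (⊤ : ℕ∞) (gt p) s := by
      refine ContDiffAt.congr_of_eventuallyEq ?_ hev
      exact contDiffAt_id.sub ((Real.contDiffAt_rpow_const_of_ne hs0.ne').div_const p)
    have hder : HasDerivAt (gt p) (1 - s ^ (p - 1)) s := (gt_hasDeriv hp hs0).congr_of_eventuallyEq hev
    have hne : 1 - s ^ (p - 1) ≠ 0 := by
      have := Real.rpow_lt_one hs0.le hs1 (show 0 < p - 1 by linarith)
      linarith
    let e := ((gt_strictMono hp).orderIsoOfSurjective (gt p) (gt_surj hp)).toHomeomorph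
    have h3 : ContDiffAt ℝ (⊤ : ℕ∞) (e.toOpenPartialHomeomorph.symm) (gt p s) := by
      have hsymm : e.toOpenPartialHomeomorph.symm (gt p s) = s :=
        ((gt_strictMono hp).orderIsoOfSurjective (gt p) (gt_surj hp)).symm_apply_apply s
      apply OpenPartialHomeomorph.contDiffAt_symm_deriv (f₀' := 1 - s ^ (p-1)) _ hne (by simp)
      · rw [hsymm]; exact hder
      · rw [hsymm]; exact hcd
    rw [Gi_eq hp]
    exact h3
  rcases lt_or_gt_of_ne hs0 with h | h
  · have h2 := key (-s) (by linarith) (by rw [abs_of_neg h] at hs; exact hs)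
    have e : Gi p = fun v => - Gi p (-v) := by ext v; rw [Gi_odd hp]; ring
    rw [e]
    apply ContDiffAt.neg
    have : ContDiffAt ℝ (⊤ : ℕ∞) (Gi p) (-(gt p s)) := by rw [← gt_odd]; exact h2
    exact ContDiffAt.comp (gt p s) this contDiffAt_id.neg
  · exact key s h (by rw [abs_of_pos h] at hs; exact hs)
end

section
variable {α p : ℝ}

/-- interval of cosines -/
abbrev CI := Icc (-1:ℝ) 1

/-- cosine as a point of `CI` -/
noncomputable def cosI (x : ℝ) : CI := ⟨Real.cos x, Real.neg_one_le_cos x, Real.cos_le_one x⟩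

lemma cosI_continuous : Continuous cosI := Real.continuous_cos.subtype_mk _

/-- even periodic function associated with `F` -/
noncomputable def psi (F : C(CI, ℝ)) (x : ℝ) : ℝ := F (cosI x)

lemma psi_continuous (F : C(CI, ℝ)) : Continuous (psi F) := F.continuous.comp cosI_continuous

lemma psi_bound (F : C(CI, ℝ)) (x : ℝ) : |psi F x| ≤ ‖F‖ := F.norm_coe_le_norm _

lemma conv_continuous (h0 : 0 < α) (h1 : α < 1) {ψ : ℝ → ℝ} (hψ : Continuous ψ) {M : ℝ}
    (hM : ∀ x, |ψ x| ≤ M) : Continuous (conv α ψ) := by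
  obtain ⟨C, hC, hH⟩ := conv_holder h0 h1
  rw [continuous_iff_continuousAt]
  intro x
  rw [ContinuousAt, tendsto_iff_norm_sub_tendsto_zero]
  have ht : Tendsto (fun y => C * M * |y - x| ^ α) (𝓝 x) (𝓝 0) := by
    have : Continuous (fun y => C * M * |y - x| ^ α) := by
      apply continuous_const.mul
      exact (by fun_prop : Continuous fun y => |y - x|).rpow_const fun _ => Or.inr h0.le
    have h2 := this.tendsto x
    simpa [Real.zero_rpow h0.ne'] using h2
  exact squeeze_zero (fun _ => norm_nonneg _) (fun y => hH ψ M hψ hM y x) ht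

lemma conv_diff_bound (h0 : 0 < α) (h1 : α < 1) {f g : ℝ → ℝ} (hf : Continuous f) (hg : Continuous g)
    (hfp : Function.Periodic f (2*π)) (hgp : Function.Periodic g (2*π))
    {M : ℝ} (hM : ∀ x, |f x - g x| ≤ M) (x : ℝ) :
    |conv α f x - conv α g x| ≤ (∫ z in (-π)..π, |Kker α z|) * M := by
  have hpi := Real.pi_pos
  have hI : ∀ h : ℝ → ℝ, Continuous h → IntervalIntegrable (fun z => Kker α z * h (x - z)) volume (-π) π := by
    intro h hh
    exact (Kker_intervalIntegrable h0 h1 _ _).mul_continuousOn (by fun_prop)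
  rw [conv_sub hfp, conv_sub hgp, ← intervalIntegral.integral_sub (hI f hf) (hI g hg), ← intervalIntegral.integral_mul_const]
  refine (intervalIntegral.abs_integral_le_integral_abs (by linarith)).trans ?_
  apply intervalIntegral.integral_mono_on (by linarith)
  · exact ((hI f hf).sub (hI g hg)).abs
  · exact (Kker_intervalIntegrable h0 h1 _ _).abs.mul_const _
  · intro z _
    rw [← mul_sub, abs_mul]
    exact mul_le_mul_of_nonneg_left (hM _) (abs_nonneg _)

lemma psi_periodic (F : C(CI, ℝ)) : Function.Periodic (psi F) (2*π) := by
  intro x; unfold psi; congr 1; apply Subtype.ext; exact Real.cos_add_two_pi x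

/-- `F ↦ conv (psi F)` in the cosine variable -/
noncomputable def UU (h0 : 0 < α) (h1 : α < 1) (F : C(CI, ℝ)) : C(CI, ℝ) :=
  ⟨fun t => conv α (psi F) (Real.arccos t),
    (conv_continuous h0 h1 (psi_continuous F) (psi_bound F)).comp
      (Real.continuous_arccos.comp continuous_subtype_val)⟩

lemma UU_continuous (h0 : 0 < α) (h1 : α < 1) : Continuous (UU h0 h1) := by
  have hL : 0 ≤ ∫ z in (-π)..π, |Kker α z| :=
    intervalIntegral.integral_nonneg (by linarith [Real.pi_pos]) fun _ _ => abs_nonneg _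
  have : LipschitzWith ⟨_, hL⟩ (UU h0 h1) := by
    apply LipschitzWith.of_dist_le_mul
    intro F G
    rw [ContinuousMap.dist_le (by positivity)]
    intro t
    rw [Real.dist_eq]
    apply conv_diff_bound h0 h1 (psi_continuous F) (psi_continuous G) (psi_periodic F) (psi_periodic G)
    intro x
    rw [← Real.dist_eq]
    exact ContinuousMap.dist_apply_le_dist _
  exact this.continuous

/-- invariant set -/
def SS (m : ℝ) : Set C(CI, ℝ) :=
  {F | (∀ s t : CI, s ≤ t → F s ≤ F t) ∧ (∀ s t : CI, (s:ℝ) = -t → F s = - F t) ∧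
    F (cosI 0) = 1 ∧ m ≤ ∫ y in (0:ℝ)..(π/4), psi F y}

lemma SS_csym {m : ℝ} {F : C(CI, ℝ)} (h : F ∈ SS m) : CSym (psi F) where
  cont := psi_continuous F
  mono := fun x y hxy => h.1 _ _ hxy
  anti := fun x => h.2.1 _ _ (by simp [cosI, Real.cos_add_pi])

lemma SS_zero {m : ℝ} {F : C(CI, ℝ)} (h : F ∈ SS m) : psi F 0 = 1 := h.2.2.1

lemma SS_convex (m : ℝ) : Convex ℝ (SS m) := by
  intro F hF G hG a b ha hb hab
  refine ⟨?_, ?_, ?_, ?_⟩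
  · intro s t hst
    simp only [ContinuousMap.add_apply, ContinuousMap.smul_apply, smul_eq_mul]
    have := hF.1 s t hst
    have := hG.1 s t hst
    gcongr
  · intro s t hst
    simp only [ContinuousMap.add_apply, ContinuousMap.smul_apply, smul_eq_mul, hF.2.1 s t hst, hG.2.1 s t hst]
    ring
  · simp only [ContinuousMap.add_apply, ContinuousMap.smul_apply, smul_eq_mul, hF.2.2.1, hG.2.2.1]
    linarith
  · have e : ∀ y, psi (a • F + b • G) y = a * psi F y + b * psi G y := fun y => rfl
    simp only [e]
    rw [intervalIntegral.integral_add (((psi_continuous F).const_mul a).intervalIntegrable _ _)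
      (((psi_continuous G).const_mul b).intervalIntegrable _ _), intervalIntegral.integral_const_mul,
      intervalIntegral.integral_const_mul]
    have k1 := mul_le_mul_of_nonneg_left hF.2.2.2 ha
    have k2 := mul_le_mul_of_nonneg_left hG.2.2.2 hb
    have k3 : m = a * m + b * m := by rw [← add_mul, hab, one_mul]
    rw [k3]; exact add_le_add k1 k2

lemma mass_continuous : Continuous (fun F : C(CI, ℝ) => ∫ y in (0:ℝ)..(π/4), psi F y) := by
  have : LipschitzWith ⟨|π/4 - 0|, abs_nonneg _⟩ (fun F : C(CI, ℝ) => ∫ y in (0:ℝ)..(π/4), psi F y) := by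
    apply LipschitzWith.of_dist_le_mul
    intro F G
    rw [Real.dist_eq, ← intervalIntegral.integral_sub ((psi_continuous F).intervalIntegrable _ _)
      ((psi_continuous G).intervalIntegrable _ _), ← Real.norm_eq_abs, mul_comm]
    apply intervalIntegral.norm_integral_le_of_norm_le_const
    intro y _
    rw [Real.norm_eq_abs, ← Real.dist_eq]
    exact ContinuousMap.dist_apply_le_dist _
  exact this.continuous

lemma SS_closed (m : ℝ) : IsClosed (SS m) := by
  have ev : ∀ t : CI, Continuous (fun F : C(CI, ℝ) => F t) := fun t => continuous_eval_const t
  have e : SS m = {F | ∀ s t : CI, s ≤ t → F s ≤ F t} ∩ ({F | ∀ s t : CI, (s:ℝ) = -t → F s = - F t} ∩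
    ({F | F (cosI 0) = 1} ∩ {F | m ≤ ∫ y in (0:ℝ)..(π/4), psi F y})) := rfl
  rw [e]
  refine IsClosed.inter ?_ (IsClosed.inter ?_ (IsClosed.inter ?_ ?_))
  · simp only [ofPred_forall]
    exact isClosed_iInter fun s => isClosed_iInter fun t => isClosed_iInter fun _ => isClosed_le (ev s) (ev t)
  · simp only [ofPred_forall]
    exact isClosed_iInter fun s => isClosed_iInter fun t => isClosed_iInter fun _ => isClosed_eq (ev s) (ev t).neg
  · exact isClosed_eq (ev _) continuous_const
  · exact isClosed_le continuous_const mass_continuous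

lemma SS_nonempty {m : ℝ} (hm : m ≤ ∫ y in (0:ℝ)..(π/4), Real.cos y) : (SS m).Nonempty := by
  refine ⟨⟨fun t => (t:ℝ), continuous_subtype_val⟩, fun s t h => h, fun s t h => h, ?_, ?_⟩
  · simp [cosI]
  · exact hm

/-- the compact set before applying `Gi` -/
lemma compact_holder (h0 : 0 < α) (A B : ℝ) : IsCompact {v : C(CI, ℝ) | (∀ t, |v t| ≤ A) ∧
    ∀ s t : CI, |v s - v t| ≤ B * |Real.arccos s - Real.arccos t| ^ α} := by
  have hb : ∀ s : CI, Tendsto (fun t : CI => B * |Real.arccos s - Real.arccos t| ^ α) (𝓝 s) (𝓝 0) := by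
    intro s
    have : Continuous (fun t : CI => B * |Real.arccos s - Real.arccos t| ^ α) := by
      apply continuous_const.mul
      refine Continuous.rpow_const ?_ fun _ => Or.inr h0.le
      have := Real.continuous_arccos.comp (continuous_subtype_val (p := fun x => x ∈ Icc (-1:ℝ) 1))
      exact (continuous_const.sub this).abs
    have h2 := this.tendsto s
    simpa [Real.zero_rpow h0.ne'] using h2
  apply ArzelaAscoli.isCompact_of_equicontinuous
  · have : ContinuousMap.toFun '' {v : C(CI, ℝ) | (∀ t, |v t| ≤ A) ∧
        ∀ s t : CI, |v s - v t| ≤ B * |Real.arccos s - Real.arccos t| ^ α} =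
        (Set.pi univ fun _ => Icc (-A) A) ∩ {v : CI → ℝ | ∀ s t : CI, |v s - v t| ≤ B * |Real.arccos s - Real.arccos t| ^ α} := by
      ext v
      constructor
      · rintro ⟨f, hf, rfl⟩
        exact ⟨fun t _ => abs_le.1 (hf.1 t), hf.2⟩
      · rintro ⟨h3, h4⟩
        have hc : Continuous v := by
          rw [continuous_iff_continuousAt]
          intro s
          rw [ContinuousAt, tendsto_iff_norm_sub_tendsto_zero]
          refine squeeze_zero (fun _ => norm_nonneg _) (fun t => ?_) (hb s)
          rw [norm_sub_rev]
          exact h4 s t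
        exact ⟨⟨v, hc⟩, ⟨fun t => abs_le.2 (h3 t trivial), h4⟩, rfl⟩
    rw [this]
    apply IsCompact.inter_right
    · exact isCompact_univ_pi fun _ => isCompact_Icc
    · simp only [ofPred_forall]
      exact isClosed_iInter fun s => isClosed_iInter fun t =>
        isClosed_le ((continuous_apply s).sub (continuous_apply t)).abs continuous_const
  · intro s
    apply Metric.equicontinuousAt_of_continuity_modulus _ (hb s)
    filter_upwards with t
    intro v
    rw [Real.dist_eq]
    exact v.2.2 s t

theorem exists_profile (h0 : 0 < α) (h1 : α < 1) (hp : 1 < p) :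
    ∃ ψ : ℝ → ℝ, CSym ψ ∧ ψ 0 = 1 ∧ ∃ c > 0, ∀ x, conv α ψ x = c * gt p (ψ x) := by
  have hpi := Real.pi_pos
  obtain ⟨κ, hκ, hlow⟩ := mass_lower h0 h1
  obtain ⟨C, hC, hup⟩ := u0_upper h0 h1
  obtain ⟨D, hD, hH⟩ := conv_holder h0 h1
  have hg := gt_one_pos hp
  set g1 := gt p 1 with hg1
  set q := π/4 * (g1 * κ / C) with hq
  have hq0 : 0 < q := by positivity
  have hcos0 : 0 < ∫ y in (0:ℝ)..(π/4), Real.cos y := by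
    rw [integral_cos, Real.sin_zero, sub_zero]
    exact Real.sin_pos_of_pos_of_lt_pi (by linarith) (by linarith)
  set m := min (∫ y in (0:ℝ)..(π/4), Real.cos y) (q ^ (1/α)) with hm
  have hm0 : 0 < m := lt_min hcos0 (by positivity)
  have hmq : m ^ α ≤ q := by
    calc m ^ α ≤ (q ^ (1/α)) ^ α := Real.rpow_le_rpow hm0.le (min_le_right _ _) h0.le
      _ = q := by rw [← Real.rpow_mul hq0.le, one_div_mul_cancel h0.ne', Real.rpow_one]
  -- basic positivity
  have hmass : ∀ F ∈ SS m, m ≤ ∫ y in (0:ℝ)..(π/4), psi F y := fun F hF => hF.2.2.2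
  have hu0 : ∀ F ∈ SS m, κ * m ≤ conv α (psi F) 0 := by
    intro F hF
    have hs := SS_csym hF
    calc κ * m ≤ κ * ∫ y in (0:ℝ)..(π/4), psi F y := mul_le_mul_of_nonneg_left (hmass F hF) hκ.le
      _ ≤ conv α (psi F) (π/4) := hlow _ hs
      _ ≤ conv α (psi F) 0 := conv_antitone h0 h1 hs le_rfl (by linarith) (by linarith)
  have hκm : 0 < κ * m := by positivity
  -- the map
  let V : C(CI, ℝ) → C(CI, ℝ) := fun F => (g1 / conv α (psi F) 0) • UU h0 h1 F
  let Gm : C(ℝ, ℝ) := ⟨Gi p, Gi_continuous hp⟩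
  let T : C(CI, ℝ) → C(CI, ℝ) := fun F => Gm.comp (V F)
  have hVt : ∀ F (t : CI), V F t = g1 / conv α (psi F) 0 * conv α (psi F) (Real.arccos t) := fun F t => rfl
  have hTt : ∀ F (t : CI), T F t = Gi p (g1 / conv α (psi F) 0 * conv α (psi F) (Real.arccos t)) := fun F t => rfl
  have hTpsi : ∀ F ∈ SS m, ∀ x, psi (T F) x = Gi p (g1 / conv α (psi F) 0 * conv α (psi F) x) := by
    intro F hF x
    unfold psi
    rw [hTt]
    congr 2
    apply conv_congr (SS_csym hF)
    exact Real.cos_arccos (Real.neg_one_le_cos x) (Real.cos_le_one x)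
  have hVcont : ContinuousOn V (SS m) := by
    refine ContinuousOn.smul (f := fun F => g1 / conv α (psi F) 0) (g := UU h0 h1) ?_ (UU_continuous h0 h1).continuousOn
    apply ContinuousOn.div continuousOn_const
    · have : Continuous (fun F => UU h0 h1 F (cosI 0)) := (continuous_eval_const (cosI 0)).comp (UU_continuous h0 h1)
      have e : (fun F => UU h0 h1 F (cosI 0)) = fun F => conv α (psi F) 0 := by
        ext F
        change conv α (psi F) (Real.arccos (Real.cos 0)) = _
        simp
      rw [← e]; exact this.continuousOn
    · intro F hF
      exact (hκm.trans_le (hu0 F hF)).ne'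
  have hTcont : ContinuousOn T (SS m) := (ContinuousMap.continuous_postcomp Gm).comp_continuousOn hVcont
  have hTS : MapsTo T (SS m) (SS m) := by
    intro F hF
    have hs := SS_csym hF
    have hpos := hκm.trans_le (hu0 F hF)
    have hr : 0 < g1 / conv α (psi F) 0 := by positivity
    refine ⟨?_, ?_, ?_, ?_⟩
    · intro s t hst
      rw [hTt, hTt]
      apply (Gi_strictMono hp).monotone
      apply mul_le_mul_of_nonneg_left _ hr.le
      apply conv_mono h0 h1 hs
      rw [Real.cos_arccos s.2.1 s.2.2, Real.cos_arccos t.2.1 t.2.2]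
      exact hst
    · intro s t hst
      rw [hTt, hTt, ← Gi_odd hp, ← mul_neg, ← conv_anti hs]
      congr 2
      apply conv_congr hs
      rw [Real.cos_add_pi, Real.cos_arccos s.2.1 s.2.2, Real.cos_arccos t.2.1 t.2.2, hst]
    · have := hTpsi F hF 0
      change psi (T F) 0 = 1
      rw [this, div_mul_cancel₀ _ hpos.ne', hg1, Gi_gt hp]
    · set M := ∫ y in (0:ℝ)..(π/4), psi F y with hM
      have hMm : m ≤ M := hmass F hF
      have hM0 : 0 < M := hm0.trans_le hMm
      have hupF := hup _ hs (SS_zero hF) hM0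
      have hlowF := hlow _ hs
      rw [← hM] at hupF hlowF
      have hMα : 0 < M ^ α := by positivity
      have k1 : g1 * κ / C * M ^ (1 - α) ≤ g1 / conv α (psi F) 0 * (κ * M) := by
        rw [Real.rpow_sub hM0, Real.rpow_one]
        rw [show g1 * κ / C * (M / M ^ α) = g1 / (C * M ^ α) * (κ * M) by field_simp]
        gcongr
      have k2 : ∀ y ∈ Icc 0 (π/4), g1 * κ / C * M ^ (1 - α) ≤ psi (T F) y := by
        intro y hy
        rw [hTpsi F hF]
        have h3 : κ * M ≤ conv α (psi F) y := hlowF.trans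
          (conv_antitone h0 h1 hs hy.1 hy.2 (by linarith))
        have h4 : conv α (psi F) y ≤ conv α (psi F) 0 := conv_antitone h0 h1 hs le_rfl hy.1 (by linarith [hy.2])
        have h5 : 0 ≤ conv α (psi F) y := (by positivity : 0 ≤ κ * M).trans h3
        calc g1 * κ / C * M ^ (1 - α) ≤ g1 / conv α (psi F) 0 * (κ * M) := k1
          _ ≤ g1 / conv α (psi F) 0 * conv α (psi F) y := mul_le_mul_of_nonneg_left h3 hr.le
          _ ≤ _ := by
            apply Gi_ge hp (by positivity)
            calc g1 / conv α (psi F) 0 * conv α (psi F) y ≤ g1 / conv α (psi F) 0 * conv α (psi F) 0 := mul_le_mul_of_nonneg_left h4 hr.le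
              _ = g1 := div_mul_cancel₀ _ hpos.ne'
              _ ≤ 1 := (gt_one_lt hp).le
      have k3 : m ≤ q * M ^ (1 - α) := by
        calc m = m ^ α * m ^ (1 - α) := by rw [← Real.rpow_add hm0]; simp
          _ ≤ q * M ^ (1 - α) := by
            apply mul_le_mul hmq _ (by positivity) hq0.le
            exact Real.rpow_le_rpow hm0.le hMm (by linarith)
      calc m ≤ q * M ^ (1 - α) := k3
        _ = ∫ y in (0:ℝ)..(π/4), g1 * κ / C * M ^ (1 - α) := by
          rw [intervalIntegral.integral_const, smul_eq_mul, hq]; ring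
        _ ≤ _ := by
          apply intervalIntegral.integral_mono_on (by linarith) intervalIntegrable_const
            ((psi_continuous _).intervalIntegrable _ _) k2
  have hcomp := (compact_holder h0 g1 (g1 / (κ * m) * (D * 1))).image (ContinuousMap.continuous_postcomp Gm)
  have hTC : MapsTo T (SS m) (Gm.comp '' {v : C(CI, ℝ) | (∀ t, |v t| ≤ g1) ∧
      ∀ s t : CI, |v s - v t| ≤ (g1 / (κ * m) * (D * 1)) * |Real.arccos s - Real.arccos t| ^ α}) := by
    intro F hF
    refine ⟨V F, ⟨?_, ?_⟩, rfl⟩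
    · intro t
      have hs := SS_csym hF
      have hpos := hκm.trans_le (hu0 F hF)
      rw [hVt, abs_mul, abs_of_pos (by positivity : 0 < g1 / conv α (psi F) 0)]
      have : |conv α (psi F) (Real.arccos t)| ≤ conv α (psi F) 0 := by
        rw [abs_le]
        have h3 := conv_mono h0 h1 hs (Real.arccos t) 0 (by simp [Real.cos_le_one])
        have h4 := conv_mono h0 h1 hs (0 + π) (Real.arccos t) (by simp [Real.neg_one_le_cos])
        rw [conv_anti hs] at h4
        exact ⟨h4, h3⟩
      calc _ ≤ g1 / conv α (psi F) 0 * conv α (psi F) 0 := mul_le_mul_of_nonneg_left this (by positivity)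
        _ = g1 := div_mul_cancel₀ _ hpos.ne'
    · intro s t
      have hs := SS_csym hF
      have hu := hu0 F hF
      have hpos := hκm.trans_le hu
      rw [hVt, hVt, ← mul_sub, abs_mul, abs_of_pos (by positivity : 0 < g1 / conv α (psi F) 0), mul_assoc]
      have := hH (psi F) 1 (psi_continuous F) (fun x => (hs.abs_le x).trans (SS_zero hF).le) (Real.arccos s) (Real.arccos t)
      gcongr
  obtain ⟨F, hF, hfix⟩ := schauder_fixed_point (SS m) _ (SS_nonempty (min_le_left _ _)) (SS_convex m) (SS_closed m)
    hcomp T hTcont hTS hTC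
  have hpos := hκm.trans_le (hu0 F hF)
  refine ⟨psi F, SS_csym hF, SS_zero hF, conv α (psi F) 0 / g1, by positivity, ?_⟩
  intro x
  have := hTpsi F hF x
  rw [hfix] at this
  rw [this, gt_Gi hp]
  field_simp
end

section
variable {α : ℝ}

lemma Ksub_intervalIntegrable (h0 : 0 < α) (h1 : α < 1) (x a b : ℝ) :
    IntervalIntegrable (fun z => Kker α (x - z)) volume a b := by
  have := (Kker_intervalIntegrable h0 h1 (x - a) (x - b)).comp_sub_left x
  simpa using this

lemma K_L1_shift (h0 : 0 < α) (h1 : α < 1) :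
    ∃ C > 0, ∀ x y : ℝ, ∫ z in (-π)..π, |Kker α (x - z) - Kker α (y - z)| ≤ C * |x - y| ^ α := by
  obtain ⟨C, hC, hL⟩ := K_L1_modulus h0 h1
  refine ⟨C, hC, ?_⟩
  intro x y
  refine le_trans (le_of_eq ?_) (hL (x - y))
  have e1 := intervalIntegral.integral_comp_sub_left (a := -π) (b := π) (fun z => |Kker α (z + (x - y)) - Kker α z|) y
  have e2 : ∀ z, |Kker α (y - z + (x - y)) - Kker α (y - z)| = |Kker α (x - z) - Kker α (y - z)| := by
    intro z; congr 3; ring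
  simp only [e2] at e1
  rw [e1]
  have hper : Function.Periodic (fun z => |Kker α (z + (x - y)) - Kker α z|) (2 * π) := fun z => by
    simp only [(Kker_periodic α) z]
    rw [show z + 2 * π + (x - y) = z + (x - y) + 2 * π by ring, (Kker_periodic α)]
  have := hper.intervalIntegral_add_eq (y - π) (-π)
  rw [show y - π + 2 * π = y - -π by ring, show -π + 2 * π = π by ring] at this
  exact this

lemma conv_w (h0 : 0 < α) (h1 : α < 1) {ψ : ℝ → ℝ} (hψ : Continuous ψ) (x y : ℝ) :
    conv α ψ x - conv α ψ y = ∫ z in (-π)..π, (Kker α (y - z) - Kker α (x - z)) * (1 - ψ z) := by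
  have hp : Function.Periodic (fun _ : ℝ => (1:ℝ)) (2 * π) := fun _ => rfl
  have e : conv α (fun _ => 1) x = conv α (fun _ => 1) y := by
    rw [conv_sub hp, conv_sub hp]
  have k : ∀ x, ∫ z in (-π)..π, Kker α (x - z) * (1 - ψ z) = conv α (fun _ => 1) x - conv α ψ x := by
    intro x
    unfold conv
    rw [← intervalIntegral.integral_sub (KK_intervalIntegrable h0 h1 continuous_const x _ _)
      (KK_intervalIntegrable h0 h1 hψ x _ _)]
    congr 1; ext z; ring
  have hc : Continuous fun z => 1 - ψ z := continuous_const.sub hψ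
  simp only [sub_mul (Kker α _)]
  rw [intervalIntegral.integral_sub (KK_intervalIntegrable h0 h1 hc y _ _)
      (KK_intervalIntegrable h0 h1 hc x _ _), k, k, e]
  ring

lemma lemmaE (h0 : 0 < α) (h1 : α < 1) :
    ∃ C > 0, ∀ ψ : ℝ → ℝ, CSym ψ → ψ 0 = 1 → ∀ A β : ℝ, 0 ≤ A → 0 ≤ β → β ≤ α →
      (∀ z, 0 ≤ z → z ≤ π → 1 - ψ z ≤ A * z ^ β) →
      ∀ x y, 0 ≤ x → x < y → y ≤ π/2 → conv α ψ x - conv α ψ y ≤ C * (A * (y ^ β * (y - x) ^ α)) := by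
  obtain ⟨C1, hC1, hL⟩ := K_L1_shift h0 h1
  obtain ⟨C2, hC2, hS⟩ := K_sym_bound h0 h1
  have hpi := Real.pi_pos
  refine ⟨2 * C1 + C2 / (2 - 2 * α), by have : 0 < 2 - 2 * α := by linarith
                                        positivity, ?_⟩
  intro ψ hψ hψ0 A β hA hβ hβα hw x y hx hxy hy
  have hy0 : 0 < y := by linarith
  have hc : Continuous fun z => 1 - ψ z := continuous_const.sub hψ.cont
  have hw0 : ∀ z, 0 ≤ 1 - ψ z := fun z => by linarith [hψ.le_zero z]
  have hi : ∀ a b, IntervalIntegrable (fun z => (Kker α (y - z) - Kker α (x - z)) * (1 - ψ z)) volume a b :=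
    fun a b => KKK_intervalIntegrable h0 h1 hc y x a b
  have hi' : ∀ a b, IntervalIntegrable (fun z => (Kker α (y + z) - Kker α (x + z)) * (1 - ψ z)) volume a b := by
    intro a b
    have := (hi (0-a) (0-b)).comp_sub_left 0
    simpa [hψ.even] using this
  rw [conv_w h0 h1 hψ.cont,
    ← intervalIntegral.integral_add_adjacent_intervals (hi (-π) (-(2*y))) (hi (-(2*y)) π),
    ← intervalIntegral.integral_add_adjacent_intervals (hi (-(2*y)) (2*y)) (hi (2*y) π)]
  have eneg : ∫ z in (-π)..(-(2*y)), (Kker α (y - z) - Kker α (x - z)) * (1 - ψ z) =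
      ∫ z in (2*y)..π, (Kker α (y + z) - Kker α (x + z)) * (1 - ψ z) := by
    have := intervalIntegral.integral_comp_neg (a := 2*y) (b := π) (fun z => (Kker α (y - z) - Kker α (x - z)) * (1 - ψ z))
    rw [← this]
    congr 1; ext z; rw [hψ.even]; simp
  rw [eneg]
  have near : ∫ z in (-(2*y))..(2*y), (Kker α (y - z) - Kker α (x - z)) * (1 - ψ z) ≤
      2 * C1 * (A * (y ^ β * (y - x) ^ α)) := by
    have hKi : ∀ a b, IntervalIntegrable (fun z => |Kker α (y - z) - Kker α (x - z)|) volume a b := fun a b =>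
      ((Ksub_intervalIntegrable h0 h1 y a b).sub (Ksub_intervalIntegrable h0 h1 x a b)).abs
    have h2β : (2*y)^β ≤ 2 * y ^ β := by
      rw [Real.mul_rpow (by norm_num) hy0.le]
      gcongr
      calc (2:ℝ)^β ≤ 2^(1:ℝ) := Real.rpow_le_rpow_of_exponent_le (by norm_num) (by linarith)
        _ = 2 := Real.rpow_one 2
    calc ∫ z in (-(2*y))..(2*y), (Kker α (y - z) - Kker α (x - z)) * (1 - ψ z)
        ≤ ∫ z in (-(2*y))..(2*y), |Kker α (y - z) - Kker α (x - z)| * (A * (2*y)^β) := by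
          apply intervalIntegral.integral_mono_on (by linarith) (hi _ _) ((hKi _ _).mul_const _)
          intro z hz
          have hz' : |z| ≤ 2*y := abs_le.2 hz
          apply mul_le_mul (le_abs_self _) _ (hw0 z) (abs_nonneg _)
          have e1 : ψ z = ψ |z| := hψ.congr (Real.cos_abs z).symm
          rw [e1]
          refine (hw _ (abs_nonneg z) (by linarith)).trans ?_
          gcongr
      _ = (∫ z in (-(2*y))..(2*y), |Kker α (y - z) - Kker α (x - z)|) * (A * (2*y)^β) := by
          rw [intervalIntegral.integral_mul_const]
      _ ≤ (∫ z in (-π)..π, |Kker α (y - z) - Kker α (x - z)|) * (A * (2*y)^β) := by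
          apply mul_le_mul_of_nonneg_right _ (by positivity)
          apply intervalIntegral.integral_mono_interval (by linarith) (by linarith) (by linarith) _ (hKi _ _)
          filter_upwards with z
          exact abs_nonneg _
      _ ≤ (C1 * |y - x|^α) * (A * (2 * y ^ β)) := by
          gcongr
          exact hL y x
      _ = _ := by rw [abs_of_pos (by linarith)]; ring
  have far : (∫ z in (2*y)..π, (Kker α (y + z) - Kker α (x + z)) * (1 - ψ z)) +
      ∫ z in (2*y)..π, (Kker α (y - z) - Kker α (x - z)) * (1 - ψ z) ≤ C2 / (2 - 2*α) * (A * (y ^ β * (y - x) ^ α)) := by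
    rw [← intervalIntegral.integral_add (hi' _ _) (hi _ _)]
    have hd : 0 < 2 - α - β := by linarith
    calc ∫ z in (2*y)..π, ((Kker α (y + z) - Kker α (x + z)) * (1 - ψ z) + (Kker α (y - z) - Kker α (x - z)) * (1 - ψ z))
        ≤ ∫ z in (2*y)..π, C2 * (y - x) * y * A * z ^ (α + β - 3) := by
          apply intervalIntegral.integral_mono_on (by linarith) ((hi' _ _).add (hi _ _))
            ((rpow_intervalIntegrable (by linarith) (by linarith)).const_mul _)
          intro z hz
          have hz0 : 0 < z := by linarith [hz.1]
          have e1 := hS x y z hx hxy.le hz.1 hz0 hz.2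
          rw [← add_mul]
          have e2 : Kker α (y + z) - Kker α (x + z) + (Kker α (y - z) - Kker α (x - z)) ≤ C2 * (y - x) * y * z ^ (α - 3) := by
            refine le_trans ?_ ((le_abs_self _).trans e1)
            rw [← Kker_even α (y - z), ← Kker_even α (x - z), show -(y - z) = z - y by ring, show -(x - z) = z - x by ring,
              add_comm y, add_comm x]
            linarith
          have hyx : 0 < y - x := by linarith
          calc _ ≤ (C2 * (y - x) * y * z ^ (α - 3)) * (A * z ^ β) :=
                mul_le_mul e2 (hw z hz0.le hz.2) (hw0 z) (by positivity)
            _ = _ := by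
              rw [show α + β - 3 = (α - 3) + β by ring, Real.rpow_add hz0]; ring
      _ = C2 * (y - x) * y * A * ∫ z in (2*y)..π, z ^ (α + β - 3) := intervalIntegral.integral_const_mul _ _
      _ ≤ C2 * (y - x) * y * A * ((2*y) ^ (α + β - 3 + 1) / (-(α + β - 3 + 1))) := by
          have hyx : 0 < y - x := by linarith
          gcongr
          exact integral_rpow_tail (by linarith) (by linarith) (by linarith)
      _ ≤ C2 * (y - x) * y * A * (y ^ (α + β - 2) / (2 - 2*α)) := by
          have hyx : 0 < y - x := by linarith
          rw [show -(α + β - 3 + 1) = 2 - α - β by ring, show α + β - 3 + 1 = α + β - 2 by ring]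
          have : (2*y) ^ (α + β - 2) ≤ y ^ (α + β - 2) :=
            Real.rpow_le_rpow_of_nonpos hy0 (by linarith) (by linarith)
          have h3 : 0 < 2 - 2 * α := by linarith
          apply mul_le_mul_of_nonneg_left _ (by positivity)
          exact div_le_div₀ (by positivity) this h3 (by linarith)
      _ = C2 / (2 - 2*α) * (A * (y ^ β * ((y - x) * y ^ (α - 1)))) := by
          rw [show α + β - 2 = β + (α - 1) + (-1) by ring, Real.rpow_add hy0, Real.rpow_add hy0, Real.rpow_neg_one]
          field_simp
      _ ≤ _ := by
          have h3 : 0 < 2 - 2 * α := by linarith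
          have hyx : 0 < y - x := by linarith
          have e3 : (y - x) * y ^ (α - 1) ≤ (y - x) ^ α := by
            calc (y - x) * y ^ (α - 1) ≤ (y - x) * (y - x) ^ (α - 1) := by
                  gcongr (y - x) * ?_
                  exact Real.rpow_le_rpow_of_nonpos hyx (by linarith) (by linarith)
              _ = (y - x) ^ α := by rw [Real.rpow_sub_one hyx.ne']; field_simp
          gcongr
  linarith
end


/-- normalised profile -/
structure Prof (α p c : ℝ) (ψ : ℝ → ℝ) : Prop where
  h0 : 0 < α
  h1 : α < 1
  hp : 1 < p
  hc : 0 < c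
  sym : CSym ψ
  one : ψ 0 = 1
  eq : ∀ x, conv α ψ x = c * gt p (ψ x)

namespace Prof
variable {α p c : ℝ} {ψ : ℝ → ℝ}

lemma w_nonneg (P : Prof α p c ψ) (x : ℝ) : 0 ≤ 1 - ψ x := by linarith [P.sym.le_zero x, P.one]

lemma strict (P : Prof α p c ψ) {x y : ℝ} (hx : 0 ≤ x) (hxy : x < y) (hy : y ≤ π) : ψ y < ψ x := by
  have := conv_strict P.h0 P.h1 P.sym (by rw [P.one]; exact one_pos) hx hxy hy
  rw [P.eq, P.eq] at this
  exact (gt_strictMono P.hp).lt_iff_lt.1 (lt_of_mul_lt_mul_left this P.hc.le)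

lemma nonneg_half (P : Prof α p c ψ) {x : ℝ} (hx : 0 ≤ x) (hx2 : x ≤ π/2) : 0 ≤ ψ x :=
  P.sym.nonneg (Real.cos_nonneg_of_mem_Icc ⟨by linarith [Real.pi_pos], hx2⟩)

lemma compare (P : Prof α p c ψ) : ∃ a > 0, ∃ b > 0, ∀ x y, 0 ≤ x → x ≤ y → y ≤ π/2 →
    a * ((ψ x - ψ y) * (1 - ψ y)) ≤ conv α ψ x - conv α ψ y ∧
    conv α ψ x - conv α ψ y ≤ b * ((ψ x - ψ y) * (1 - ψ y)) := by
  obtain ⟨a, ha, b, hb, hab⟩ := gt_compare P.hp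
  have hc := P.hc
  refine ⟨c * a, by positivity, c * b, by positivity, ?_⟩
  intro x y hx hxy hy
  have hpi := Real.pi_pos
  have := hab (ψ y) (ψ x) (P.nonneg_half (hx.trans hxy) hy)
    (P.sym.antitoneOn ⟨hx, by linarith⟩ ⟨by linarith, by linarith⟩ hxy) (by linarith [P.sym.le_zero x, P.one])
  rw [P.eq, P.eq, ← mul_sub, mul_assoc, mul_assoc]
  exact ⟨mul_le_mul_of_nonneg_left this.1 hc.le, mul_le_mul_of_nonneg_left this.2 hc.le⟩

lemma upper (P : Prof α p c ψ) : ∃ A > 0, ∀ z, 0 ≤ z → z ≤ π → 1 - ψ z ≤ A * z ^ α := by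
  obtain ⟨a, ha, b, hb, hab⟩ := P.compare
  obtain ⟨C, hC, hE⟩ := lemmaE P.h0 P.h1
  have h0 := P.h0
  have hpi := Real.pi_pos
  have hpi3 := Real.pi_gt_three
  set A := max (C / a) 2 with hA
  have hA2 : 2 ≤ A := le_max_right _ _
  have hAC : C / a ≤ A := le_max_left _ _
  have hA0 : 0 < A := by linarith
  have hw2 : ∀ z, 1 - ψ z ≤ 2 := fun z => by linarith [P.sym.ge_neg z, P.one]
  have key : ∀ n : ℕ, ∀ z, 0 ≤ z → z ≤ π → 1 - ψ z ≤ A * z ^ (α * (1 - (1/2)^n)) := by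
    intro n
    induction n with
    | zero => intro z _ _; simp; linarith [hw2 z]
    | succ n ih =>
      intro z hz hzp
      set β := α * (1 - (1/2)^n) with hβ
      have hpn : (1/2:ℝ)^n ≤ 1 := pow_le_one₀ (by norm_num) (by norm_num)
      have hpn0 : (0:ℝ) < (1/2:ℝ)^n := by positivity
      have hβ0 : 0 ≤ β := mul_nonneg h0.le (by linarith)
      have hβα : β ≤ α := by rw [hβ]; nlinarith
      have e : α * (1 - (1/2:ℝ)^(n+1)) = (α + β)/2 := by rw [hβ, pow_succ]; ring
      rw [e]
      rcases le_or_gt z (π/2) with h | h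
      · rcases hz.eq_or_lt with h' | h'
        · rw [← h', P.one]; simp; positivity
        have k1 := hE ψ P.sym P.one A β hA0.le hβ0 hβα ih 0 z le_rfl h' h
        have k2 := (hab 0 z le_rfl hz h).1
        rw [sub_zero] at k1
        rw [P.one] at k2
        have k3 : (1 - ψ z) ^ 2 ≤ (A * z ^ ((α + β)/2)) ^ 2 := by
          have e2 : (z ^ ((α + β)/2)) ^ 2 = z ^ β * z ^ α := by
            rw [← Real.rpow_natCast, ← Real.rpow_mul hz, ← Real.rpow_add h']; congr 1; push_cast; ring
          rw [mul_pow, e2]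
          have k4 : a * (1 - ψ z)^2 ≤ C * (A * (z ^ β * z ^ α)) := by nlinarith
          have k5 : (1 - ψ z)^2 ≤ C / a * (A * (z ^ β * z ^ α)) := by
            rw [div_mul_eq_mul_div, le_div_iff₀ ha]; linarith
          calc _ ≤ C / a * (A * (z ^ β * z ^ α)) := k5
            _ ≤ A * (A * (z ^ β * z ^ α)) := by gcongr
            _ = _ := by ring
        exact le_of_sq_le_sq k3 (by positivity)
      · calc 1 - ψ z ≤ 2 := hw2 z
          _ ≤ A * 1 := by linarith
          _ ≤ _ := by
            gcongr
            exact Real.one_le_rpow (by linarith) (by positivity)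
  refine ⟨A, hA0, ?_⟩
  intro z hz hzp
  rcases hz.eq_or_lt with h' | h'
  · rw [← h', P.one]; simp; positivity
  have ht : Tendsto (fun n : ℕ => A * z ^ (α * (1 - (1/2:ℝ)^n))) atTop (𝓝 (A * z ^ (α * (1 - 0)))) := by
    apply Tendsto.const_mul
    apply Tendsto.rpow tendsto_const_nhds _ (Or.inl h'.ne')
    apply Tendsto.const_mul
    exact tendsto_const_nhds.sub (tendsto_pow_atTop_nhds_zero_of_lt_one (by norm_num) (by norm_num))
  rw [sub_zero, mul_one] at ht
  exact ge_of_tendsto' ht fun n => key n z hz hzp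

lemma K_diff_lower {α : ℝ} (h0 : 0 < α) (h1 : α < 1) : ∃ k > 0, ∀ x z : ℝ, 0 < x → 0 < z → z ≤ 2 * x → 3 * x ≤ 1 →
    k * (x * x ^ (α - 2)) ≤ Kker α z - Kker α (x + z) := by
  obtain ⟨k, hk, hd⟩ := dK_neg_lower h0 h1
  refine ⟨k * 3 ^ (α - 2), by positivity, ?_⟩
  intro x z hx hz hzx h3
  have hder : ∀ t ∈ Icc z (x + z), HasDerivAt (Kker α) (dK α t) t := by
    intro t ht
    have ht0 : 0 < t := by linarith [ht.1]
    apply Kker_hasDerivAt h0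
    exact cos_lt_one_of ht0.ne' (by rw [abs_of_pos ht0]; linarith [ht.2, Real.pi_gt_three])
  obtain ⟨ξ, hξ, he⟩ := exists_hasDerivAt_eq_slope (Kker α) (dK α) (show z < x + z by linarith)
    (fun t ht => (hder t ht).continuousAt.continuousWithinAt) (fun t ht => hder t (Ioo_subset_Icc_self ht))
  rw [show x + z - z = x by ring, eq_div_iff hx.ne'] at he
  have hξ0 : 0 < ξ := by linarith [hξ.1]
  have h4 := hd ξ hξ0 (by linarith [hξ.2])
  have h5 : (3 * x) ^ (α - 2) ≤ ξ ^ (α - 2) := Real.rpow_le_rpow_of_nonpos hξ0 (by linarith [hξ.2]) (by linarith)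
  rw [Real.mul_rpow (by norm_num) hx.le] at h5
  have h6 : k * (3 ^ (α - 2) * x ^ (α - 2)) ≤ k * ξ ^ (α - 2) := mul_le_mul_of_nonneg_left h5 hk.le
  nlinarith

lemma lower_step (P : Prof α p c ψ) : ∃ κ > 0, ∀ x, 0 < x → 3 * x ≤ 1 →
    κ * x ^ α * (ψ x - ψ (2 * x)) ≤ (1 - ψ x) ^ 2 := by
  obtain ⟨a, ha, b, hb, hab⟩ := P.compare
  obtain ⟨k, hk, hK⟩ := K_diff_lower P.h0 P.h1
  have h0 := P.h0
  have h1 := P.h1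
  have hpi := Real.pi_pos
  have hpi3 := Real.pi_gt_three
  refine ⟨k / b, by positivity, ?_⟩
  intro x hx h3
  have hψ := P.sym
  have hup := (hab 0 x le_rfl hx.le (by linarith)).2
  rw [P.one, conv_reflect h0 h1 hψ] at hup
  simp only [zero_add, zero_sub] at hup
  have hc2 : Continuous fun y => ψ y - ψ (x - y) := by have := hψ.cont; fun_prop
  have hi : ∀ a b, IntervalIntegrable (fun y => (Kker α (-y) - Kker α (x - y)) * (ψ y - ψ (x - y))) volume a b := by
    intro a b
    have := KKK_intervalIntegrable h0 h1 hc2 0 x a b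
    simpa using this
  have hin : ∀ a b, IntervalIntegrable ψ volume a b := fun a b => hψ.cont.intervalIntegrable _ _
  set q := k * (x * x ^ (α - 2)) with hq
  have hq0 : 0 < q := by positivity
  have s1 : ∫ y in (-(2*x))..0, q * (ψ y - ψ (x - y)) ≤
      ∫ y in (-(2*x))..0, (Kker α (-y) - Kker α (x - y)) * (ψ y - ψ (x - y)) := by
    apply intervalIntegral.integral_mono_on_of_le_Ioo (by linarith) ((hc2.const_mul q).intervalIntegrable _ _) (hi _ _)
    intro y hy
    apply mul_le_mul_of_nonneg_right
    · have := hK x (-y) hx (by linarith [hy.2]) (by linarith [hy.1]) h3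
      rw [← sub_eq_add_neg] at this
      exact this
    · have e1 := hψ.antitoneOn (a := -y) (b := x - y) ⟨by linarith [hy.2], by linarith [hy.1]⟩
        ⟨by linarith [hy.2], by linarith [hy.1]⟩ (by linarith)
      rw [hψ.even] at e1
      linarith
  have s2 : ∫ y in (-(2*x))..0, (Kker α (-y) - Kker α (x - y)) * (ψ y - ψ (x - y)) ≤
      ∫ y in (x/2 - π)..(x/2), (Kker α (-y) - Kker α (x - y)) * (ψ y - ψ (x - y)) := by
    apply intervalIntegral.integral_mono_interval (by linarith) (by linarith) (by linarith) _ (hi _ _)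
    filter_upwards [ae_restrict_mem measurableSet_Ioc, ae_restrict_of_ae (ae_cos_ne 0)] with y hy hcs
    have := conv_anti_nonneg h0 h1 hψ le_rfl hx.le (by linarith) y (by simp only [zero_add]; exact Ioc_subset_Icc_self hy) hcs
    simpa using this
  have s3 : ∫ y in (-(2*x))..0, q * (ψ y - ψ (x - y)) = q * ((∫ y in (0:ℝ)..x, ψ y) - ∫ y in (2*x)..(3*x), ψ y) := by
    rw [intervalIntegral.integral_const_mul, intervalIntegral.integral_sub (hin _ _)
      ((by have := hψ.cont; fun_prop : Continuous fun y => ψ (x - y)).intervalIntegrable _ _)]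
    congr 1
    have e1 : ∫ y in (-(2*x))..0, ψ y = ∫ y in (0:ℝ)..(2*x), ψ y := by
      have := intervalIntegral.integral_comp_neg (a := 0) (b := 2*x) ψ
      rw [neg_zero] at this
      rw [← this]
      congr 1; ext y; rw [hψ.even]
    have e2 : ∫ y in (-(2*x))..0, ψ (x - y) = ∫ y in x..(3*x), ψ y := by
      rw [intervalIntegral.integral_comp_sub_left ψ x]
      congr 1 <;> ring
    rw [e1, e2, ← intervalIntegral.integral_add_adjacent_intervals (hin 0 x) (hin x (2*x)),
      ← intervalIntegral.integral_add_adjacent_intervals (hin x (2*x)) (hin (2*x) (3*x))]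
    ring
  have s4 : x * ψ x ≤ ∫ y in (0:ℝ)..x, ψ y := by
    have := intervalIntegral.integral_mono_on (μ := volume) hx.le (intervalIntegrable_const (c := ψ x)) (hin 0 x)
      (fun y hy => hψ.antitoneOn ⟨hy.1, by linarith [hy.2]⟩ ⟨hx.le, by linarith⟩ hy.2)
    rw [intervalIntegral.integral_const, smul_eq_mul, sub_zero] at this
    exact this
  have s5 : ∫ y in (2*x)..(3*x), ψ y ≤ x * ψ (2*x) := by
    have := intervalIntegral.integral_mono_on (μ := volume) (show 2*x ≤ 3*x by linarith) (hin (2*x) (3*x)) (intervalIntegrable_const (c := ψ (2*x)))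
      (fun y hy => hψ.antitoneOn ⟨by linarith, by linarith⟩ ⟨by linarith [hy.1], by linarith [hy.2]⟩ hy.1)
    rw [intervalIntegral.integral_const, smul_eq_mul, show 3*x - 2*x = x by ring] at this
    exact this
  have s6 : q * (x * (ψ x - ψ (2*x))) ≤ b * ((1 - ψ x) * (1 - ψ x)) := by
    calc q * (x * (ψ x - ψ (2*x))) ≤ q * ((∫ y in (0:ℝ)..x, ψ y) - ∫ y in (2*x)..(3*x), ψ y) := by
          apply mul_le_mul_of_nonneg_left _ hq0.le; linarith
      _ ≤ _ := by rw [← s3]; exact s1.trans (s2.trans hup)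
  have e3 : q * x = k * x ^ α := by
    rw [hq, show α = (α - 2) + 1 + 1 by ring, Real.rpow_add hx, Real.rpow_add hx, Real.rpow_one]
    ring_nf
  rw [show k / b * x ^ α * (ψ x - ψ (2 * x)) = (k * x ^ α * (ψ x - ψ (2*x))) / b by ring, div_le_iff₀ hb, ← e3]
  nlinarith

lemma lower (P : Prof α p c ψ) : ∃ ε > 0, ∀ z, 0 ≤ z → z ≤ π → ε * z ^ α ≤ 1 - ψ z := by
  obtain ⟨κ, hκ, hs⟩ := P.lower_step
  have h0 := P.h0
  have hpi3 := Real.pi_gt_three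
  have hpi4 := Real.pi_lt_four
  have hw : 0 < 1 - ψ (1/3) := by
    have := P.strict le_rfl (show (0:ℝ) < 1/3 by norm_num) (by linarith)
    rw [P.one] at this; linarith
  have h2α : 0 < (2:ℝ)^α - 1 := by linarith [Real.one_lt_rpow (show (1:ℝ) < 2 by norm_num) h0]
  set ε := min (κ * (2^α - 1)) ((1 - ψ (1/3))/4) with hε
  have hε0 : 0 < ε := lt_min (by positivity) (by positivity)
  have hε1 : ε ≤ κ * (2^α - 1) := min_le_left _ _
  have hε2 : ε ≤ (1 - ψ (1/3))/4 := min_le_right _ _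
  have key : ∀ n : ℕ, ∀ z, (1/3) * (1/2:ℝ)^n ≤ z → z ≤ π → ε * z ^ α ≤ 1 - ψ z := by
    intro n
    induction n with
    | zero =>
      intro z hz hzp
      simp only [pow_zero, mul_one] at hz
      have e1 := P.sym.antitoneOn ⟨by norm_num, by linarith⟩ ⟨by linarith, hzp⟩ hz
      have e2 : z ^ α ≤ 4 := by
        calc z ^ α ≤ 4 ^ α := Real.rpow_le_rpow (by linarith) (by linarith) h0.le
          _ ≤ 4 ^ (1:ℝ) := Real.rpow_le_rpow_of_exponent_le (by norm_num) P.h1.le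
          _ = 4 := Real.rpow_one 4
      have : ε * z ^ α ≤ ε * 4 := by gcongr
      linarith
    | succ n ih =>
      intro z hz hzp
      have hz0 : 0 < z := lt_of_lt_of_le (by positivity) hz
      rcases le_or_gt (1/3) z with h | h
      · have hp1 : (1/2:ℝ)^n ≤ 1 := pow_le_one₀ (by norm_num) (by norm_num)
        exact ih z (by linarith) hzp
      · have i1 := ih (2*z) (by rw [pow_succ] at hz; linarith) (by linarith)
        have i2 := hs z hz0 (by linarith)
        rw [Real.mul_rpow (by norm_num) hz0.le] at i1
        by_contra! hcon
        have hzα : 0 < z ^ α := by positivity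
        have i3 := P.w_nonneg z
        have i4 : (1 - ψ z)^2 < (ε * z ^ α)^2 := by
          apply pow_lt_pow_left₀ hcon i3 (by norm_num)
        have i5 : ε * z ^ α * (2^α - 1) ≤ ψ z - ψ (2*z) := by linarith
        have i6 : κ * z ^ α * (ε * z ^ α * (2^α - 1)) ≤ κ * z ^ α * (ψ z - ψ (2*z)) :=
          mul_le_mul_of_nonneg_left i5 (by positivity)
        have i7 : (ε * z ^ α)^2 ≤ κ * z ^ α * (ε * z ^ α * (2^α - 1)) := by
          calc (ε * z ^ α)^2 = ε * (ε * (z ^ α)^2) := by ring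
            _ ≤ (κ * (2^α - 1)) * (ε * (z ^ α)^2) := by gcongr
            _ = _ := by ring
        linarith
  refine ⟨ε, hε0, ?_⟩
  intro z hz hzp
  rcases hz.eq_or_lt with h | h
  · rw [← h, P.one, Real.zero_rpow h0.ne']; simp
  · obtain ⟨n, hn⟩ := exists_pow_lt_of_lt_one (show 0 < 3 * z by positivity) (show (1/2:ℝ) < 1 by norm_num)
    exact key n z (by linarith) hzp

lemma holder (P : Prof α p c ψ) : ∃ H > 0, ∀ x y, |ψ x - ψ y| ≤ H * |x - y| ^ α := by
  obtain ⟨a, ha, b, hb, hab⟩ := P.compare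
  obtain ⟨C, hC, hE⟩ := lemmaE P.h0 P.h1
  obtain ⟨A, hA, hup⟩ := P.upper
  obtain ⟨ε, hε, hlow⟩ := P.lower
  have h0 := P.h0
  have hpi := Real.pi_pos
  set H := C * A / (a * ε) with hH
  have hH0 : 0 < H := by positivity
  have k1 : ∀ x y, 0 ≤ x → x < y → y ≤ π/2 → ψ x - ψ y ≤ H * (y - x) ^ α := by
    intro x y hx hxy hy
    have hy0 : 0 < y := by linarith
    have e1 := hE ψ P.sym P.one A α hA.le h0.le le_rfl hup x y hx hxy hy
    have e2 := (hab x y hx hxy.le hy).1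
    have e3 := hlow y hy0.le (by linarith)
    have e4 : 0 ≤ ψ x - ψ y := by linarith [P.strict hx hxy (by linarith)]
    have hyα : 0 < y ^ α := by positivity
    have e5 : a * ((ψ x - ψ y) * (ε * y ^ α)) ≤ a * ((ψ x - ψ y) * (1 - ψ y)) := by gcongr
    have e6 : y ^ α * ((ψ x - ψ y) * (a * ε)) ≤ y ^ α * (C * A * (y - x) ^ α) := by linarith
    have e7 := le_of_mul_le_mul_left e6 hyα
    rw [hH, div_mul_eq_mul_div, le_div_iff₀ (by positivity)]
    exact e7
  have k1' : ∀ x y, 0 ≤ x → x ≤ y → y ≤ π/2 → ψ x - ψ y ≤ H * (y - x) ^ α := by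
    intro x y hx hxy hy
    rcases hxy.eq_or_lt with h | h
    · rw [h]; simp [Real.zero_rpow h0.ne']
    · exact k1 x y hx h hy
  have k2 : ∀ x y, 0 ≤ x → x ≤ y → y ≤ π → ψ x - ψ y ≤ 2 * H * (y - x) ^ α := by
    intro x y hx hxy hy
    have hpos : 0 ≤ H * (y - x) ^ α := mul_nonneg hH0.le (Real.rpow_nonneg (by linarith) _)
    rcases le_total y (π/2) with h | h
    · linarith [k1' x y hx hxy h]
    rcases le_total x (π/2) with h' | h'
    · have e1 := k1' x (π/2) hx h' le_rfl
      have e2 := k1' (π - y) (π/2) (by linarith) (by linarith) le_rfl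
      rw [P.sym.pi_sub, P.sym.half_pi] at e2
      rw [P.sym.half_pi] at e1
      have e3 : H * (π/2 - x) ^ α ≤ H * (y - x) ^ α := by
        apply mul_le_mul_of_nonneg_left _ hH0.le
        exact Real.rpow_le_rpow (by linarith) (by linarith) h0.le
      have e4 : H * (π/2 - (π - y)) ^ α ≤ H * (y - x) ^ α := by
        apply mul_le_mul_of_nonneg_left _ hH0.le
        exact Real.rpow_le_rpow (by linarith) (by linarith) h0.le
      linarith
    · have e2 := k1' (π - y) (π - x) (by linarith) (by linarith) (by linarith)
      rw [P.sym.pi_sub, P.sym.pi_sub, show π - x - (π - y) = y - x by ring] at e2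
      linarith
  have k3 : ∀ x y, 0 ≤ x → x ≤ π → 0 ≤ y → y ≤ π → |ψ x - ψ y| ≤ 2 * H * |x - y| ^ α := by
    have : ∀ x y, 0 ≤ x → y ≤ π → x ≤ y → |ψ x - ψ y| ≤ 2 * H * |x - y| ^ α := by
      intro x y hx hy hxy
      rw [abs_of_nonneg (sub_nonneg.2 (P.sym.antitoneOn ⟨hx, by linarith⟩ ⟨by linarith, hy⟩ hxy)),
        abs_sub_comm, abs_of_nonneg (by linarith : 0 ≤ y - x)]
      exact k2 x y hx hxy hy
    intro x y hx hx' hy hy'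
    rcases le_total x y with h | h
    · exact this x y hx hy' h
    · rw [abs_sub_comm, abs_sub_comm x y]; exact this y x hy hx' h
  refine ⟨2 * H, by positivity, ?_⟩
  intro x y
  have f1 : ∀ x : ℝ, ψ x = ψ ‖(x : AddCircle (2*π))‖ := by
    intro x
    rw [AddCircle.norm_eq]
    apply P.sym.congr
    rw [Real.cos_abs, Real.cos_sub_int_mul_two_pi]
  have f2 : ∀ x : ℝ, ‖(x : AddCircle (2*π))‖ ≤ π := by
    intro x
    have := AddCircle.norm_le_half_period (2*π) (by positivity) (x := (x : AddCircle (2*π)))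
    rw [abs_of_pos (by positivity)] at this
    linarith
  rw [f1 x, f1 y]
  refine (k3 _ _ (norm_nonneg _) (f2 x) (norm_nonneg _) (f2 y)).trans ?_
  apply mul_le_mul_of_nonneg_left _ (by positivity)
  apply Real.rpow_le_rpow (abs_nonneg _) _ h0.le
  calc |‖(x : AddCircle (2*π))‖ - ‖(y : AddCircle (2*π))‖| ≤ ‖(x : AddCircle (2*π)) - (y : AddCircle (2*π))‖ := abs_norm_sub_norm_le _ _
    _ = ‖((x - y : ℝ) : AddCircle (2*π))‖ := by rw [AddCircle.coe_sub]
    _ ≤ |x - y| := by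
      exact QuotientAddGroup.norm_mk_le_norm
end Prof


/-- `C^{k,β}` on the open interval `(a,b)` -/
def Lk : ℕ → ℝ → (ℝ → ℝ) → ℝ → ℝ → Prop
  | 0, β, f, a, b => ∃ C : ℝ, ∀ x ∈ Ioo a b, ∀ y ∈ Ioo a b, |f x - f y| ≤ C * |x - y| ^ β
  | k+1, β, f, a, b => (∀ x ∈ Ioo a b, DifferentiableAt ℝ f x) ∧ Lk k β (deriv f) a b

section
variable {β a b : ℝ}

lemma contDiffAt_deriv_top {f : ℝ → ℝ} {x : ℝ} (h : ContDiffAt ℝ (⊤ : ℕ∞) f x) : ContDiffAt ℝ (⊤ : ℕ∞) (deriv f) x := by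
  have h2 : ContDiffAt ℝ (⊤ : ℕ∞) (fderiv ℝ f) x := h.fderiv_right (by simp)
  have e : deriv f = fun x => fderiv ℝ f x 1 := by ext x; simp
  rw [e]
  exact h2.clm_apply contDiffAt_const

lemma deriv_congr_Ioo {f g : ℝ → ℝ} (h : ∀ x ∈ Ioo a b, f x = g x) : ∀ x ∈ Ioo a b, deriv f x = deriv g x := by
  intro x hx
  apply Filter.EventuallyEq.deriv_eq
  filter_upwards [Ioo_mem_nhds hx.1 hx.2] with y hy using h y hy

lemma Lk_congr {k : ℕ} : ∀ {f g : ℝ → ℝ}, (∀ x ∈ Ioo a b, f x = g x) → Lk k β f a b → Lk k β g a b := by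
  induction k with
  | zero =>
    rintro f g h ⟨C, hC⟩
    refine ⟨C, fun x hx y hy => ?_⟩
    rw [← h x hx, ← h y hy]; exact hC x hx y hy
  | succ k ih =>
    rintro f g h ⟨h1, h2⟩
    refine ⟨fun x hx => ?_, ih (deriv_congr_Ioo h) h2⟩
    apply (h1 x hx).congr_of_eventuallyEq
    filter_upwards [Ioo_mem_nhds hx.1 hx.2] with y hy using (h y hy).symm

lemma Lk_mono {k : ℕ} {a' b' : ℝ} (ha : a ≤ a') (hb : b' ≤ b) : ∀ {f : ℝ → ℝ}, Lk k β f a b → Lk k β f a' b' := by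
  have hs : Ioo a' b' ⊆ Ioo a b := Ioo_subset_Ioo ha hb
  induction k with
  | zero =>
    rintro f ⟨C, hC⟩
    exact ⟨C, fun x hx y hy => hC x (hs hx) y (hs hy)⟩
  | succ k ih =>
    rintro f ⟨h1, h2⟩
    exact ⟨fun x hx => h1 x (hs hx), ih h2⟩

lemma Lk_exp {k : ℕ} {β' : ℝ} (h0 : 0 < β') (h : β' ≤ β) : ∀ {f : ℝ → ℝ}, Lk k β f a b → Lk k β' f a b := by
  induction k with
  | zero =>
    rintro f ⟨C, hC⟩
    refine ⟨|C| * |b - a| ^ (β - β'), fun x hx y hy => ?_⟩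
    refine (hC x hx y hy).trans ?_
    rcases eq_or_ne x y with h' | h'
    · rw [h', sub_self, abs_zero, Real.zero_rpow (by linarith), Real.zero_rpow (by linarith)]; simp
    have hpos : 0 < |x - y| := abs_pos.2 (sub_ne_zero.2 h')
    have e : |x - y| ^ β = |x - y| ^ (β - β') * |x - y| ^ β' := by rw [← Real.rpow_add hpos]; simp
    rw [e, mul_assoc, ]
    have : |x - y| ≤ |b - a| := by
      rw [abs_of_pos (by linarith [hx.1, hx.2] : 0 < b - a), abs_le]
      constructor <;> linarith [hx.1, hx.2, hy.1, hy.2]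
    have : |x - y| ^ (β - β') ≤ |b - a| ^ (β - β') := Real.rpow_le_rpow hpos.le this (by linarith)
    gcongr
    exact le_abs_self C
  | succ k ih =>
    rintro f ⟨h1, h2⟩
    exact ⟨h1, ih h2⟩

lemma Lk0_bounded (hβ : 0 < β) {f : ℝ → ℝ} (h : Lk 0 β f a b) : ∃ M > 0, ∀ x ∈ Ioo a b, |f x| ≤ M := by
  obtain ⟨C, hC⟩ := h
  rcases le_or_gt b a with hab | hab
  · exact ⟨1, one_pos, fun x hx => absurd (hx.1.trans hx.2) (by linarith)⟩
  set m := (a+b)/2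
  have hm : m ∈ Ioo a b := ⟨by simp only [m]; linarith, by simp only [m]; linarith⟩
  refine ⟨|f m| + |C| * |b - a| ^ β + 1, by positivity, fun x hx => ?_⟩
  have h1 := hC x hx m hm
  have h2 : |x - m| ≤ |b - a| := by
    rw [abs_of_pos (by linarith : 0 < b - a), abs_le]
    constructor <;> linarith [hx.1, hx.2, hm.1, hm.2]
  have h3 : C * |x - m| ^ β ≤ |C| * |b - a| ^ β := by
    gcongr
    exact le_abs_self C
  have h4 : |f x| ≤ |f m| + |f x - f m| := by
    have := abs_add_le (f m) (f x - f m)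
    simpa using this
  linarith

lemma Lk0_continuousOn (hβ : 0 < β) {f : ℝ → ℝ} (h : Lk 0 β f a b) : ContinuousOn f (Ioo a b) := by
  obtain ⟨C, hC⟩ := h
  intro x hx
  rw [ContinuousWithinAt, tendsto_iff_norm_sub_tendsto_zero]
  have ht : Tendsto (fun y => C * |y - x| ^ β) (𝓝[Ioo a b] x) (𝓝 0) := by
    have : Continuous (fun y => C * |y - x| ^ β) := by
      apply continuous_const.mul
      exact (by fun_prop : Continuous fun y => |y - x|).rpow_const fun _ => Or.inr hβ.le
    have h2 := (this.tendsto x).mono_left (nhdsWithin_le_nhds (s := Ioo a b))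
    simpa [Real.zero_rpow hβ.ne'] using h2
  refine squeeze_zero' (Eventually.of_forall fun _ => norm_nonneg _) ?_ ht
  filter_upwards [self_mem_nhdsWithin] with y hy
  exact hC y hy x hx

/-- bounded derivative implies Hölder -/
lemma Lk0_of_deriv (hβ : 0 < β) (hβ1 : β ≤ 1) {f : ℝ → ℝ} (hd : ∀ x ∈ Ioo a b, DifferentiableAt ℝ f x) {M : ℝ}
    (hM : ∀ x ∈ Ioo a b, |deriv f x| ≤ M) : Lk 0 β f a b := by
  have : Lk 0 1 f a b := by
    refine ⟨M, fun x hx y hy => ?_⟩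
    rw [Real.rpow_one]
    exact Convex.norm_image_sub_le_of_norm_deriv_le (fun z hz => hd z hz) hM (convex_Ioo a b) hy hx
  exact Lk_exp hβ hβ1 this

lemma Lk_down (hβ : 0 < β) (hβ1 : β ≤ 1) {k : ℕ} : ∀ {f : ℝ → ℝ}, Lk (k+1) β f a b → Lk k β f a b := by
  induction k with
  | zero =>
    rintro f ⟨h1, h2⟩
    obtain ⟨M, _, hM⟩ := Lk0_bounded hβ h2
    exact Lk0_of_deriv hβ hβ1 h1 hM
  | succ k ih =>
    rintro f ⟨h1, h2⟩
    exact ⟨h1, ih h2⟩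

lemma Lk_add {k : ℕ} : ∀ {f g : ℝ → ℝ}, Lk k β f a b → Lk k β g a b → Lk k β (fun x => f x + g x) a b := by
  induction k with
  | zero =>
    rintro f g ⟨C, hC⟩ ⟨D, hD⟩
    refine ⟨C + D, fun x hx y hy => ?_⟩
    have := abs_add_le (f x - f y) (g x - g y)
    rw [show f x + g x - (f y + g y) = f x - f y + (g x - g y) by ring, add_mul]
    linarith [hC x hx y hy, hD x hx y hy]
  | succ k ih =>
    rintro f g ⟨h1, h2⟩ ⟨h3, h4⟩
    refine ⟨fun x hx => (h1 x hx).add (h3 x hx), Lk_congr (fun x hx => ?_) (ih h2 h4)⟩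
    exact ((h1 x hx).hasDerivAt.add (h3 x hx).hasDerivAt).deriv.symm

lemma Lk_mul (hβ : 0 < β) (hβ1 : β ≤ 1) {k : ℕ} : ∀ {f g : ℝ → ℝ}, Lk k β f a b → Lk k β g a b →
    Lk k β (fun x => f x * g x) a b := by
  induction k with
  | zero =>
    rintro f g hf hg
    obtain ⟨M, hM0, hM⟩ := Lk0_bounded hβ hf
    obtain ⟨N, hN0, hN⟩ := Lk0_bounded hβ hg
    obtain ⟨C, hC⟩ := hf
    obtain ⟨D, hD⟩ := hg
    refine ⟨M * D + C * N, fun x hx y hy => ?_⟩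
    rw [show f x * g x - f y * g y = f x * (g x - g y) + (f x - f y) * g y by ring]
    have e1 := hC x hx y hy
    have e2 := hD x hx y hy
    calc _ ≤ |f x| * |g x - g y| + |f x - f y| * |g y| := by
          rw [← abs_mul, ← abs_mul]; exact abs_add_le _ _
      _ ≤ M * (D * |x - y|^β) + (C * |x - y| ^ β) * N := by
          have e3 := (abs_nonneg _).trans e1
          have e4 := (abs_nonneg _).trans e2
          gcongr
          · exact hM x hx
          · exact hN y hy
      _ = _ := by ring
  | succ k ih =>
    intro f g hf hg
    refine ⟨fun x hx => (hf.1 x hx).mul (hg.1 x hx), Lk_congr (fun x hx => ?_)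
      (Lk_add (ih hf.2 (Lk_down hβ hβ1 hg)) (ih (Lk_down hβ hβ1 hf) hg.2))⟩
    exact ((hf.1 x hx).hasDerivAt.mul (hg.1 x hx).hasDerivAt).deriv.symm

/-- smooth functions on a neighbourhood of a compact interval -/
lemma Lk_smooth (hβ : 0 < β) (hβ1 : β ≤ 1) {k : ℕ} : ∀ {f : ℝ → ℝ}, (∀ x ∈ Icc a b, ContDiffAt ℝ (⊤ : ℕ∞) f x) →
    Lk k β f a b := by
  have hder : ∀ f : ℝ → ℝ, (∀ x ∈ Icc a b, ContDiffAt ℝ (⊤ : ℕ∞) f x) → ∀ x ∈ Icc a b, ContDiffAt ℝ (⊤ : ℕ∞) (deriv f) x := by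
    intro f hf x hx
    exact contDiffAt_deriv_top (hf x hx)
  induction k with
  | zero =>
    intro f hf
    have hc : ContinuousOn (deriv f) (Icc a b) := fun x hx => (hder f hf x hx).continuousAt.continuousWithinAt
    obtain ⟨M, hM⟩ := isCompact_Icc.exists_bound_of_continuousOn hc
    exact Lk0_of_deriv hβ hβ1 (fun x hx => (hf x (Ioo_subset_Icc_self hx)).differentiableAt (by simp))
      (fun x hx => hM x (Ioo_subset_Icc_self hx))
  | succ k ih =>
    intro f hf
    exact ⟨fun x hx => (hf x (Ioo_subset_Icc_self hx)).differentiableAt (by simp), ih (hder f hf)⟩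

lemma Lk_comp (hβ : 0 < β) (hβ1 : β ≤ 1) {m M : ℝ} {k : ℕ} : ∀ {G f : ℝ → ℝ}, (∀ x ∈ Icc m M, ContDiffAt ℝ (⊤ : ℕ∞) G x) →
    (∀ x ∈ Ioo a b, f x ∈ Icc m M) → Lk k β f a b → Lk k β (fun x => G (f x)) a b := by
  induction k with
  | zero =>
    rintro G f hG hr ⟨C, hC⟩
    have hc : ContinuousOn (deriv G) (Icc m M) := fun x hx => (contDiffAt_deriv_top (hG x hx)).continuousAt.continuousWithinAt
    obtain ⟨N, hN⟩ := isCompact_Icc.exists_bound_of_continuousOn hc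
    refine ⟨N * C, fun x hx y hy => ?_⟩
    have h1 : |G (f x) - G (f y)| ≤ N * |f x - f y| :=
      Convex.norm_image_sub_le_of_norm_deriv_le (fun z hz => (hG z hz).differentiableAt (by simp)) hN (convex_Icc m M) (hr y hy) (hr x hx)
    have hN0 : 0 ≤ N := (norm_nonneg _).trans (hN _ (hr x hx))
    calc _ ≤ N * |f x - f y| := h1
      _ ≤ N * (C * |x - y| ^ β) := by gcongr; exact hC x hx y hy
      _ = _ := by ring
  | succ k ih =>
    intro G f hG hr hf
    have hdG : ∀ x ∈ Ioo a b, HasDerivAt (fun x => G (f x)) (deriv G (f x) * deriv f x) x := fun x hx =>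
      ((hG _ (hr x hx)).differentiableAt (by simp)).hasDerivAt.comp x (hf.1 x hx).hasDerivAt
    refine ⟨fun x hx => (hdG x hx).differentiableAt, Lk_congr (fun x hx => (hdG x hx).deriv.symm) ?_⟩
    exact Lk_mul hβ hβ1 (ih (fun x hx => contDiffAt_deriv_top (hG x hx)) hr (Lk_down hβ hβ1 hf)) hf.2

lemma Lk_contDiffOn (hβ : 0 < β) {k : ℕ} : ∀ {f : ℝ → ℝ}, Lk k β f a b → ContDiffOn ℝ k f (Ioo a b) := by
  induction k with
  | zero => intro f h; exact contDiffOn_zero.2 (Lk0_continuousOn hβ h)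
  | succ k ih =>
    intro f h
    have := (contDiffOn_succ_iff_deriv_of_isOpen (𝕜 := ℝ) (n := k) (f := f) isOpen_Ioo).2
      ⟨fun x hx => (h.1 x hx).differentiableWithinAt, by simp, ih h.2⟩
    exact_mod_cast this
end


section
variable {α : ℝ}

lemma dK_diff_bound (h0 : 0 < α) (h1 : α < 1) :
    ∃ C > 0, ∀ z h : ℝ, z ≠ 0 → |z| ≤ π → |h| ≤ |z|/2 →
      |dK α (z + h) - dK α z| ≤ C * |h| * |z| ^ (α - 3) := by
  obtain ⟨C, hC, hd⟩ := ddK_bound h0 h1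
  have hpi := Real.pi_pos
  refine ⟨C * (1/2) ^ (α - 3), by positivity, ?_⟩
  intro z h hz hzpi hh
  have hz0 := abs_pos.2 hz
  have key : ∀ ξ ∈ uIcc z (z+h), |z|/2 ≤ |ξ| ∧ |ξ| ≤ 3 * π / 2 := by
    intro ξ hξ
    have h2 : |ξ - z| ≤ |h| := by
      have := abs_sub_left_of_mem_uIcc hξ
      simpa using this
    have a1 := abs_sub_abs_le_abs_sub z ξ
    have a2 := abs_sub_abs_le_abs_sub ξ z
    rw [abs_sub_comm] at a1
    constructor <;> linarith
  have := Convex.norm_image_sub_le_of_norm_hasDerivWithin_le (f := dK α) (f' := ddK α)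
    (C := C * ((1/2) ^ (α - 3) * |z| ^ (α - 3))) (s := uIcc z (z+h)) (x := z) (y := z + h)
    (by
      intro ξ hξ
      obtain ⟨k1, k2⟩ := key ξ hξ
      have hξ0 : ξ ≠ 0 := abs_pos.1 (by linarith)
      exact (dK_hasDerivAt h0 (cos_lt_one_of hξ0 k2)).hasDerivWithinAt)
    (by
      intro ξ hξ
      obtain ⟨k1, k2⟩ := key ξ hξ
      have hξ0 : ξ ≠ 0 := abs_pos.1 (by linarith)
      refine (hd ξ hξ0 k2).trans ?_
      rw [← Real.mul_rpow (by norm_num) hz0.le]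
      gcongr 1
      exact Real.rpow_le_rpow_of_nonpos (by positivity) (by linarith) (by linarith))
    (convex_uIcc _ _) left_mem_uIcc right_mem_uIcc
  simp only [Real.norm_eq_abs, add_sub_cancel_left] at this
  refine this.trans (le_of_eq (by ring))

lemma K_taylor_bound (h0 : 0 < α) (h1 : α < 1) :
    ∃ C > 0, ∀ z h : ℝ, z ≠ 0 → |z| ≤ π → |h| ≤ |z|/2 →
      |Kker α (z + h) - Kker α z - h * dK α z| ≤ C * |h| ^ 2 * |z| ^ (α - 3) := by
  obtain ⟨C, hC, hd⟩ := dK_diff_bound h0 h1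
  have hpi := Real.pi_pos
  refine ⟨C, hC, ?_⟩
  intro z h hz hzpi hh
  have hz0 := abs_pos.2 hz
  have key : ∀ ξ ∈ uIcc z (z+h), |z|/2 ≤ |ξ| ∧ |ξ| ≤ 3 * π / 2 ∧ |ξ - z| ≤ |h| := by
    intro ξ hξ
    have h2 : |ξ - z| ≤ |h| := by
      have := abs_sub_left_of_mem_uIcc hξ
      simpa using this
    have a1 := abs_sub_abs_le_abs_sub z ξ
    have a2 := abs_sub_abs_le_abs_sub ξ z
    rw [abs_sub_comm] at a1
    refine ⟨?_, ?_, h2⟩ <;> linarith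
  have := Convex.norm_image_sub_le_of_norm_hasDerivWithin_le (f := fun t => Kker α t - t * dK α z)
    (f' := fun t => dK α t - 1 * dK α z)
    (C := C * |h| * |z| ^ (α - 3)) (s := uIcc z (z+h)) (x := z) (y := z + h)
    (by
      intro ξ hξ
      obtain ⟨k1, k2, k3⟩ := key ξ hξ
      have hξ0 : ξ ≠ 0 := abs_pos.1 (by linarith)
      exact ((Kker_hasDerivAt h0 (cos_lt_one_of hξ0 k2)).sub ((hasDerivAt_id ξ).mul_const _)).hasDerivWithinAt)
    (by
      intro ξ hξ
      obtain ⟨k1, k2, k3⟩ := key ξ hξ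
      have := hd z (ξ - z) hz hzpi (k3.trans hh)
      rw [add_sub_cancel] at this
      rw [one_mul, Real.norm_eq_abs]
      refine this.trans ?_
      have : 0 ≤ |z| ^ (α - 3) := by positivity
      gcongr)
    (convex_uIcc _ _) left_mem_uIcc right_mem_uIcc
  simp only [Real.norm_eq_abs, add_sub_cancel_left] at this
  rw [show Kker α (z + h) - Kker α z - h * dK α z = Kker α (z + h) - (z + h) * dK α z - (Kker α z - z * dK α z) by ring]
  refine this.trans (le_of_eq (by ring))

/-- splitting bound -/
lemma split_bound {e B N d : ℝ} {g : ℝ → ℝ} (he : e < -1) (hd : 0 < d) (hdpi : d ≤ π) (hB : 0 ≤ B)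
    (hg : IntervalIntegrable g volume (-π) π)
    (near : ∫ z in (-d)..d, |g z| ≤ N)
    (far : ∀ z : ℝ, d ≤ |z| → |z| ≤ π → |g z| ≤ B * |z| ^ e) :
    |∫ z in (-π)..π, g z| ≤ N + 2 * (B * (d ^ (e+1) / (-(e+1)))) := by
  have hpi := Real.pi_pos
  have hgi : ∀ a b : ℝ, -π ≤ a → a ≤ π → -π ≤ b → b ≤ π → IntervalIntegrable (fun z => |g z|) volume a b := by
    intro a b h1 h2 h3 h4
    apply hg.abs.mono_set
    rw [uIcc_of_le (by linarith : -π ≤ π)]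
    intro z hz
    rw [mem_uIcc] at hz
    constructor <;> rcases hz with hz | hz <;> linarith [hz.1, hz.2]
  have tail : ∫ z in d..π, B * z ^ e ≤ B * (d ^ (e+1) / (-(e+1))) := by
    rw [intervalIntegral.integral_const_mul]
    exact mul_le_mul_of_nonneg_left (integral_rpow_tail he hd hdpi) hB
  have i2 : ∫ z in d..π, |g z| ≤ B * (d ^ (e+1) / (-(e+1))) := by
    refine le_trans ?_ tail
    apply intervalIntegral.integral_mono_on hdpi (hgi _ _ (by linarith) (by linarith) (by linarith) (by linarith))
    · exact (rpow_intervalIntegrable hd hdpi).const_mul _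
    · intro z hz
      have hz0 : 0 < z := by linarith [hz.1]
      have := far z (by rw [abs_of_pos hz0]; exact hz.1) (by rw [abs_of_pos hz0]; linarith [hz.2])
      rwa [abs_of_pos hz0] at this
  have i3 : ∫ z in (-π)..(-d), |g z| ≤ B * (d ^ (e+1) / (-(e+1))) := by
    have e := intervalIntegral.integral_comp_neg (a := d) (b := π) (fun z => |g z|)
    rw [← e]
    refine le_trans ?_ tail
    apply intervalIntegral.integral_mono_on hdpi
    · have := (hgi (-d) (-π) (by linarith) (by linarith) (by linarith) (by linarith))
      rw [IntervalIntegrable.iff_comp_neg] at this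
      simpa using this
    · exact (rpow_intervalIntegrable hd hdpi).const_mul _
    · intro z hz
      have hz0 : 0 < z := by linarith [hz.1]
      have := far (-z) (by rw [abs_neg, abs_of_pos hz0]; exact hz.1) (by rw [abs_neg, abs_of_pos hz0]; linarith [hz.2])
      rwa [abs_neg, abs_of_pos hz0] at this
  refine (intervalIntegral.abs_integral_le_integral_abs (by linarith)).trans ?_
  rw [← intervalIntegral.integral_add_adjacent_intervals (hgi (-π) (-d) (by linarith) (by linarith) (by linarith) (by linarith))
      (hgi _ π (by linarith) (by linarith) (by linarith) (by linarith)),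
      ← intervalIntegral.integral_add_adjacent_intervals (hgi (-d) d (by linarith) (by linarith) (by linarith) (by linarith))
       (hgi _ π (by linarith) (by linarith) (by linarith) (by linarith))]
  linarith

lemma Kh_intervalIntegrable (h0 : 0 < α) (h1 : α < 1) (h a b : ℝ) :
    IntervalIntegrable (fun z => Kker α (z + h)) volume a b := by
  have := (Kker_intervalIntegrable h0 h1 (a + h) (b + h)).comp_add_right h
  simpa using this

/-- difference of the convolution as a weighted integral -/
lemma conv_diff (h0 : 0 < α) (h1 : α < 1) {f : ℝ → ℝ} (hf : Continuous f) (hp : Function.Periodic f (2 * π)) (x δ : ℝ) :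
    conv α f (x + δ) - conv α f x = ∫ z in (-π)..π, (Kker α (z + δ) - Kker α z) * (f (x - z) - f x) := by
  have hpi := Real.pi_pos
  have hcf : Continuous fun z => f (x - z) := by fun_prop
  have hi1 := Kh_intervalIntegrable h0 h1 δ (-π) π
  have hi2 := Kker_intervalIntegrable h0 h1 (-π) π
  have e1 : conv α f (x + δ) = ∫ z in (-π)..π, Kker α (z + δ) * f (x - z) := by
    rw [conv_sub hp]
    have hper : Function.Periodic (fun z => Kker α z * f (x + δ - z)) (2 * π) := by
      intro z
      simp only
      rw [(Kker_periodic α) z, ← hp (x + δ - (z + 2 * π))]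
      congr 2; ring
    have e := hper.intervalIntegral_add_eq (-π) (-π + δ)
    have e2 := intervalIntegral.integral_comp_add_right (a := -π) (b := π) (fun z => Kker α z * f (x + δ - z)) δ
    rw [show -π + 2 * π = π by ring, show -π + δ + 2 * π = π + δ by ring] at e
    rw [e, ← e2]
    congr 1; ext z; congr 2; ring
  have e0 : ∫ z in (-π)..π, (Kker α (z + δ) - Kker α z) = 0 := by
    rw [intervalIntegral.integral_sub hi1 hi2, intervalIntegral.integral_comp_add_right (fun z => Kker α z) δ]
    have e := (Kker_periodic α).intervalIntegral_add_eq (-π) (-π + δ)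
    rw [show -π + 2 * π = π by ring, show -π + δ + 2 * π = π + δ by ring] at e
    rw [e, sub_self]
  have e3 : ∫ z in (-π)..π, (Kker α (z + δ) - Kker α z) * (f (x - z) - f x)
      = (∫ z in (-π)..π, (Kker α (z + δ) * f (x - z) - Kker α z * f (x - z))) - ∫ z in (-π)..π, (Kker α (z + δ) - Kker α z) * f x := by
    rw [← intervalIntegral.integral_sub]
    · congr 1; ext z; ring
    · exact (hi1.mul_continuousOn hcf.continuousOn).sub (hi2.mul_continuousOn hcf.continuousOn)
    · exact (hi1.sub hi2).mul_const _
  rw [e3, intervalIntegral.integral_mul_const, e0, zero_mul, sub_zero,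
    intervalIntegral.integral_sub (hi1.mul_continuousOn hcf.continuousOn) (hi2.mul_continuousOn hcf.continuousOn), e1, conv_sub hp]

lemma near_bound (h0 : 0 < α) (h1 : α < 1) : ∃ C > 0, ∀ δ : ℝ, |δ| ≤ 1 →
    ∫ z in (-(2 * |δ|))..(2 * |δ|), |Kker α (z + δ) - Kker α z| ≤ C * |δ| ^ α := by
  obtain ⟨C2, hC2, hn⟩ := K_int_near h0 h1
  have hpi := Real.pi_gt_three
  refine ⟨2 * C2 * 3 ^ α, by positivity, fun h hh => ?_⟩
  set H := |h| with hHdef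
  have hH : 0 ≤ H := abs_nonneg h
  have hKi := Kker_intervalIntegrable h0 h1
  have hKh := Kh_intervalIntegrable h0 h1
  have j1 : ∫ z in (-(2 * H))..(2 * H), |Kker α (z + h)| ≤ C2 * (3 * H) ^ α := by
    rw [intervalIntegral.integral_comp_add_right (fun z => |Kker α z|) h]
    refine le_trans ?_ (hn (3 * H) (by positivity) (by linarith))
    apply intervalIntegral.integral_mono_interval
    · linarith [neg_abs_le h]
    · linarith
    · linarith [le_abs_self h]
    · exact Eventually.of_forall fun _ => abs_nonneg _
    · exact (hKi _ _).abs
  have j2 : ∫ z in (-(2 * H))..(2 * H), |Kker α z| ≤ C2 * (3 * H) ^ α := by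
    refine (hn (2 * H) (by positivity) (by linarith)).trans ?_
    gcongr; norm_num
  calc _ ≤ ∫ z in (-(2 * H))..(2 * H), (|Kker α (z + h)| + |Kker α z|) := by
        apply intervalIntegral.integral_mono_on (by linarith) ((hKh h _ _).sub (hKi _ _)).abs ((hKh h _ _).abs.add (hKi _ _).abs)
        intro z _; exact abs_sub _ _
    _ ≤ C2 * (3 * H) ^ α + C2 * (3 * H) ^ α := by
        rw [intervalIntegral.integral_add (hKh h _ _).abs (hKi _ _).abs]
        exact add_le_add j1 j2
    _ = _ := by rw [Real.mul_rpow (by norm_num) hH]; ring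

/-- Hölder gain, `α + β < 1` -/
lemma gain_low (h0 : 0 < α) (h1 : α < 1) {β : ℝ} (hβ : 0 < β) (hs : α + β < 1) :
    ∃ C > 0, ∀ (f : ℝ → ℝ) (M x δ : ℝ), Continuous f → Function.Periodic f (2 * π) → 0 ≤ M →
      (∀ z, |z| ≤ π → |f (x - z) - f x| ≤ M * |z| ^ β) → |δ| ≤ 1 →
      |conv α f (x + δ) - conv α f x| ≤ C * M * |δ| ^ (α + β) := by
  obtain ⟨C1, hC1, hb⟩ := K_diff_bound h0 h1
  obtain ⟨C2, hC2, hn⟩ := near_bound h0 h1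
  have hpi := Real.pi_gt_three
  have hs' : 0 < 1 - (α + β) := by linarith
  refine ⟨C2 * 2 ^ β + 2 * (C1 * (2 ^ (α + β - 1) / (1 - (α + β)))), by positivity, ?_⟩
  intro f M x δ hf hp hM hfb hδ
  rcases eq_or_ne δ 0 with rfl | hδ0
  · simp [Real.zero_rpow (by linarith : α + β ≠ 0)]
  have hH : 0 < |δ| := abs_pos.2 hδ0
  rw [conv_diff h0 h1 hf hp]
  have hcf : Continuous fun z => f (x - z) - f x := by fun_prop
  have hDi : ∀ a b : ℝ, IntervalIntegrable (fun z => Kker α (z + δ) - Kker α z) volume a b :=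
    fun a b => (Kh_intervalIntegrable h0 h1 δ a b).sub (Kker_intervalIntegrable h0 h1 a b)
  have := split_bound (e := α - 2 + β) (B := C1 * |δ| * M) (N := C2 * |δ| ^ α * (M * (2 * |δ|) ^ β)) (d := 2 * |δ|)
    (g := fun z => (Kker α (z + δ) - Kker α z) * (f (x - z) - f x)) (by linarith) (by positivity) (by linarith) (by positivity)
    ((hDi _ _).mul_continuousOn hcf.continuousOn)
    (by
      refine le_trans ?_ (mul_le_mul_of_nonneg_right (hn δ hδ) (by positivity))
      rw [← intervalIntegral.integral_mul_const]
      apply intervalIntegral.integral_mono_on (by linarith) ((hDi _ _).mul_continuousOn hcf.continuousOn).abs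
        ((hDi _ _).abs.mul_const _)
      intro z hz
      have hz' : |z| ≤ 2 * |δ| := abs_le.2 hz
      rw [abs_mul]
      refine mul_le_mul_of_nonneg_left ?_ (abs_nonneg _)
      refine (hfb z (by linarith)).trans ?_
      exact mul_le_mul_of_nonneg_left (Real.rpow_le_rpow (abs_nonneg _) hz' hβ.le) hM)
    (by
      intro z hz1 hz2
      have hz0 : 0 < |z| := by linarith
      rw [abs_mul]
      have k1 := hb z δ (abs_pos.1 hz0) hz2 (by linarith)
      have k2 := hfb z hz2
      refine (mul_le_mul k1 k2 (abs_nonneg _) (by positivity)).trans (le_of_eq ?_)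
      rw [Real.rpow_add hz0]; ring)
  refine this.trans (le_of_eq ?_)
  rw [show α - 2 + β + 1 = α + β - 1 by ring, Real.mul_rpow (by norm_num) hH.le, Real.mul_rpow (by norm_num) hH.le,
    Real.rpow_sub_one hH.ne', Real.rpow_add hH, show -(α + β - 1) = 1 - (α + β) by ring]
  field_simp

/-- Hölder gain, `1 < α + β` -/
lemma gain_high (h0 : 0 < α) (h1 : α < 1) {β : ℝ} (hβ : 0 < β) (hβ1 : β < 1) (hs : 1 < α + β) :
    ∃ C > 0, ∀ (f : ℝ → ℝ) (M x δ : ℝ), Continuous f → Function.Periodic f (2 * π) → 0 ≤ M →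
      (∀ z, |z| ≤ π → |f (x - z) - f x| ≤ M * |z| ^ β) → |δ| ≤ 1 →
      |conv α f (x + δ) - conv α f x - δ * ∫ z in (-π)..π, deriv (Kker α) z * (f (x - z) - f x)| ≤ C * M * |δ| ^ (α + β) := by
  obtain ⟨C1, hC1, hb⟩ := K_taylor_bound h0 h1
  obtain ⟨C2, hC2, hn⟩ := near_bound h0 h1
  obtain ⟨C3, hC3, hd⟩ := dK_bound h0 h1
  have hpi := Real.pi_gt_three
  have hs' : 0 < α + β - 1 := by linarith
  have hs2 : 0 < 2 - (α + β) := by linarith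
  have hdK : ∀ z, z ≠ 0 → |z| ≤ π → deriv (Kker α) z = dK α z := fun z hz hz' =>
    (Kker_hasDerivAt h0 (cos_lt_one_of hz (by linarith))).deriv
  refine ⟨C2 * 2 ^ β + C3 * (2 * (2 ^ (α + β - 1) / (α + β - 1))) + 2 * (C1 * (2 ^ (α + β - 2) / (2 - (α + β)))), by positivity, ?_⟩
  intro f M x δ hf hp hM hfb hδ
  rcases eq_or_ne δ 0 with rfl | hδ0
  · simp [Real.zero_rpow (by linarith : α + β ≠ 0)]
  have hH : 0 < |δ| := abs_pos.2 hδ0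
  rw [conv_diff h0 h1 hf hp]
  have hcf : Continuous fun z => f (x - z) - f x := by fun_prop
  have hDi : ∀ a b : ℝ, IntervalIntegrable (fun z => (Kker α (z + δ) - Kker α z) * (f (x - z) - f x)) volume a b :=
    fun a b => ((Kh_intervalIntegrable h0 h1 δ a b).sub (Kker_intervalIntegrable h0 h1 a b)).mul_continuousOn hcf.continuousOn
  have hEb : ∀ z, |z| ≤ π → |deriv (Kker α) z * (f (x - z) - f x)| ≤ C3 * M * |z| ^ (α - 2 + β) := by
    intro z hz
    rcases eq_or_ne z 0 with rfl | hz0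
    · simp; positivity
    have hz1 := abs_pos.2 hz0
    rw [abs_mul, hdK z hz0 hz]
    refine (mul_le_mul (hd z hz0 (by linarith)) (hfb z hz) (abs_nonneg _) (by positivity)).trans (le_of_eq ?_)
    rw [Real.rpow_add hz1]; ring
  have hEi : IntervalIntegrable (fun z => deriv (Kker α) z * (f (x - z) - f x)) volume (-π) π := by
    apply ((absrpow_intervalIntegrable (e := α - 2 + β) (by linarith) (-π) π).const_mul (C3 * M)).mono_fun
    · exact ((measurable_deriv _).mul hcf.measurable).aestronglyMeasurable
    · rw [EventuallyLE, ae_restrict_iff' measurableSet_uIoc]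
      refine Eventually.of_forall fun z hz => ?_
      rw [uIoc_of_le (by linarith)] at hz
      rw [Real.norm_eq_abs, Real.norm_eq_abs]
      exact (hEb z (abs_le.2 ⟨hz.1.le, hz.2⟩)).trans (le_abs_self _)
  have hEi' : IntervalIntegrable (fun z => deriv (Kker α) z * (f (x - z) - f x)) volume (-(2*|δ|)) (2*|δ|) := by
    apply hEi.mono_set
    rw [uIcc_of_le (by linarith), uIcc_of_le (by linarith)]
    exact Icc_subset_Icc (by linarith) (by linarith)
  rw [← intervalIntegral.integral_const_mul, ← intervalIntegral.integral_sub (hDi _ _) (hEi.const_mul _)]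
  have := split_bound (e := α - 3 + β) (B := C1 * |δ| ^ 2 * M)
    (N := C2 * |δ| ^ α * (M * (2 * |δ|) ^ β) + |δ| * (C3 * M * (2 * ((2 * |δ|) ^ (α - 2 + β + 1) / (α - 2 + β + 1))))) (d := 2 * |δ|)
    (g := fun z => (Kker α (z + δ) - Kker α z) * (f (x - z) - f x) - δ * (deriv (Kker α) z * (f (x - z) - f x)))
    (by linarith) (by positivity) (by linarith) (by positivity)
    ((hDi _ _).sub (hEi.const_mul _))
    (by
      rw [← integral_abs_rpow (by linarith) (by positivity)]
      refine le_trans ?_ (add_le_add_left (mul_le_mul_of_nonneg_right (hn δ hδ) (by positivity)) _)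
      rw [← intervalIntegral.integral_mul_const, ← intervalIntegral.integral_const_mul, ← intervalIntegral.integral_const_mul,
       ← intervalIntegral.integral_add]
      rotate_left
      · exact ((Kh_intervalIntegrable h0 h1 δ _ _).sub (Kker_intervalIntegrable h0 h1 _ _)).abs.mul_const _
      · exact ((absrpow_intervalIntegrable (by linarith) _ _).const_mul _).const_mul _
      apply intervalIntegral.integral_mono_on (by linarith) ((hDi _ _).sub (hEi'.const_mul _)).abs
      · exact (((Kh_intervalIntegrable h0 h1 δ _ _).sub (Kker_intervalIntegrable h0 h1 _ _)).abs.mul_const _).add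
         (((absrpow_intervalIntegrable (by linarith) _ _).const_mul _).const_mul _)
      intro z hz
      have hz' : |z| ≤ 2 * |δ| := abs_le.2 hz
      refine (abs_sub _ _).trans (add_le_add ?_ ?_)
      · rw [abs_mul]
        refine mul_le_mul_of_nonneg_left ?_ (abs_nonneg _)
        refine (hfb z (by linarith)).trans ?_
        exact mul_le_mul_of_nonneg_left (Real.rpow_le_rpow (abs_nonneg _) hz' hβ.le) hM
      · rw [abs_mul]
        exact mul_le_mul_of_nonneg_left (hEb z (by linarith)) (abs_nonneg _))
    (by
      intro z hz1 hz2
      have hz0 : 0 < |z| := by linarith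
      rw [hdK z (abs_pos.1 hz0) hz2, ← mul_assoc, ← sub_mul, abs_mul]
      have k1 := hb z δ (abs_pos.1 hz0) hz2 (by linarith)
      have k2 := hfb z hz2
      refine (mul_le_mul k1 k2 (abs_nonneg _) (by positivity)).trans (le_of_eq ?_)
      rw [Real.rpow_add hz0]; ring)
  refine this.trans (le_of_eq ?_)
  rw [show α - 2 + β + 1 = α + β - 1 by ring, show α - 3 + β + 1 = α + β - 2 by ring,
    Real.mul_rpow (by norm_num) hH.le, Real.mul_rpow (by norm_num) hH.le, Real.mul_rpow (by norm_num) hH.le,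
    Real.rpow_sub_one hH.ne', Real.rpow_sub hH (α + β) 2, Real.rpow_add hH, show -(α + β - 2) = 2 - (α + β) by ring]
  norm_cast
  field_simp
end


section
variable {α : ℝ}

lemma periodic_continuous_of_window {f : ℝ → ℝ} {x0 : ℝ} (hp : Function.Periodic f (2 * π))
    (hc : ContinuousOn f (Ioo (x0 - 5) (x0 + 5))) : Continuous f := by
  have hpi := Real.pi_gt_three
  have hpi2 := Real.pi_lt_four
  rw [continuous_iff_continuousAt]
  intro x
  set n : ℤ := ⌊(x - x0 + π) / (2 * π)⌋ with hn
  have a1 := Int.floor_le ((x - x0 + π) / (2 * π))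
  have a2 := Int.lt_floor_add_one ((x - x0 + π) / (2 * π))
  rw [← hn, le_div_iff₀ (by positivity)] at a1
  rw [← hn, div_lt_iff₀ (by positivity)] at a2
  have hmem : x - n * (2 * π) ∈ Ioo (x0 - 5) (x0 + 5) := by
    constructor <;> nlinarith
  have h1 : ContinuousAt f (x - n * (2 * π)) := hc.continuousAt (Ioo_mem_nhds hmem.1 hmem.2)
  have h2 : ContinuousAt (fun y => f (y - n * (2 * π))) x := by
    apply ContinuousAt.comp (f := fun y => y - n * (2 * π)) h1
    fun_prop
  have h3 : (fun y => f (y - n * (2 * π))) = f := by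
    ext y; exact hp.sub_int_mul_eq n
  rwa [h3] at h2

lemma Lk_zero_of {k : ℕ} {β a b : ℝ} (hβ : 0 < β) (hβ1 : β ≤ 1) {f : ℝ → ℝ} (h : Lk k β f a b) : Lk 0 β f a b := by
  induction k with
  | zero => exact h
  | succ k ih => exact ih (Lk_down hβ hβ1 h)

lemma periodic_deriv {f : ℝ → ℝ} (hp : Function.Periodic f (2 * π)) : Function.Periodic (deriv f) (2 * π) := by
  intro x
  rw [← deriv_comp_add_const]
  congr 1; ext y; exact hp y

lemma conv_hasDerivAt (h0 : 0 < α) (h1 : α < 1) {k : ℕ} {β x0 : ℝ} (hβ : 0 < β) (hβ1 : β ≤ 1) {f : ℝ → ℝ}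
    (hp : Function.Periodic f (2 * π)) (h : Lk (k+1) β f (x0 - 5) (x0 + 5)) {x : ℝ} (hx : x ∈ Ioo (x0 - 1/2) (x0 + 1/2)) :
    HasDerivAt (conv α f) (conv α (deriv f) x) x := by
  have hpi := Real.pi_gt_three
  have hpi2 := Real.pi_lt_four
  have hL0 : Lk 0 β (deriv f) (x0 - 5) (x0 + 5) := Lk_zero_of hβ hβ1 h.2
  have hfc : Continuous f := periodic_continuous_of_window hp (Lk0_continuousOn hβ (Lk_zero_of hβ hβ1 h))
  have hdc : Continuous (deriv f) := periodic_continuous_of_window (periodic_deriv hp) (Lk0_continuousOn hβ hL0)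
  obtain ⟨M, hM, hMb⟩ := Lk0_bounded hβ hL0
  have e : conv α f = fun x => ∫ z in (-π)..π, Kker α z * f (x - z) := by ext x; exact conv_sub hp x
  rw [e, conv_sub (periodic_deriv hp)]
  have hKm := Kker_measurable h0
  refine (intervalIntegral.hasDerivAt_integral_of_dominated_loc_of_deriv_le (F := fun x z => Kker α z * f (x - z))
    (F' := fun x z => Kker α z * deriv f (x - z)) (bound := fun z => |Kker α z| * M) (s := Ioo (x0 - 1/2) (x0 + 1/2))
    (Ioo_mem_nhds hx.1 hx.2) ?_ ?_ ?_ ?_ ?_ ?_).2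
  · refine Eventually.of_forall fun x => ?_
    exact (hKm.mul (by fun_prop : Continuous fun z => f (x - z)).measurable).aestronglyMeasurable
  · exact (Kker_intervalIntegrable h0 h1 _ _).mul_continuousOn (by fun_prop : Continuous fun z => f (x - z)).continuousOn
  · exact (hKm.mul (by fun_prop : Continuous fun z => deriv f (x - z)).measurable).aestronglyMeasurable
  · refine Eventually.of_forall fun z hz y hy => ?_
    rw [uIoc_of_le (by linarith)] at hz
    rw [Real.norm_eq_abs, abs_mul]
    refine mul_le_mul_of_nonneg_left (hMb _ ?_) (abs_nonneg _)
    constructor <;> linarith [hz.1, hz.2, hy.1, hy.2]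
  · exact (Kker_intervalIntegrable h0 h1 _ _).abs.mul_const _
  · refine Eventually.of_forall fun z hz y hy => ?_
    rw [uIoc_of_le (by linarith)] at hz
    have hd : DifferentiableAt ℝ f (y - z) := h.1 _ (by constructor <;> linarith [hz.1, hz.2, hy.1, hy.2])
    have := hd.hasDerivAt.comp_sub_const y z
    exact this.const_mul _

lemma gain_step (h0 : 0 < α) (h1 : α < 1) {k : ℕ} {β x0 : ℝ} (hβ : 0 < β) (hβ1 : β < 1) : ∀ {f : ℝ → ℝ},
    Function.Periodic f (2 * π) → Lk k β f (x0 - 5) (x0 + 5) →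
    (α + β < 1 → Lk k (α + β) (conv α f) (x0 - 1/2) (x0 + 1/2)) ∧
    (1 < α + β → Lk (k+1) (α + β - 1) (conv α f) (x0 - 1/2) (x0 + 1/2)) := by
  have hpi := Real.pi_gt_three
  have hpi2 := Real.pi_lt_four
  induction k with
  | zero =>
    intro f hp h
    have hfc : Continuous f := periodic_continuous_of_window hp (Lk0_continuousOn hβ h)
    obtain ⟨C, hC⟩ := h
    have hfb : ∀ x ∈ Ioo (x0 - 1/2) (x0 + 1/2), ∀ z, |z| ≤ π → |f (x - z) - f x| ≤ |C| * |z| ^ β := by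
      intro x hx z hz
      have hz' := abs_le.1 hz
      refine (hC (x - z) (by constructor <;> linarith [hx.1, hx.2]) x (by constructor <;> linarith [hx.1, hx.2])).trans ?_
      rw [show x - z - x = -z by ring, abs_neg]
      exact mul_le_mul_of_nonneg_right (le_abs_self C) (by positivity)
    constructor
    · intro hs
      obtain ⟨G, hG, hg⟩ := gain_low h0 h1 hβ hs
      refine ⟨G * |C|, fun x hx y hy => ?_⟩
      have := hg f |C| y (x - y) hfc hp (abs_nonneg _) (hfb y hy)
        (abs_le.2 ⟨by linarith [hx.1, hx.2, hy.1, hy.2], by linarith [hx.1, hx.2, hy.1, hy.2]⟩)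
      rwa [add_sub_cancel] at this
    · intro hs
      obtain ⟨G, hG, hg⟩ := gain_high h0 h1 hβ hβ1 hs
      set D : ℝ → ℝ := fun x => ∫ z in (-π)..π, deriv (Kker α) z * (f (x - z) - f x) with hD
      have key : ∀ x ∈ Ioo (x0 - 1/2) (x0 + 1/2), ∀ δ, |δ| ≤ 1 →
          |conv α f (x + δ) - conv α f x - δ * D x| ≤ G * |C| * |δ| ^ (α + β) := fun x hx δ hδ =>
        hg f |C| x δ hfc hp (abs_nonneg _) (hfb x hx) hδ
      have hder : ∀ x ∈ Ioo (x0 - 1/2) (x0 + 1/2), HasDerivAt (conv α f) (D x) x := by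
        intro x hx
        rw [hasDerivAt_iff_isLittleO_nhds_zero]
        have hO : (fun h => conv α f (x + h) - conv α f x - h • D x) =O[𝓝 0] fun h : ℝ => |h| ^ (α + β) := by
          apply Asymptotics.IsBigO.of_bound (G * |C|)
          have : ∀ᶠ h : ℝ in 𝓝 0, |h| < 1 := by
            have := Metric.ball_mem_nhds (0:ℝ) one_pos
            filter_upwards [this] with h hh
            simpa using hh
          filter_upwards [this] with h hh
          rw [Real.norm_eq_abs, Real.norm_eq_abs, abs_of_nonneg (by positivity : 0 ≤ |h| ^ (α + β))]
          exact key x hx h hh.le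
        refine hO.trans_isLittleO ?_
        rw [Asymptotics.isLittleO_iff]
        intro ε hε
        have ht : Tendsto (fun h : ℝ => |h| ^ (α + β - 1)) (𝓝 0) (𝓝 0) := by
          have : ContinuousAt (fun h : ℝ => |h| ^ (α + β - 1)) 0 := by
            apply ContinuousAt.rpow_const continuous_abs.continuousAt
            right; linarith
          have h2 := this.tendsto
          simpa [Real.zero_rpow (by linarith : α + β - 1 ≠ 0)] using h2
        filter_upwards [ht.eventually (gt_mem_nhds hε)] with h hh
        rw [Real.norm_eq_abs, Real.norm_eq_abs, abs_of_nonneg (by positivity : 0 ≤ |h| ^ (α + β))]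
        rcases eq_or_ne h 0 with rfl | hh0
        · simp [Real.zero_rpow (by linarith : α + β ≠ 0)]
        have hpos := abs_pos.2 hh0
        rw [Real.rpow_sub_one hpos.ne', div_lt_iff₀ hpos] at hh
        exact hh.le
      refine ⟨fun x hx => (hder x hx).differentiableAt, Lk_congr (f := D) (fun x hx => (hder x hx).deriv.symm) ?_⟩
      refine ⟨2 * (G * |C|), fun x hx y hy => ?_⟩
      rcases eq_or_ne x y with rfl | hxy
      · simp [Real.zero_rpow (by linarith : α + β - 1 ≠ 0)]
      have hpos : 0 < |x - y| := abs_pos.2 (sub_ne_zero.2 hxy)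
      have hle : |x - y| ≤ 1 := (abs_le.2 ⟨by linarith [hx.1, hx.2, hy.1, hy.2], by linarith [hx.1, hx.2, hy.1, hy.2]⟩)
      have k1 := key y hy (x - y) hle
      have k2 := key x hx (y - x) (by rwa [abs_sub_comm])
      rw [add_sub_cancel] at k1 k2
      rw [abs_sub_comm y x] at k2
      have k3 : |x - y| * |D x - D y| ≤ 2 * (G * |C|) * |x - y| ^ (α + β) := by
        rw [← abs_mul]
        rw [abs_le] at k1 k2 ⊢
        constructor <;> linarith [k1.1, k1.2, k2.1, k2.2]
      rw [Real.rpow_sub_one hpos.ne', ← mul_div_assoc, le_div_iff₀ hpos]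
      linarith
  | succ k ih =>
    intro f hp h
    obtain ⟨i1, i2⟩ := ih (periodic_deriv hp) h.2
    have hd := fun x hx => conv_hasDerivAt h0 h1 hβ hβ1.le hp h (x := x) hx
    constructor
    · intro hs
      exact ⟨fun x hx => (hd x hx).differentiableAt, Lk_congr (fun x hx => (hd x hx).deriv.symm) (i1 hs)⟩
    · intro hs
      exact ⟨fun x hx => (hd x hx).differentiableAt, Lk_congr (fun x hx => (hd x hx).deriv.symm) (i2 hs)⟩

lemma Lk_glue {k : ℕ} {β a b c d : ℝ} (hβ : 0 < β) (hab : a < b) (hbc : b < c) (hcd : c < d) : ∀ {f : ℝ → ℝ},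
    Lk k β f a c → Lk k β f b d → Lk k β f a d := by
  induction k with
  | zero =>
    rintro f ⟨C, hC⟩ ⟨C', hC'⟩
    set m := (b + c) / 2 with hm
    have main : ∀ x ∈ Ioo a d, ∀ y ∈ Ioo a d, x ≤ y → |f x - f y| ≤ (|C| + |C'|) * |x - y| ^ β := by
      intro x hx y hy hxy
      have hp1 : 0 ≤ |x - y| ^ β := by positivity
      by_cases h1 : y < c
      · refine (hC x ⟨hx.1, by linarith⟩ y ⟨hy.1, h1⟩).trans (mul_le_mul_of_nonneg_right ?_ hp1)
        linarith [le_abs_self C, abs_nonneg C']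
      by_cases h2 : b < x
      · refine (hC' x ⟨h2, hx.2⟩ y ⟨by linarith, hy.2⟩).trans (mul_le_mul_of_nonneg_right ?_ hp1)
        linarith [le_abs_self C', abs_nonneg C]
      push Not at h1 h2
      have k1 := hC x ⟨hx.1, by linarith⟩ m ⟨by linarith, by linarith⟩
      have k2 := hC' m ⟨by linarith, by linarith⟩ y ⟨by linarith, hy.2⟩
      have l1 : |x - m| ^ β ≤ |x - y| ^ β := by
        apply Real.rpow_le_rpow (abs_nonneg _) _ hβ.le
        rw [abs_of_nonpos (by linarith), abs_of_nonpos (by linarith)]; linarith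
      have l2 : |m - y| ^ β ≤ |x - y| ^ β := by
        apply Real.rpow_le_rpow (abs_nonneg _) _ hβ.le
        rw [abs_of_nonpos (by linarith), abs_of_nonpos (by linarith)]; linarith
      have m1 : C * |x - m| ^ β ≤ |C| * |x - y| ^ β := mul_le_mul (le_abs_self C) l1 (by positivity) (abs_nonneg _)
      have m2 : C' * |m - y| ^ β ≤ |C'| * |x - y| ^ β := mul_le_mul (le_abs_self C') l2 (by positivity) (abs_nonneg _)
      have := abs_sub_le (f x) (f m) (f y)
      linarith
    refine ⟨|C| + |C'|, fun x hx y hy => ?_⟩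
    rcases le_total x y with h | h
    · exact main x hx y hy h
    · rw [abs_sub_comm, abs_sub_comm x y]; exact main y hy x hx h
  | succ k ih =>
    rintro f ⟨h1, h2⟩ ⟨h3, h4⟩
    refine ⟨fun x hx => ?_, ih h2 h4⟩
    by_cases h : x < c
    · exact h1 x ⟨hx.1, h⟩
    · exact h3 x ⟨by linarith, hx.2⟩

/-- Convolution with a smooth kernel on an interval is smooth. -/
lemma smooth_conv {g : ℝ → ℝ} (hg : Continuous g) (n : ℕ) : ∀ {L : ℝ → ℝ}, ContDiff ℝ (⊤ : ℕ∞) L →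
    ContDiff ℝ n (fun x => ∫ y in (-π)..π, L (x - y) * g y) := by
  have hpi := Real.pi_pos
  have hd : ∀ {L : ℝ → ℝ}, ContDiff ℝ (⊤ : ℕ∞) L → ∀ x, HasDerivAt (fun x => ∫ y in (-π)..π, L (x - y) * g y)
      (∫ y in (-π)..π, deriv L (x - y) * g y) x := by
    intro L hL x
    have hLd : Continuous (deriv L) := (contDiff_iff_contDiffAt.2 fun x => contDiffAt_deriv_top hL.contDiffAt).continuous
    have hLc := hL.continuous
    have hK : IsCompact (Icc (x - 1 - π) (x + 1 + π)) := isCompact_Icc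
    obtain ⟨M, hM⟩ := hK.exists_bound_of_continuousOn hLd.continuousOn
    refine (intervalIntegral.hasDerivAt_integral_of_dominated_loc_of_deriv_le (F := fun x y => L (x - y) * g y)
      (F' := fun x y => deriv L (x - y) * g y) (bound := fun y => M * |g y|) (s := Ioo (x - 1) (x + 1))
      (Ioo_mem_nhds (by linarith) (by linarith)) ?_ ?_ ?_ ?_ ?_ ?_).2
    · exact Eventually.of_forall fun x => (by fun_prop : Continuous fun y => L (x - y) * g y).aestronglyMeasurable
    · exact (by fun_prop : Continuous fun y => L (x - y) * g y).intervalIntegrable _ _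
    · exact (by fun_prop : Continuous fun y => deriv L (x - y) * g y).aestronglyMeasurable
    · refine Eventually.of_forall fun y hy z hz => ?_
      rw [uIoc_of_le (by linarith)] at hy
      rw [Real.norm_eq_abs, abs_mul]
      refine mul_le_mul_of_nonneg_right (hM _ ?_) (abs_nonneg _)
      constructor <;> linarith [hz.1, hz.2, hy.1, hy.2]
    · exact (by fun_prop : Continuous fun y => M * |g y|).intervalIntegrable _ _
    · refine Eventually.of_forall fun y hy z hz => ?_
      have := ((hL.differentiable (by simp)) (z - y)).hasDerivAt.comp_sub_const z y
      exact this.mul_const _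
  induction n with
  | zero =>
    intro L hL
    have : Continuous (fun x => ∫ y in (-π)..π, L (x - y) * g y) :=
      continuous_iff_continuousAt.2 fun x => (hd hL x).continuousAt
    exact_mod_cast contDiff_zero.2 this
  | succ n ih =>
    intro L hL
    have := (contDiff_succ_iff_deriv (𝕜 := ℝ) (n := n) (f := fun x => ∫ y in (-π)..π, L (x - y) * g y)).2
      ⟨fun x => (hd hL x).differentiableAt, by simp, by
        have e : deriv (fun x => ∫ y in (-π)..π, L (x - y) * g y) = fun x => ∫ y in (-π)..π, deriv L (x - y) * g y := by
          ext x; exact (hd hL x).deriv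
        rw [e]
        exact ih (contDiff_iff_contDiffAt.2 fun x => contDiffAt_deriv_top hL.contDiffAt)⟩
    exact_mod_cast this
end


section
variable {α : ℝ}

noncomputable def cut (r R z : ℝ) : ℝ := Real.smoothTransition ((Real.cos z - Real.cos R) / (Real.cos r - Real.cos R))

lemma cut_contDiff (r R : ℝ) : ContDiff ℝ (⊤ : ℕ∞) (cut r R) := by
  unfold cut
  apply Real.smoothTransition.contDiff.comp
  exact (Real.contDiff_cos.sub contDiff_const).div_const _

lemma cut_periodic (r R : ℝ) : Function.Periodic (cut r R) (2 * π) := by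
  intro z; unfold cut; rw [Real.cos_add_two_pi]

lemma cut_one {r R z : ℝ} (h : Real.cos R < Real.cos r) (hz : Real.cos r ≤ Real.cos z) : cut r R z = 1 := by
  unfold cut
  apply Real.smoothTransition.one_of_one_le
  rw [le_div_iff₀ (by linarith)]; linarith

lemma cut_zero {r R z : ℝ} (h : Real.cos R < Real.cos r) (hz : Real.cos z ≤ Real.cos R) : cut r R z = 0 := by
  unfold cut
  apply Real.smoothTransition.zero_of_nonpos
  exact div_nonpos_of_nonpos_of_nonneg (by linarith) (by linarith)

lemma cos_le_of_abs {x y : ℝ} (hx : |x| ≤ |y|) (hy : |y| ≤ π) : Real.cos y ≤ Real.cos x := by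
  rw [← Real.cos_abs x, ← Real.cos_abs y]
  exact Real.cos_le_cos_of_nonneg_of_le_pi (abs_nonneg _) hy hx

lemma periodic_flip {L g : ℝ → ℝ} (hL : Function.Periodic L (2 * π)) (hg : Function.Periodic g (2 * π)) (x : ℝ) :
    ∫ y in (-π)..π, L (x - y) * g y = ∫ z in (-π)..π, L z * g (x - z) := by
  have hper : Function.Periodic (fun y => L (x - y) * g y) (2 * π) := by
    intro y
    simp only
    rw [hg y]
    congr 1
    rw [← hL (x - (y + 2 * π))]; congr 1; ring
  have h1 := hper.intervalIntegral_add_eq (-π) (x - π)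
  have := intervalIntegral.integral_comp_sub_left (a := -π) (b := π) (fun y => L (x - y) * g y) x
  simp only [sub_sub_cancel] at this
  rw [this, show x - -π = x - π + 2 * π by ring, ← h1]; congr 1; ring

lemma farK_contDiff (h0 : 0 < α) {r R : ℝ} (hr : 0 < r) (hR : r < R) (hpi : R ≤ π) :
    ContDiff ℝ (⊤ : ℕ∞) (fun z => (1 - cut r R z) * Kker α z) := by
  have hc : Real.cos R < Real.cos r := Real.cos_lt_cos_of_nonneg_of_le_pi hr.le hpi hR
  have hc1 : Real.cos r < 1 := by
    rw [← Real.cos_zero]; exact Real.cos_lt_cos_of_nonneg_of_le_pi le_rfl (by linarith) hr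
  rw [contDiff_iff_contDiffAt]
  intro z
  by_cases hz : Real.cos z < 1
  · exact (contDiffAt_const.sub (cut_contDiff r R).contDiffAt).mul (Kker_contDiffAt h0 hz)
  · have hz1 : Real.cos r < Real.cos z := by linarith
    have : (fun z => (1 - cut r R z) * Kker α z) =ᶠ[𝓝 z] fun _ => 0 := by
      filter_upwards [Real.continuous_cos.continuousAt.eventually (lt_mem_nhds hz1)] with y hy
      rw [cut_one hc hy.le]; simp
    exact contDiffAt_const.congr_of_eventuallyEq this

lemma local_gain (h0 : 0 < α) (h1 : α < 1) {k : ℕ} {β x0 ρ : ℝ} (hβ : 0 < β) (hβ1 : β < 1) {ψ : ℝ → ℝ}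
    (hψc : Continuous ψ) (hψp : Function.Periodic ψ (2 * π)) (hρ : 0 < ρ) (hρ1 : ρ ≤ 1)
    (h : Lk k β ψ (x0 - ρ) (x0 + ρ)) :
    (α + β < 1 → Lk k (α + β) (conv α ψ) (x0 - ρ/8) (x0 + ρ/8)) ∧
    (1 < α + β → Lk (k+1) (α + β - 1) (conv α ψ) (x0 - ρ/8) (x0 + ρ/8)) := by
  have hpi := Real.pi_gt_three
  have hpi2 := Real.pi_lt_four
  have hc1 : Real.cos (ρ/2) < Real.cos (ρ/4) := Real.cos_lt_cos_of_nonneg_of_le_pi (by linarith) (by linarith) (by linarith)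
  have hc2 : Real.cos (ρ/16) < Real.cos (ρ/32) := Real.cos_lt_cos_of_nonneg_of_le_pi (by linarith) (by linarith) (by linarith)
  set χ : ℝ → ℝ := fun y => cut (ρ/4) (ρ/2) (y - x0) with hχ
  have hχs : ContDiff ℝ (⊤ : ℕ∞) χ := (cut_contDiff _ _).comp (contDiff_id.sub contDiff_const)
  have hχc := hχs.continuous
  have hχp : Function.Periodic χ (2 * π) := by
    intro y; simp only [hχ]
    rw [show y + 2 * π - x0 = y - x0 + 2 * π by ring, cut_periodic]
  set f : ℝ → ℝ := fun y => χ y * ψ y with hf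
  set g : ℝ → ℝ := fun y => (1 - χ y) * ψ y with hg
  have hfc : Continuous f := hχc.mul hψc
  have hgc : Continuous g := (continuous_const.sub hχc).mul hψc
  have hfp : Function.Periodic f (2 * π) := by intro y; simp only [hf]; rw [hχp, hψp]
  have hgp : Function.Periodic g (2 * π) := by intro y; simp only [hg]; rw [hχp, hψp]
  have hmid : Lk k β f (x0 - ρ) (x0 + ρ) := Lk_mul hβ hβ1.le (Lk_smooth hβ hβ1.le fun x _ => hχs.contDiffAt) h
  have hzero : ∀ a b, Lk k β (fun _ => (0:ℝ)) a b := fun a b => Lk_smooth hβ hβ1.le fun x _ => contDiffAt_const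
  have hright : Lk k β f (x0 + ρ/2) (x0 + 5) := by
    refine Lk_congr (fun y hy => ?_) (hzero _ _)
    simp only [hf, hχ]
    rw [cut_zero hc1, zero_mul]
    by_cases h3 : y - x0 ≤ π
    · exact Real.cos_le_cos_of_nonneg_of_le_pi (by linarith) h3 (by linarith [hy.1])
    · rw [← Real.cos_neg (y - x0), ← Real.cos_add_two_pi (-(y - x0))]
      exact Real.cos_le_cos_of_nonneg_of_le_pi (by linarith) (by linarith) (by linarith [hy.2])
  have hleft : Lk k β f (x0 - 5) (x0 - ρ/2) := by
    refine Lk_congr (fun y hy => ?_) (hzero _ _)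
    simp only [hf, hχ]
    rw [cut_zero hc1, zero_mul]
    by_cases h3 : -(y - x0) ≤ π
    · rw [← Real.cos_neg (y - x0)]
      exact Real.cos_le_cos_of_nonneg_of_le_pi (by linarith) h3 (by linarith [hy.2])
    · rw [← Real.cos_add_two_pi ((y - x0))]
      exact Real.cos_le_cos_of_nonneg_of_le_pi (by linarith) (by linarith) (by linarith [hy.1])
  have hwin : Lk k β f (x0 - 5) (x0 + 5) :=
    Lk_glue hβ (by linarith) (by linarith) (by linarith) hleft
      (Lk_glue hβ (by linarith) (by linarith) (by linarith) hmid hright)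
  obtain ⟨g1, g2⟩ := gain_step h0 h1 hβ hβ1 hfp hwin
  set L : ℝ → ℝ := fun z => (1 - cut (ρ/32) (ρ/16) z) * Kker α z with hL
  have hLs : ContDiff ℝ (⊤ : ℕ∞) L := farK_contDiff h0 (by linarith) (by linarith) (by linarith)
  have hLp : Function.Periodic L (2 * π) := by
    intro y; simp only [hL]; rw [cut_periodic, Kker_periodic α]
  set w : ℝ → ℝ := fun x => ∫ y in (-π)..π, L (x - y) * g y with hw
  have hws : ContDiff ℝ (⊤ : ℕ∞) w := contDiff_infty.2 fun n => smooth_conv hgc n hLs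
  have hgw : ∀ x ∈ Ioo (x0 - ρ/8) (x0 + ρ/8), conv α g x = w x := by
    intro x hx
    simp only [hw]
    rw [conv_sub hgp, periodic_flip hLp hgp]
    apply intervalIntegral.integral_congr
    intro z hz
    rw [uIcc_of_le (by linarith)] at hz
    have hzpi : |z| ≤ π := abs_le.2 hz
    simp only [hL]
    by_cases h3 : ρ/16 ≤ |z|
    · rw [cut_zero hc2]; · ring
      exact cos_le_of_abs (by rwa [abs_of_pos (by linarith)]) hzpi
    · push Not at h3
      have : g (x - z) = 0 := by
        simp only [hg, hχ]
        rw [cut_one hc1]; · ring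
        rw [abs_lt] at h3
        apply cos_le_of_abs
        · rw [abs_of_pos (by linarith : 0 < ρ/4), abs_le]
          constructor <;> linarith [hx.1, hx.2]
        · rw [abs_of_pos (by linarith : 0 < ρ/4)]; linarith
      rw [this]; ring
  have hsum : ∀ x, conv α ψ x = conv α f x + conv α g x := by
    intro x
    unfold conv
    rw [← intervalIntegral.integral_add (KK_intervalIntegrable h0 h1 hfc x _ _) (KK_intervalIntegrable h0 h1 hgc x _ _)]
    congr 1; ext y; simp only [hf, hg]; ring
  have fin : ∀ {k : ℕ} {s : ℝ}, 0 < s → s ≤ 1 → Lk k s (conv α f) (x0 - 1/2) (x0 + 1/2) →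
      Lk k s (conv α ψ) (x0 - ρ/8) (x0 + ρ/8) := by
    intro k s hs hs1 hl
    refine Lk_congr (f := fun x => conv α f x + w x) (fun x hx => ?_) ?_
    · rw [hsum, hgw x hx]
    · exact Lk_add (Lk_mono (by linarith) (by linarith) hl) (Lk_smooth hs hs1 fun x _ => hws.contDiffAt)
  exact ⟨fun hs => fin (by linarith) hs.le (g1 hs), fun hs => fin (by linarith) (by linarith) (g2 hs)⟩

lemma Prof.recover {p c : ℝ} {ψ : ℝ → ℝ} (P : Prof α p c ψ) {x0 : ℝ} (hne : ψ x0 ≠ 0) (hlt : |ψ x0| < 1)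
    {k : ℕ} {β ρ : ℝ} (hβ : 0 < β) (hβ1 : β ≤ 1) (hρ : 0 < ρ) (h : Lk k β (conv α ψ) (x0 - ρ) (x0 + ρ)) :
    ∃ ρ', 0 < ρ' ∧ ρ' ≤ 1 ∧ Lk k β ψ (x0 - ρ') (x0 + ρ') := by
  have hc := P.hc
  obtain ⟨s1, s2, h1, h2, h3⟩ : ∃ s1 s2, s1 < ψ x0 ∧ ψ x0 < s2 ∧ ∀ s, s1 ≤ s → s ≤ s2 → s ≠ 0 ∧ |s| < 1 := by
    rw [abs_lt] at hlt
    rcases lt_or_gt_of_ne hne with hn | hn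
    · refine ⟨(ψ x0 - 1)/2, ψ x0 / 2, by linarith, by linarith, fun s a b => ⟨by linarith, abs_lt.2 ⟨by linarith, by linarith⟩⟩⟩
    · refine ⟨ψ x0 / 2, (ψ x0 + 1)/2, by linarith, by linarith, fun s a b => ⟨by linarith, abs_lt.2 ⟨by linarith, by linarith⟩⟩⟩
  have hev : ∀ᶠ x in 𝓝 x0, s1 < ψ x ∧ ψ x < s2 :=
    (P.sym.cont.continuousAt.eventually (lt_mem_nhds h1)).and (P.sym.cont.continuousAt.eventually (gt_mem_nhds h2))
  obtain ⟨ε, hε, hb⟩ := Metric.eventually_nhds_iff.1 hev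
  have hmin : 0 < min (min ε ρ) 1 := by positivity
  refine ⟨min (min ε ρ) 1, hmin, min_le_right _ _, ?_⟩
  have m1 : min (min ε ρ) 1 ≤ ε := (min_le_left _ _).trans (min_le_left _ _)
  have m2 : min (min ε ρ) 1 ≤ ρ := (min_le_left _ _).trans (min_le_right _ _)
  generalize min (min ε ρ) 1 = r at *
  have hl : Lk k β (fun x => c⁻¹ * conv α ψ x) (x0 - r) (x0 + r) :=
    Lk_mul hβ hβ1 (Lk_smooth hβ hβ1 fun x _ => contDiffAt_const) (Lk_mono (by linarith) (by linarith) h)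
  have hgt : ∀ x, c⁻¹ * conv α ψ x = gt p (ψ x) := by
    intro x; rw [P.eq]; field_simp
  have := Lk_comp (G := Gi p) (m := gt p s1) (M := gt p s2) hβ hβ1 (by
      intro v hv
      obtain ⟨a1, a2⟩ := hv
      rw [← gt_Gi P.hp v] at a1 a2 ⊢
      obtain ⟨b1, b2⟩ := h3 (Gi p v) ((gt_strictMono P.hp).le_iff_le.1 a1) ((gt_strictMono P.hp).le_iff_le.1 a2)
      exact Gi_contDiffAt P.hp b1 b2)
    (by
      intro x hx
      rw [hgt]
      obtain ⟨b1, b2⟩ := hb (y := x) (by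
        rw [Real.dist_eq, abs_lt]; constructor <;> linarith [hx.1, hx.2])
      exact ⟨(gt_strictMono P.hp).monotone b1.le, (gt_strictMono P.hp).monotone b2.le⟩) hl
  refine Lk_congr (fun x _ => ?_) this
  simp only [hgt, Gi_gt P.hp]

lemma Prof.smooth {p c : ℝ} {ψ : ℝ → ℝ} (P : Prof α p c ψ) {x0 : ℝ} (hne : ψ x0 ≠ 0) (hlt : |ψ x0| < 1) :
    ContDiffAt ℝ (⊤ : ℕ∞) ψ x0 := by
  have h0 := P.h0
  have h1 := P.h1
  set Q : ℕ → ℝ → Prop := fun k β => ∃ ρ, 0 < ρ ∧ ρ ≤ 1 ∧ Lk k β ψ (x0 - ρ) (x0 + ρ) with hQ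
  have step : ∀ k β, 0 < β → β < 1 → Q k β → (α + β < 1 → Q k (α + β)) ∧ (1 < α + β → Q (k+1) (α + β - 1)) := by
    rintro k β hβ hβ1 ⟨ρ, hρ, hρ1, hl⟩
    obtain ⟨g1, g2⟩ := local_gain h0 h1 hβ hβ1 P.sym.cont P.sym.periodic hρ hρ1 hl
    exact ⟨fun hs => P.recover hne hlt (by linarith) hs.le (by linarith) (g1 hs),
      fun hs => P.recover hne hlt (by linarith) (by linarith) (by linarith) (g2 hs)⟩
  have ladder : ∀ k (n : ℕ) β, 0 < β → β < 1 → 1 < β + n * α → Q k β → ∃ β', 0 < β' ∧ β' < 1 ∧ Q (k+1) β' := by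
    intro k n
    induction n with
    | zero => intro β hβ hβ1 hn; simp at hn; linarith
    | succ n ih =>
      intro β hβ hβ1 hn hq
      push_cast at hn
      rcases lt_trichotomy (α + β) 1 with hs | hs | hs
      · exact ih (α + β) (by linarith) hs (by linarith) ((step k β hβ hβ1 hq).1 hs)
      · -- decrease the exponent a little, then climb twice
        have hβ2 : 0 < β / 2 := by linarith
        obtain ⟨ρ, hρ, hρ1, hl⟩ := hq
        have hm : 0 < min α β / 2 := by have := lt_min h0 hβ; linarith
        have hm1 : min α β ≤ α := min_le_left _ _
        have hm2 : min α β ≤ β := min_le_right _ _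
        have hb' : 0 < β - min α β / 2 := by linarith
        have q1 : Q k (β - min α β / 2) := ⟨ρ, hρ, hρ1, Lk_exp hb' (by linarith) hl⟩
        have q2 := (step k _ hb' (by linarith) q1).1 (by linarith)
        have q3 := (step k _ (by linarith) (by linarith) q2).2 (by linarith)
        exact ⟨_, by linarith, by linarith, q3⟩
      · exact ⟨_, by linarith, by linarith, (step k β hβ hβ1 hq).2 hs⟩
  have all : ∀ k, ∃ β, 0 < β ∧ β < 1 ∧ Q k β := by
    intro k
    induction k with
    | zero =>
      obtain ⟨H, hH, hh⟩ := P.holder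
      exact ⟨α, h0, h1, 1, one_pos, le_rfl, H, fun x _ y _ => hh x y⟩
    | succ k ih =>
      obtain ⟨β, hβ, hβ1, hq⟩ := ih
      obtain ⟨n, hn⟩ := exists_nat_gt ((1 - β) / α)
      rw [div_lt_iff₀ h0] at hn
      exact ladder k n β hβ hβ1 (by linarith) hq
  rw [contDiffAt_infty]
  intro k
  obtain ⟨β, hβ, hβ1, ρ, hρ, hρ1, hl⟩ := all k
  exact (Lk_contDiffOn hβ hl).contDiffAt (Ioo_mem_nhds (by linarith) (by linarith))
end


section
variable {α p c : ℝ} {ψ : ℝ → ℝ}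

lemma Prof.abs_lt_one (P : Prof α p c ψ) {x : ℝ} (h1 : 0 < x) (h2 : x < π) : |ψ x| < 1 := by
  have a := P.strict le_rfl h1 h2.le
  have b := P.strict h1.le h2 le_rfl
  rw [P.sym.pi_eq] at b
  rw [P.one] at a b
  exact abs_lt.2 ⟨b, a⟩

lemma Prof.conv_zero_lt (P : Prof α p c ψ) : conv α ψ 0 < ∫ x in (-π)..π, |Kker α x| := by
  have hpi := Real.pi_pos
  have h0 := P.h0
  have h1 := P.h1
  rw [conv_sub P.sym.periodic]
  have hcf : Continuous fun z => ψ (0 - z) := P.sym.cont.comp (by fun_prop)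
  have hi1 : ∀ a b, IntervalIntegrable (fun z => |Kker α z|) volume a b := fun a b => (Kker_intervalIntegrable h0 h1 a b).abs
  have hi2 : ∀ a b, IntervalIntegrable (fun z => Kker α z * ψ (0 - z)) volume a b := fun a b =>
    (Kker_intervalIntegrable h0 h1 a b).mul_continuousOn hcf.continuousOn
  have hle : ∀ z, 0 ≤ |Kker α z| - Kker α z * ψ (0 - z) := by
    intro z
    have h2 : |ψ (0 - z)| ≤ 1 := by have := P.sym.abs_le (0 - z); rwa [P.one] at this
    have h3 : |Kker α z * ψ (0 - z)| ≤ |Kker α z| := by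
      rw [abs_mul]; exact mul_le_of_le_one_right (abs_nonneg _) h2
    linarith [le_abs_self (Kker α z * ψ (0 - z))]
  have hlt : ∀ z, 0 < z → z < π → Kker α z ≠ 0 → 0 < |Kker α z| - Kker α z * ψ (0 - z) := by
    intro z hz hz2 hK
    have h2 : |ψ (0 - z)| < 1 := by rw [zero_sub, P.sym.even]; exact P.abs_lt_one hz hz2
    have h3 : |Kker α z * ψ (0 - z)| < |Kker α z| := by
      rw [abs_mul]; exact mul_lt_of_lt_one_right (abs_pos.2 hK) h2
    linarith [le_abs_self (Kker α z * ψ (0 - z))]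
  obtain ⟨a, b, ha, hab, hb, hK⟩ : ∃ a b, 0 ≤ a ∧ a < b ∧ b ≤ π ∧ ∀ z ∈ Ioo a b, Kker α z ≠ 0 := by
    by_cases h : 0 ≤ Kker α (π/2)
    · refine ⟨0, π/2, le_rfl, by linarith, by linarith, fun z hz => ?_⟩
      have := Kker_lt h0 (x := π/2) (y := z) (Real.cos_lt_cos_of_nonneg_of_le_pi hz.1.le (by linarith) hz.2)
        (cos_lt_one_of hz.1.ne' (by rw [abs_of_pos hz.1]; linarith [hz.2]))
      linarith
    · push Not at h
      refine ⟨π/2, π, by linarith, by linarith, le_rfl, fun z hz => ?_⟩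
      have := Kker_lt h0 (x := z) (y := π/2) (Real.cos_lt_cos_of_nonneg_of_le_pi (by linarith) hz.2.le hz.1)
        (by simp)
      linarith
  have k1 : 0 < ∫ z in a..b, (|Kker α z| - Kker α z * ψ (0 - z)) :=
    intervalIntegral.intervalIntegral_pos_of_pos_on ((hi1 _ _).sub (hi2 _ _))
      (fun z hz => hlt z (by linarith [hz.1]) (by linarith [hz.2]) (hK z hz)) hab
  have k2 : ∫ z in a..b, (|Kker α z| - Kker α z * ψ (0 - z)) ≤ ∫ z in (-π)..π, (|Kker α z| - Kker α z * ψ (0 - z)) := by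
    apply intervalIntegral.integral_mono_interval (by linarith) hab.le hb
    · exact Eventually.of_forall hle
    · exact (hi1 _ _).sub (hi2 _ _)
  have k3 := intervalIntegral.integral_sub (hi1 (-π) π) (hi2 (-π) π)
  linarith

lemma integral_antisym {f : ℝ → ℝ} (hf : Continuous f) (ha : ∀ x, f (x + π) = - f x) : ∫ y in (-π)..π, f y = 0 := by
  rw [← intervalIntegral.integral_add_adjacent_intervals (hf.intervalIntegrable (-π) 0) (hf.intervalIntegrable 0 π)]
  have := intervalIntegral.integral_comp_add_right (a := -π) (b := 0) f π
  simp only [ha, neg_add_cancel, zero_add, intervalIntegral.integral_neg] at this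
  rw [← this]; ring
end

/-- Existence of a highest, doubly-cusped, antisymmetric, exactly
`α`-Hölder periodic travelling wave for the nonlinearity `n(x) = x·|x|^(p-1)`. -/
theorem statement1 (α p : ℝ) (hα : α ∈ Set.Ioo (0:ℝ) 1) (hp : 1 < p) :
    ∃ (c : ℝ) (φ : ℝ → ℝ),
      0 < c ∧ c < (p / (p - 1)) * (∫ x in (-π)..π, |Kker α x|) ∧
      IsSteadySolution α c (nSgn p) φ ∧
      (∃ x, φ x ≠ 0) ∧
      (∀ x, φ (-x) = φ x) ∧
      (∀ x, φ (x + π) = -φ x) ∧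
      φ (-π) = -((c / p) ^ (1 / (p - 1))) ∧
      φ 0 = (c / p) ^ (1 / (p - 1)) ∧
      (∀ x, -((c / p) ^ (1 / (p - 1))) ≤ φ x ∧ φ x ≤ (c / p) ^ (1 / (p - 1))) ∧
      (∃ C > 0, ∀ x y : ℝ, |φ x - φ y| ≤ C * |x - y| ^ α) ∧
      StrictMonoOn φ (Set.Ioo (-π) 0) ∧
      (∀ x ∈ Set.Ioo (-π) 0 ∪ Set.Ioo 0 π, φ x ≠ 0 → ContDiffAt ℝ (⊤ : ℕ∞) φ x) ∧
      (∃ δ > 0, ∃ c₁ > 0, ∃ c₂ > 0,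
        (∀ x : ℝ, |x| ≤ δ →
          c₁ * |x| ^ α ≤ (c / p) ^ (1 / (p - 1)) - φ x ∧
          (c / p) ^ (1 / (p - 1)) - φ x ≤ c₂ * |x| ^ α) ∧
        (∀ x : ℝ, |x + π| ≤ δ →
          c₁ * |x + π| ^ α ≤ φ x + (c / p) ^ (1 / (p - 1)) ∧
          φ x + (c / p) ^ (1 / (p - 1)) ≤ c₂ * |x + π| ^ α)) := by
  obtain ⟨h0, h1⟩ := hα
  obtain ⟨ψ, hsym, hone, c, hc, heq⟩ := exists_profile h0 h1 hp
  have P : Prof α p c ψ := ⟨h0, h1, hp, hc, hsym, hone, heq⟩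
  have hpi := Real.pi_pos
  set μ := (c / p) ^ (1 / (p - 1)) with hμ
  have hcp : 0 < c / p := by positivity
  have hμ0 : 0 < μ := Real.rpow_pos_of_pos hcp _
  have hμp : μ ^ (p - 1) = c / p := by
    rw [hμ, ← Real.rpow_mul hcp.le, one_div, inv_mul_cancel₀ (by linarith), Real.rpow_one]
  have hψ1 : ∀ x, -1 ≤ ψ x ∧ ψ x ≤ 1 := by
    intro x
    have a := hsym.ge_neg x
    have b := hsym.le_zero x
    rw [hone] at a b
    exact ⟨a, b⟩
  have hanti : ∀ x, ψ (x + π) = - ψ x := hsym.anti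
  have hn : ∀ x, nSgn p (μ * ψ x) = μ * (c / p) * nSgn p (ψ x) := by
    intro x
    unfold nSgn
    rw [abs_mul, abs_of_pos hμ0, Real.mul_rpow hμ0.le (abs_nonneg _), hμp]; ring
  have hnc := nSgn_continuous hp
  have hψc := hsym.cont
  obtain ⟨A, hA, hup⟩ := P.upper
  obtain ⟨ε, hε, hlow⟩ := P.lower
  have hnear : ∀ x, |x| ≤ π → μ * ε * |x| ^ α ≤ μ - μ * ψ x ∧ μ - μ * ψ x ≤ μ * A * |x| ^ α := by
    intro x hx
    have e : ψ x = ψ |x| := by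
      rcases abs_choice x with h | h <;> rw [h]
      rw [hsym.even]
    have u := hup |x| (abs_nonneg _) hx
    have l := hlow |x| (abs_nonneg _) hx
    rw [e]
    constructor <;> nlinarith
  refine ⟨c, fun x => μ * ψ x, hc, ?_, ⟨by fun_prop, ?_, ?_, ?_⟩, ⟨0, ?_⟩, ?_, ?_, ?_, ?_, ?_, ?_, ?_, ?_, ?_⟩
  · have h := P.conv_zero_lt
    rw [P.eq, hone, gt_one hp] at h
    have hp1 : 0 < p - 1 := by linarith
    have e : c = (p / (p - 1)) * (c * (1 - 1 / p)) := by field_simp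
    rw [e]
    exact mul_lt_mul_of_pos_left h (by positivity)
  · intro x; simp only; rw [hsym.periodic]
  · apply integral_antisym (by fun_prop)
    intro x; rw [hanti]; ring
  · intro x
    have e1 : ∫ y in (-π)..π, nSgn p (μ * ψ y) = 0 := by
      apply integral_antisym (hnc.comp (by fun_prop))
      intro x; simp only [Function.comp]; rw [hanti, mul_neg, nSgn_neg]
    have e2 : ∫ y in (-π)..π, Kker α (x - y) * (μ * ψ y) = μ * conv α ψ x := by
      unfold conv
      rw [← intervalIntegral.integral_const_mul]
      congr 1; ext y; ring
    rw [e1, e2, hn, P.eq, gt_eq (hψ1 x).1 (hψ1 x).2]; ring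
  · simp only; rw [hone]; simp; exact hμ0.ne'
  · intro x; simp only; rw [hsym.even]
  · intro x; simp only; rw [hanti]; ring
  · simp only; rw [hsym.even, hsym.pi_eq, hone]; ring
  · simp only; rw [hone]; ring
  · intro x
    constructor <;> nlinarith [hψ1 x]
  · obtain ⟨H, hH, hh⟩ := P.holder
    refine ⟨μ * H, by positivity, fun x y => ?_⟩
    rw [← mul_sub, abs_mul, abs_of_pos hμ0, mul_assoc]
    exact mul_le_mul_of_nonneg_left (hh x y) hμ0.le
  · intro x hx y hy hxy
    have := P.strict (x := -y) (y := -x) (by linarith [hy.2]) (by linarith) (by linarith [hx.1])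
    rw [hsym.even, hsym.even] at this
    exact mul_lt_mul_of_pos_left this hμ0
  · intro x hx hne
    have hne' : ψ x ≠ 0 := fun h => hne (by simp only; rw [h, mul_zero])
    have hlt : |ψ x| < 1 := by
      rcases hx with hx | hx
      · rw [← hsym.even]; exact P.abs_lt_one (by linarith [hx.2]) (by linarith [hx.1])
      · exact P.abs_lt_one hx.1 hx.2
    exact contDiffAt_const.mul (P.smooth hne' hlt)
  · refine ⟨π, hpi, μ * ε, by positivity, μ * A, by positivity, hnear, fun x hx => ?_⟩
    have := hnear (x + π) hx
    rw [hanti] at this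
    constructor <;> linarith [this.1, this.2]
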